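/- arXiv:1403.6852 — 3 statements merged into one kernel-verified Lean document; each statement's English description precedes it below -/
import Mathlib

section
/- Let k be a field, let n ≥ 1, d ≥ 0 be integers, let 0 ≤ s ≤ n+1, and let m_1,…,m_s be integers with 0 ≤ m_i ≤ d+1 for all i. Then the dimension over k of the space of homogeneous polynomials of degree d in k[x_1,…,x_{n+1}] having multiplicity at least m_i at the coordinate point e_i of ℙ^n for i = 1,…,s equals the linear virtual dimension ℓ(n,d; m_1,…,m_s) = Σ_{I ⊆ {1,…,s}} (−1)^{|I|} · binom(n + k_I − |I|, n). (This is the equality h^0(D) = ldim(D) of the classification theorem for toric divisors with multiplicities bounded by d+1.) -/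
open MvPolynomial Finset

noncomputable section

/-- The homogeneous vanishing ideal of the point of `ℙ^{N-1}` represented by the
vector `v`: the ideal generated by the linear forms vanishing at `v`. -/
def pointIdeal (k : Type) [Field k] (N : ℕ) (v : Fin N → k) :
    Ideal (MvPolynomial (Fin N) k) :=
  Ideal.span {P | P ∈ homogeneousSubmodule (Fin N) k 1 ∧ eval v P = 0}

/-- The homogeneous vanishing ideal `(x_j : j ≠ i)` of the `i`-th coordinate point. -/
def coordIdeal (k : Type) [Field k] (N : ℕ) (i : ℕ) :
    Ideal (MvPolynomial (Fin N) k) :=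
  Ideal.span {P | ∃ j : Fin N, (j : ℕ) ≠ i ∧ P = X j}

/-- The linear system `L_{n,d}(m_1,…,m_s; p_1,…,p_s)` of degree-`d` forms in `n+1`
variables with multiplicity at least `m i` at the point `p i`, for `i < s`. -/
def linSys (k : Type) [Field k] (n d s : ℕ) (m : ℕ → ℕ)
    (p : ℕ → (Fin (n + 1) → k)) : Submodule k (MvPolynomial (Fin (n + 1)) k) :=
  (homogeneousSubmodule (Fin (n + 1)) k d) ⊓
    ⨅ i ∈ Finset.range s,
      Submodule.restrictScalars k (pointIdeal k (n + 1) (p i) ^ (m i))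

/-- The generic dimension of `L_{n,d}(m_1,…,m_s)`: the minimum over all `s`-tuples of
points of `ℙ^n(k)` of the dimension of the corresponding linear system. -/
def gdim (k : Type) [Field k] (n d s : ℕ) (m : ℕ → ℕ) : ℕ :=
  sInf {N | ∃ p : ℕ → (Fin (n + 1) → k),
    (∀ i < s, p i ≠ 0) ∧ N = Module.finrank k ↥(linSys k n d s m p)}

/-- `k_I = max(Σ_{i∈I} m_i − (|I|−1)d, 0)`. -/
def kIdx (d : ℕ) (m : ℕ → ℕ) (I : Finset ℕ) : ℤ :=
  max ((∑ i ∈ I, (m i : ℤ)) - ((I.card : ℤ) - 1) * d) 0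

/-- `binom(a, n)`, understood to be `0` whenever `a < n` (in particular for negative `a`). -/
def binomZ (a : ℤ) (n : ℕ) : ℤ :=
  if a < (n : ℤ) then 0 else ((a.toNat).choose n : ℤ)

/-- The (affine) linear virtual dimension
`ℓ(n,d;m_1,…,m_s) = Σ_{I ⊆ {1,…,s}} (−1)^{|I|} binom(n + k_I − |I|, n)`. -/
def ldim (n d s : ℕ) (m : ℕ → ℕ) : ℤ :=
  ∑ I ∈ (Finset.range s).powerset,
    (-1) ^ I.card * binomZ ((n : ℤ) + kIdx d m I - (I.card : ℤ)) n

/-- A polynomial lies in the `m`-th power of the ideal generated by the variables in `T` iff each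
of its monomials has degree at least `m` in these variables. -/
theorem mem_span_X_image_pow_iff {σ R : Type*} [Fintype σ] [DecidableEq σ] [CommRing R]
    (T : Finset σ) (m : ℕ) (p : MvPolynomial σ R) :
    p ∈ Ideal.span (X '' (T : Set σ) : Set (MvPolynomial σ R)) ^ m ↔
      ∀ a ∈ p.support, m ≤ ∑ j ∈ T, a j := by
  constructor
  · intro hp
    induction m generalizing p with
    | zero => simp
    | succ m ih =>
      rw [pow_succ] at hp
      induction hp using Submodule.mul_induction_on' with
      | mem_mul_mem q hq r hr =>
        intro a ha
        obtain ⟨x, hx, y, hy, rfl⟩ := Finset.mem_add.mp (support_mul q r ha)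
        obtain ⟨i, hi, hyi⟩ := mem_ideal_span_X_image.mp hr y hy
        have hle : y i ≤ ∑ j ∈ T, y j :=
          Finset.single_le_sum (f := fun j => y j) (fun _ _ => Nat.zero_le _) hi
        have hx' := ih q hq x hx
        simp only [Finsupp.add_apply, Finset.sum_add_distrib]
        omega
      | add q _ r _ hq hr =>
        intro a ha
        rcases Finset.mem_union.mp (support_add ha) with h | h
        exacts [hq a h, hr a h]
  · intro h
    rw [p.as_sum]
    refine Ideal.sum_mem _ fun a ha => Ideal.pow_le_pow_right (h a ha) ?_
    rw [monomial_eq, Finsupp.prod_fintype _ _ (by simp),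
      ← Finset.prod_mul_prod_compl T, ← Finset.prod_pow_eq_pow_sum]
    exact Ideal.mul_mem_left _ _ (Ideal.mul_mem_right _ _ (Ideal.prod_mem_prod fun j hj =>
      Ideal.pow_mem_pow (Ideal.subset_span (Set.mem_image_of_mem _ hj)) _))

theorem mem_coordIdeal_pow_iff (k : Type) [Field k] (N i m : ℕ)
    (p : MvPolynomial (Fin N) k) :
    p ∈ coordIdeal k N i ^ m ↔
      ∀ a ∈ p.support, m ≤ ∑ j ∈ univ.filter (fun j : Fin N => (j : ℕ) ≠ i), a j := by
  rw [← mem_span_X_image_pow_iff, coordIdeal]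
  have : {P : MvPolynomial (Fin N) k | ∃ j : Fin N, (j : ℕ) ≠ i ∧ P = X j} =
      X '' ((univ.filter fun j : Fin N => (j : ℕ) ≠ i : Finset (Fin N)) : Set (Fin N)) := by
    ext P
    simp [eq_comm]
  rw [this]

/-- The space of forms spanned by a finite set of monomials has that set as dimension. -/
theorem finrank_restrictSupport_finset {σ k : Type*} [Field k] (A : Finset (σ →₀ ℕ)) :
    Module.finrank k (restrictSupport k (A : Set (σ →₀ ℕ))) = #A := by
  rw [Module.finrank_eq_card_basis (basisRestrictSupport k (A : Set (σ →₀ ℕ)))]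
  simp

/-- Inclusion-exclusion for the elements of `A` satisfying none of the conditions `P i`. -/
theorem card_filter_forall_not {ι α : Type*} [DecidableEq ι] (s : Finset ι) (A : Finset α)
    (P : ι → α → Prop) [∀ i a, Decidable (P i a)] :
    (#{a ∈ A | ∀ i ∈ s, ¬ P i a} : ℤ) =
      ∑ t ∈ s.powerset, (-1) ^ #t * (#{a ∈ A | ∀ i ∈ t, P i a} : ℤ) := by
  simp_rw [Finset.card_filter, Nat.cast_sum, Finset.mul_sum]
  rw [Finset.sum_comm]
  refine Finset.sum_congr rfl fun a _ => ?_
  have h := Finset.prod_sub (fun _ => (1 : ℤ)) (fun i => if P i a then 1 else 0) s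
  have h₁ : ∀ i, (1 : ℤ) - (if P i a then 1 else 0) = if ¬ P i a then 1 else 0 := by
    intro i
    split_ifs <;> simp_all
  simp only [h₁, Finset.prod_const_one, mul_one, Finset.prod_boole] at h
  simpa using h

/-- The number of monomials of degree `d` in `n + 1` variables divisible by a fixed monomial. -/
theorem card_finsuppAntidiag_filter_le (n d : ℕ) (c : Fin (n + 1) →₀ ℕ) :
    #{a ∈ (univ : Finset (Fin (n + 1))).finsuppAntidiag d | c ≤ a} =
      if ∑ j, c j ≤ d then (n + (d - ∑ j, c j)).choose n else 0 := by
  have hadd : ∀ a b : Fin (n + 1) →₀ ℕ, univ.sum ⇑(a + b) = ∑ j, a j + ∑ j, b j :=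
    fun _ _ => Finset.sum_add_distrib
  split_ifs with h
  · have hcard : #((univ : Finset (Fin (n + 1))).finsuppAntidiag (d - ∑ j, c j)) =
        (n + (d - ∑ j, c j)).choose n := by
      rw [Finset.card_finsuppAntidiag_nat_eq_choose, Finset.card_univ, Fintype.card_fin,
        show n + 1 + (d - ∑ j, c j) - 1 = n + (d - ∑ j, c j) by omega, Nat.choose_symm_add]
    rw [← hcard]
    refine (Finset.card_bij (fun a _ => a + c) ?_ ?_ ?_).symm
    · intro a ha
      simp only [mem_finsuppAntidiag, Finset.subset_univ, and_true, Finset.mem_filter, hadd] at ha ⊢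
      exact ⟨by rw [ha]; omega, le_add_self⟩
    · intro a _ b _ hab
      exact add_right_cancel hab
    · intro a ha
      simp only [mem_finsuppAntidiag, Finset.subset_univ, and_true, Finset.mem_filter] at ha
      obtain ⟨b, rfl⟩ := exists_add_of_le ha.2
      refine ⟨b, ?_, add_comm _ _⟩
      simp only [mem_finsuppAntidiag, Finset.subset_univ, and_true, hadd] at ha ⊢
      exact Nat.eq_sub_of_add_eq' ha.1
  · rw [Finset.card_eq_zero, Finset.filter_eq_empty_iff]
    intro a ha hca
    simp only [mem_finsuppAntidiag, Finset.subset_univ, and_true] at ha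
    exact h (ha ▸ Finset.sum_le_sum fun j _ => hca j)

/-- The number of monomials of degree `d` whose exponent at each `i ∈ I` is at least
`d + 1 - m i` is the binomial coefficient attached to `I` in the linear virtual dimension. -/
theorem card_finsuppAntidiag_filter_eq_binomZ (n d : ℕ) (m : ℕ → ℕ) (I : Finset ℕ)
    (hI : I ⊆ Finset.range (n + 1)) (hm : ∀ i ∈ I, m i ≤ d + 1) :
    (#{a ∈ (univ : Finset (Fin (n + 1))).finsuppAntidiag d |
        ∀ i ∈ I, ∀ j : Fin (n + 1), (j : ℕ) = i → d + 1 - m i ≤ a j} : ℤ) =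
      binomZ ((n : ℤ) + kIdx d m I - (#I : ℤ)) n := by
  let c : Fin (n + 1) →₀ ℕ :=
    Finsupp.equivFunOnFinite.symm fun j => if (j : ℕ) ∈ I then d + 1 - m j else 0
  have hc : ∀ j, c j = if (j : ℕ) ∈ I then d + 1 - m j else 0 := fun _ => rfl
  have hfilter : {a ∈ (univ : Finset (Fin (n + 1))).finsuppAntidiag d |
      ∀ i ∈ I, ∀ j : Fin (n + 1), (j : ℕ) = i → d + 1 - m i ≤ a j} =
      {a ∈ (univ : Finset (Fin (n + 1))).finsuppAntidiag d | c ≤ a} := by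
    refine Finset.filter_congr fun a _ => ⟨fun h j => ?_, ?_⟩
    · rw [hc]
      split_ifs with hj
      exacts [h _ hj j rfl, Nat.zero_le _]
    · rintro h _ hi j rfl
      simpa [hc, hi] using h j
  have hsum : ∑ j, c j = ∑ i ∈ I, (d + 1 - m i) := by
    simp_rw [hc]
    rw [Fin.sum_univ_eq_sum_range (fun i => if i ∈ I then d + 1 - m i else 0),
      Finset.sum_ite_mem, Finset.inter_eq_right.mpr hI]
  have hcast : ((∑ i ∈ I, (d + 1 - m i) : ℕ) : ℤ) = #I * ((d : ℤ) + 1) - ∑ i ∈ I, (m i : ℤ) := by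
    rw [Nat.cast_sum, Finset.sum_congr rfl fun i hi => Nat.cast_sub (hm i hi)]
    simp
  rw [hfilter, card_finsuppAntidiag_filter_le, hsum, binomZ, kIdx]
  have key : (∑ i ∈ I, (m i : ℤ)) - ((#I : ℤ) - 1) * d =
      d - ((∑ i ∈ I, (d + 1 - m i) : ℕ) : ℤ) + #I := by
    rw [hcast]
    ring
  rw [key]
  have hempty : #I = 0 → ∑ i ∈ I, (d + 1 - m i) = 0 := by
    intro h
    simp [Finset.card_eq_zero.mp h]
  generalize ∑ i ∈ I, (d + 1 - m i) = S at hempty ⊢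
  by_cases h : S ≤ d
  · rw [if_pos h, if_neg (by omega), show
      ((n : ℤ) + max ((d : ℤ) - S + #I) 0 - #I).toNat = n + (d - S) by omega]
  · rw [if_neg h, if_pos (by omega)]
    rfl

/-- For `s ≤ n+1` coordinate points with multiplicities `m_i ≤ d+1`, the
dimension of the space of degree-`d` forms with multiplicity at least `m i` at the
coordinate point `e_i` equals the linear virtual dimension. -/
theorem stmt0 (k : Type) [Field k] (n d s : ℕ) (hn : 1 ≤ n) (hs : s ≤ n + 1)
    (m : ℕ → ℕ) (hm : ∀ i < s, m i ≤ d + 1) :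
    (Module.finrank k ↥((homogeneousSubmodule (Fin (n + 1)) k d) ⊓
        ⨅ i ∈ Finset.range s,
          Submodule.restrictScalars k (coordIdeal k (n + 1) i ^ (m i))) : ℤ)
      = ldim n d s m := by
  have hspace : (homogeneousSubmodule (Fin (n + 1)) k d) ⊓
      (⨅ i ∈ Finset.range s, Submodule.restrictScalars k (coordIdeal k (n + 1) i ^ (m i))) =
      restrictSupport k ({a ∈ (univ : Finset (Fin (n + 1))).finsuppAntidiag d |
        ∀ i ∈ Finset.range s, ¬ ∀ j : Fin (n + 1), (j : ℕ) = i → d + 1 - m i ≤ a j} :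
          Finset (Fin (n + 1) →₀ ℕ)) := by
    have hiff : ∀ a : Fin (n + 1) →₀ ℕ, ∑ j, a j = d → ∀ i < s,
        (m i ≤ ∑ j ∈ univ.filter (fun j : Fin (n + 1) => (j : ℕ) ≠ i), a j ↔
          ¬ ∀ j : Fin (n + 1), (j : ℕ) = i → d + 1 - m i ≤ a j) := by
      intro a ha i hi
      have hmi := hm i hi
      have hall : (∀ j : Fin (n + 1), (j : ℕ) = i → d + 1 - m i ≤ a j) ↔
          d + 1 - m i ≤ a ⟨i, hi.trans_le hs⟩ :=
        ⟨fun h => h _ rfl, by rintro h j rfl; exact h⟩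
      have hsplit := Finset.sum_filter_add_sum_filter_not univ
        (fun j : Fin (n + 1) => (j : ℕ) ≠ i) (fun j => a j)
      have hsingle : (univ.filter fun j : Fin (n + 1) => ¬ (j : ℕ) ≠ i) =
          {⟨i, hi.trans_le hs⟩} := by
        ext j
        simp [Fin.ext_iff]
      rw [hsingle, Finset.sum_singleton, ha] at hsplit
      rw [hall]
      omega
    ext p
    have hhom : p ∈ homogeneousSubmodule (Fin (n + 1)) k d ↔
        ∀ a ∈ p.support, ∑ j, a j = d := by
      rw [homogeneousSubmodule_eq_finsupp_supported]
      simp_rw [← Finsupp.degree_eq_sum]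
      rfl
    simp only [Submodule.mem_inf, Submodule.mem_iInf, Submodule.restrictScalars_mem,
      mem_coordIdeal_pow_iff, mem_restrictSupport_iff, hhom, Set.subset_def, Finset.mem_coe,
      Finset.mem_filter, mem_finsuppAntidiag, Finset.subset_univ, and_true, Finset.mem_range]
    constructor
    · rintro ⟨h₁, h₂⟩ a ha
      exact ⟨h₁ a ha, fun i hi => (hiff a (h₁ a ha) i hi).mp (h₂ i hi a ha)⟩
    · intro h
      exact ⟨fun a ha => (h a ha).1,
        fun i hi a ha => (hiff a (h a ha).1 i hi).mpr ((h a ha).2 i hi)⟩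
  rw [hspace, finrank_restrictSupport_finset, card_filter_forall_not, ldim]
  refine Finset.sum_congr rfl fun I hI => ?_
  have hIs := Finset.mem_powerset.mp hI
  rw [card_finsuppAntidiag_filter_eq_binomZ n d m I
    (hIs.trans (Finset.range_subset_range.mpr hs))
    fun i hi => hm i (Finset.mem_range.mp (hIs hi))]
end
end

section
/- Let k be an algebraically closed field of characteristic zero, let n ≥ 2, d ≥ 1, s ≥ n+3, and let m_1,…,m_s be integers with 1 ≤ m_i ≤ d for all i; let s(d) := #{i : m_i = d} and assume Σ_{i=1}^s m_i ≤ nd + min(n − s(d), s − n − 2). Then, with k'_{1i} := max(m_1 + m_i − d − 1, 0) for 2 ≤ i ≤ s, one has the recursion gdim L_{n,d}(m_1, m_2,…,m_s) = gdim L_{n,d}(m_1 − 1, m_2,…,m_s) − gdim L_{n−1, m_1−1}(k'_{12},…,k'_{1s}). (This is the equality h^0(D) = h^0(D') − h^0(D'_{(1)}|_{E_1}) established for divisors satisfying the effectivity bound.) -/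
open MvPolynomial Finset

noncomputable section

/-- The expansion `F(p + T y)` of a polynomial `F` around the point `p`, as a polynomial in `T`
whose coefficients are polynomials in the direction `y`. -/
def expandAt {k σ : Type*} [Field k] (p : σ → k) :
    MvPolynomial σ k →ₐ[k] Polynomial (MvPolynomial σ k) :=
  aeval fun i => Polynomial.C (C (p i)) + Polynomial.X * Polynomial.C (X i)

/-- `F` vanishes to order at least `c` at the point `p`. -/
def VanishesTo {k σ : Type*} [Field k] (c : ℕ) (p : σ → k) (F : MvPolynomial σ k) : Prop :=
  Polynomial.X ^ c ∣ expandAt p F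

section Expand

variable {k σ τ : Type*} [Field k]

@[simp]
lemma expandAt_X (p : σ → k) (i : σ) :
    expandAt p (X i) = Polynomial.C (C (p i)) + Polynomial.X * Polynomial.C (X i) := by
  simp [expandAt]

@[simp]
lemma expandAt_C (p : σ → k) (a : k) : expandAt p (C a) = Polynomial.C (C a) := by
  simp [expandAt, Polynomial.algebraMap_apply, MvPolynomial.algebraMap_eq]

lemma VanishesTo.mono {c c' : ℕ} {p : σ → k} {F : MvPolynomial σ k} (h : c' ≤ c)
    (hF : VanishesTo c p F) : VanishesTo c' p F :=
  (pow_dvd_pow _ h).trans hF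

@[simp]
lemma vanishesTo_zero_left (p : σ → k) (F : MvPolynomial σ k) : VanishesTo 0 p F := by
  simp [VanishesTo]

@[simp]
lemma vanishesTo_zero_right (c : ℕ) (p : σ → k) : VanishesTo c p (0 : MvPolynomial σ k) := by
  simp [VanishesTo]

lemma VanishesTo.add {c : ℕ} {p : σ → k} {F G : MvPolynomial σ k}
    (hF : VanishesTo c p F) (hG : VanishesTo c p G) : VanishesTo c p (F + G) := by
  unfold VanishesTo; rw [map_add]; exact dvd_add hF hG

lemma VanishesTo.smul {c : ℕ} {p : σ → k} {F : MvPolynomial σ k} (a : k)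
    (hF : VanishesTo c p F) : VanishesTo c p (a • F) := by
  unfold VanishesTo; rw [map_smul]; exact (Algebra.smul_def a (expandAt p F)).symm ▸ Dvd.dvd.mul_left hF _

lemma VanishesTo.mul {c c' : ℕ} {p : σ → k} {F G : MvPolynomial σ k}
    (hF : VanishesTo c p F) (hG : VanishesTo c' p G) : VanishesTo (c + c') p (F * G) := by
  unfold VanishesTo; rw [map_mul, pow_add]; exact mul_dvd_mul hF hG

/-- The linear form with coefficient vector `a`. -/
def linForm [Fintype σ] (a : σ → k) : MvPolynomial σ k := ∑ i, C (a i) * X i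

lemma isHomogeneous_linForm [Fintype σ] (a : σ → k) : (linForm a).IsHomogeneous 1 :=
  IsHomogeneous.sum _ _ _ fun i _ => by
    simpa using (isHomogeneous_C σ (a i)).mul (isHomogeneous_X k i)

@[simp]
lemma eval_linForm [Fintype σ] (a v : σ → k) : eval v (linForm a) = ∑ i, a i * v i := by
  simp [linForm]

lemma expandAt_linForm [Fintype σ] (p a : σ → k) :
    expandAt p (linForm a) =
      Polynomial.C (C (eval p (linForm a))) + Polynomial.X * Polynomial.C (linForm a) := by
  simp only [linForm, map_sum, map_mul, expandAt_C, expandAt_X, eval_C, eval_X]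
  rw [Finset.mul_sum, ← Finset.sum_add_distrib]
  exact Finset.sum_congr rfl fun i _ => by ring

lemma coeff_linForm [Fintype σ] [DecidableEq σ] (a : σ → k) (i : σ) :
    eval (Pi.single i 1) (linForm a) = a i := by
  simp [Pi.single_apply]

lemma linForm_ne_zero [Fintype σ] {a : σ → k} (ha : a ≠ 0) : linForm a ≠ 0 := by
  classical
  intro h
  apply ha
  funext i
  rw [← coeff_linForm a i, h]; simp

lemma VanishesTo.linForm_mul [Fintype σ] {c : ℕ} {p a : σ → k} {F : MvPolynomial σ k}
    (ha : eval p (linForm a) = 0) (hF : VanishesTo (c - 1) p F) :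
    VanishesTo c p (linForm a * F) := by
  have h1 : VanishesTo 1 p (linForm a) := by
    unfold VanishesTo; rw [expandAt_linForm, ha]; simp
  exact (h1.mul hF).mono (by omega)

lemma isCoprime_X_expandAt_linForm [Fintype σ] {p a : σ → k} (ha : eval p (linForm a) ≠ 0) :
    IsCoprime Polynomial.X (expandAt p (linForm a)) := by
  rw [expandAt_linForm, IsCoprime.add_mul_left_right_iff]
  have hu : IsUnit (C (eval p (linForm a)) : MvPolynomial σ k) :=
    (isUnit_iff_ne_zero.mpr ha).map C
  exact isCoprime_one_right.of_isCoprime_of_dvd_right (hu.map Polynomial.C).dvd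

lemma VanishesTo.of_linForm_mul' [Fintype σ] {c : ℕ} {p a : σ → k} {F : MvPolynomial σ k}
    (ha : eval p (linForm a) ≠ 0) (hF : VanishesTo c p (linForm a * F)) : VanishesTo c p F := by
  unfold VanishesTo at hF ⊢
  rw [map_mul] at hF
  exact (isCoprime_X_expandAt_linForm ha).pow_left.dvd_of_dvd_mul_left hF

lemma VanishesTo.of_linForm_mul [Fintype σ] {c : ℕ} {p a : σ → k} {F : MvPolynomial σ k}
    (ha : a ≠ 0) (hF : VanishesTo c p (linForm a * F)) : VanishesTo (c - 1) p F := by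
  by_cases h0 : eval p (linForm a) = 0
  · rcases c with _ | c
    · simp
    unfold VanishesTo at hF ⊢
    rw [map_mul, expandAt_linForm, h0, map_zero, map_zero, zero_add, mul_assoc, pow_succ',
      mul_dvd_mul_iff_left Polynomial.X_ne_zero, Polynomial.X_pow_dvd_iff] at hF
    rw [Polynomial.X_pow_dvd_iff]
    intro j hj
    have := hF j hj
    rw [Polynomial.coeff_C_mul] at this
    exact (mul_eq_zero.mp this).resolve_left (linForm_ne_zero ha)
  · exact (hF.of_linForm_mul' h0).mono (Nat.sub_le _ _)

/-- Substitution of the linear map given by a matrix. -/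
def linSubst [Fintype σ] (A : Matrix τ σ k) : MvPolynomial τ k →ₐ[k] MvPolynomial σ k :=
  aeval fun t => linForm (A t)

@[simp]
lemma linSubst_X [Fintype σ] (A : Matrix τ σ k) (t : τ) : linSubst A (X t) = linForm (A t) := by
  simp [linSubst]

lemma linSubst_isHomogeneous [Fintype σ] (A : Matrix τ σ k) {F : MvPolynomial τ k} {d : ℕ}
    (hF : F.IsHomogeneous d) : (linSubst A F).IsHomogeneous d := by
  have h := hF.aeval (fun t => linForm (A t)) fun t => isHomogeneous_linForm (A t)
  rwa [one_mul] at h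

lemma linSubst_linSubst [Fintype σ] [Fintype τ] {υ : Type*} (A : Matrix τ σ k) (B : Matrix υ τ k)
    (F : MvPolynomial υ k) : linSubst A (linSubst B F) = linSubst (B * A) F := by
  suffices h : (linSubst A).comp (linSubst B) = linSubst (B * A) from DFunLike.congr_fun h F
  ext1 i
  simp only [AlgHom.comp_apply, linSubst_X, linForm, map_sum, map_mul, algHom_C, algebraMap_eq,
    Matrix.mul_apply, Finset.mul_sum, Finset.sum_mul]
  rw [Finset.sum_comm]
  exact Finset.sum_congr rfl fun i _ => Finset.sum_congr rfl fun j _ => by ring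

lemma linSubst_one [Fintype σ] [DecidableEq σ] (F : MvPolynomial σ k) :
    linSubst (1 : Matrix σ σ k) F = F := by
  suffices h : linSubst (1 : Matrix σ σ k) = AlgHom.id k _ from DFunLike.congr_fun h F
  ext1 i
  simp [linForm, Matrix.one_apply]

lemma expandAt_linSubst [Fintype σ] (A : Matrix τ σ k) (p : σ → k) (F : MvPolynomial τ k) :
    expandAt p (linSubst A F) = Polynomial.mapAlgHom (linSubst A) (expandAt (A.mulVec p) F) := by
  suffices h : (expandAt p).comp (linSubst A) =
      (Polynomial.mapAlgHom (linSubst A)).comp (expandAt (A.mulVec p)) from DFunLike.congr_fun h F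
  ext1 i
  simp [expandAt_linForm, Matrix.mulVec, dotProduct, Polynomial.mapAlgHom, Polynomial.map_sum]

lemma VanishesTo.linSubst [Fintype σ] {c : ℕ} {A : Matrix τ σ k} {p : σ → k}
    {F : MvPolynomial τ k} (hF : VanishesTo c (A.mulVec p) F) :
    VanishesTo c p (linSubst A F) := by
  unfold VanishesTo at hF ⊢
  rw [expandAt_linSubst]
  simpa using map_dvd (Polynomial.mapAlgHom (_root_.linSubst A)) hF

end Expand

section HeadCoeff

variable {k : Type*} [Field k] {n : ℕ}

/-- The coefficient of `X 0 ^ j` in `F`, as a polynomial in the remaining variables. -/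
def headCoeff (j : ℕ) (F : MvPolynomial (Fin (n + 1)) k) : MvPolynomial (Fin n) k :=
  (finSuccEquiv k n F).coeff j

@[simp]
lemma headCoeff_add (j : ℕ) (F G : MvPolynomial (Fin (n + 1)) k) :
    headCoeff j (F + G) = headCoeff j F + headCoeff j G := by
  simp [headCoeff]

@[simp]
lemma headCoeff_smul (j : ℕ) (a : k) (F : MvPolynomial (Fin (n + 1)) k) :
    headCoeff j (a • F) = a • headCoeff j F := by
  simp [headCoeff]

lemma finSuccEquiv_C (a : k) : finSuccEquiv k n (C a) = Polynomial.C (C a) :=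
  (finSuccEquiv k n).commutes a

lemma headCoeff_isHomogeneous {d : ℕ} {F : MvPolynomial (Fin (n + 1)) k} (hF : F.IsHomogeneous d)
    {j : ℕ} (hj : j ≤ d) : (headCoeff j F).IsHomogeneous (d - j) :=
  hF.finSuccEquiv_coeff_isHomogeneous j (d - j) (by omega)

lemma headCoeff_eq_zero {d : ℕ} {F : MvPolynomial (Fin (n + 1)) k} (hF : F.IsHomogeneous d)
    {j : ℕ} (hj : d < j) : headCoeff j F = 0 := by
  by_contra h
  obtain ⟨μ, hμ⟩ := MvPolynomial.ne_zero_iff.mp h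
  rw [headCoeff, finSuccEquiv_coeff_coeff] at hμ
  have h1 := hF hμ
  rw [Finsupp.weight_apply, Finsupp.sum_fintype _ _ (by simp), Fin.sum_univ_succ] at h1
  simp at h1
  omega

lemma eq_sum_headCoeff {d : ℕ} {F : MvPolynomial (Fin (n + 1)) k} (hF : ∀ j, d < j → headCoeff j F = 0) :
    F = ∑ j ∈ range (d + 1), X 0 ^ j * rename Fin.succ (headCoeff j F) := by
  have hr : ∀ G : MvPolynomial (Fin n) k,
      finSuccEquiv k n (rename Fin.succ G) = Polynomial.C G := by
    intro G
    induction G using MvPolynomial.induction_on with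
    | C a => rw [rename_C, finSuccEquiv_C]
    | add p q hp hq => simp [hp, hq]
    | mul_X p i hp => simp [hp, finSuccEquiv_X_succ]
  apply (finSuccEquiv k n).injective
  rw [map_sum]
  have hd : (finSuccEquiv k n F).natDegree < d + 1 :=
    Nat.lt_succ_of_le (Polynomial.natDegree_le_iff_coeff_eq_zero.mpr fun j hj => hF j hj)
  conv_lhs => rw [Polynomial.as_sum_range' _ _ hd]
  refine Finset.sum_congr rfl fun j _ => ?_
  rw [map_mul, map_pow, finSuccEquiv_X_zero, hr, ← Polynomial.C_mul_X_pow_eq_monomial, mul_comm,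
    headCoeff]

lemma eq_zero_of_headCoeff_eq_zero {F : MvPolynomial (Fin (n + 1)) k} (hF : ∀ j, headCoeff j F = 0) :
    F = 0 :=
  (finSuccEquiv k n).injective (Polynomial.ext fun j => by rw [map_zero]; exact hF j)

lemma exists_eq_X_mul {F : MvPolynomial (Fin (n + 1)) k} (hF : headCoeff 0 F = 0) :
    ∃ G, F = X 0 * G := by
  obtain ⟨P, hP⟩ := Polynomial.X_dvd_iff.mpr hF
  refine ⟨(finSuccEquiv k n).symm P, (finSuccEquiv k n).injective ?_⟩
  rw [hP, map_mul, finSuccEquiv_X_zero, AlgEquiv.apply_symm_apply]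

/-- The expansion of the head coefficients of `F` around a point. -/
def headExpand (q : Fin n → k) (F : MvPolynomial (Fin (n + 1)) k) :
    Polynomial (Polynomial (MvPolynomial (Fin n) k)) :=
  (finSuccEquiv k n F).map (expandAt q : MvPolynomial (Fin n) k →+* _)

lemma coeff_headExpand (q : Fin n → k) (F : MvPolynomial (Fin (n + 1)) k) (j : ℕ) :
    (headExpand q F).coeff j = expandAt q (headCoeff j F) := by
  simp [headExpand, headCoeff]

lemma dvd_coeff_taylor {c : ℕ} {x : k} {q : Fin n → k} {F : MvPolynomial (Fin (n + 1)) k}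
    (hF : VanishesTo c (Fin.cons x q : Fin (n + 1) → k) F) (i : ℕ) :
    Polynomial.X ^ c ∣
      (Polynomial.taylor (Polynomial.C (C x)) (headExpand q F)).coeff i * Polynomial.X ^ i := by
  let Θ : Polynomial (MvPolynomial (Fin (n + 1)) k) →+*
      Polynomial (Polynomial (MvPolynomial (Fin n) k)) :=
    Polynomial.eval₂RingHom (R := MvPolynomial (Fin (n + 1)) k)
      (S := Polynomial (Polynomial (MvPolynomial (Fin n) k)))
      ((Polynomial.mapRingHom (Polynomial.C : MvPolynomial (Fin n) k →+* _)).comp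
        (finSuccEquiv k n : MvPolynomial (Fin (n + 1)) k →+* Polynomial (MvPolynomial (Fin n) k)))
      (Polynomial.C Polynomial.X)
  have key : Θ.comp (expandAt (Fin.cons x q : Fin (n + 1) → k) :
        MvPolynomial (Fin (n + 1)) k →+* _) =
      (Polynomial.compRingHom (Polynomial.C Polynomial.X * Polynomial.X)).comp
        ((Polynomial.taylorAlgHom (Polynomial.C (C x) : Polynomial (MvPolynomial (Fin n) k)) :
            Polynomial (Polynomial (MvPolynomial (Fin n) k)) →+* _).comp
        ((Polynomial.mapRingHom (expandAt q : MvPolynomial (Fin n) k →+* _)).comp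
          (finSuccEquiv k n : MvPolynomial (Fin (n + 1)) k →+* _))) := by
    apply MvPolynomial.ringHom_ext
    · intro a
      simp [Θ, finSuccEquiv_C]
    · intro i
      refine Fin.cases ?_ (fun j => ?_) i
      · simp [Θ, finSuccEquiv_X_zero, finSuccEquiv_C, add_comm]
      · simp [Θ, finSuccEquiv_X_succ, finSuccEquiv_C]
  have h1 : Θ (Polynomial.X ^ c) ∣ Θ (expandAt (Fin.cons x q : Fin (n + 1) → k) F) :=
    map_dvd Θ hF
  have h2 : Θ (expandAt (Fin.cons x q : Fin (n + 1) → k) F) =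
      (Polynomial.taylor (Polynomial.C (C x)) (headExpand q F)).comp
        (Polynomial.C Polynomial.X * Polynomial.X) := DFunLike.congr_fun key F
  have h3 : Θ (Polynomial.X ^ c) = Polynomial.C (Polynomial.X ^ c) := by simp [Θ]
  rw [h2, h3, Polynomial.C_dvd_iff_dvd_coeff] at h1
  have h4 := h1 i
  rwa [Polynomial.comp_C_mul_X_coeff] at h4

lemma VanishesTo.headCoeff_of_le {c e : ℕ} {x : k} {q : Fin n → k}
    {F : MvPolynomial (Fin (n + 1)) k} (hF : VanishesTo c (Fin.cons x q : Fin (n + 1) → k) F)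
    (he : ∀ j, e < j → headCoeff j F = 0) (j : ℕ) : VanishesTo (c - e) q (headCoeff j F) := by
  have hdeg : (headExpand q F).natDegree ≤ e :=
    Polynomial.natDegree_le_iff_coeff_eq_zero.mpr fun j hj => by
      rw [coeff_headExpand, he j hj, map_zero]
  have h1 : Polynomial.C (Polynomial.X ^ (c - e)) ∣
      Polynomial.taylor (Polynomial.C (C x)) (headExpand q F) := by
    rw [Polynomial.C_dvd_iff_dvd_coeff]
    intro i
    by_cases hi : e < i
    · rw [Polynomial.coeff_eq_zero_of_natDegree_lt]
      · simp
      · rw [Polynomial.natDegree_taylor]; omega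
    · have h2 := dvd_coeff_taylor hF i
      by_cases hc : c ≤ e
      · simp [Nat.sub_eq_zero_of_le hc]
      · rw [show c = (c - i) + i by omega, pow_add,
          mul_dvd_mul_iff_right (pow_ne_zero _ Polynomial.X_ne_zero)] at h2
        exact (pow_dvd_pow _ (by omega)).trans h2
  have h2 := map_dvd (Polynomial.taylorAlgHom (-(Polynomial.C (C x)) :
    Polynomial (MvPolynomial (Fin n) k))) h1
  change Polynomial.taylor _ _ ∣ Polynomial.taylor _ (Polynomial.taylor _ _) at h2
  rw [Polynomial.taylor_taylor] at h2
  simp only [neg_add_cancel, Polynomial.taylor_zero, Polynomial.taylor_C] at h2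
  rw [Polynomial.C_dvd_iff_dvd_coeff] at h2
  simpa [VanishesTo, coeff_headExpand] using h2 j

lemma VanishesTo.headCoeff_zero {c : ℕ} {q : Fin n → k}
    {F : MvPolynomial (Fin (n + 1)) k} (hF : VanishesTo c (Fin.cons 0 q : Fin (n + 1) → k) F) :
    VanishesTo c q (headCoeff 0 F) := by
  have h := dvd_coeff_taylor hF 0
  simpa [coeff_headExpand, VanishesTo] using h

lemma expandAt_zero {σ : Type*} [Fintype σ] {d : ℕ} {F : MvPolynomial σ k} (hF : F.IsHomogeneous d) :
    expandAt 0 F = Polynomial.C F * Polynomial.X ^ d := by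
  conv_lhs => rw [F.as_sum]
  conv_rhs => rw [F.as_sum]
  rw [map_sum, map_sum, Finset.sum_mul]
  refine Finset.sum_congr rfl fun μ hμ => ?_
  rw [monomial_eq, map_mul, expandAt_C, map_mul, mul_assoc]
  congr 1
  have h1 : d = ∑ i, μ i := by
    have := hF (mem_support_iff.mp hμ)
    rw [Finsupp.weight_apply, Finsupp.sum_fintype _ _ (by simp)] at this
    simpa using this.symm
  rw [Finsupp.prod_fintype _ _ (by simp), map_prod, map_prod, h1, ← Finset.prod_pow_eq_pow_sum,
    ← Finset.prod_mul_distrib]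
  refine Finset.prod_congr rfl fun i _ => ?_
  rw [map_pow, map_pow, expandAt_X, Pi.zero_apply, map_zero, map_zero, zero_add, mul_pow, mul_comm]

lemma VanishesTo.headCoeff_eq_zero {c d : ℕ} {F : MvPolynomial (Fin (n + 1)) k}
    (hd : F.IsHomogeneous d) (hF : VanishesTo c (Fin.cons 1 0 : Fin (n + 1) → k) F)
    {j : ℕ} (hj : d < j + c) : headCoeff j F = 0 := by
  by_cases hjd : d < j
  · exact _root_.headCoeff_eq_zero hd hjd
  have h := dvd_coeff_taylor hF 0
  rw [pow_zero, mul_one, Polynomial.taylor_coeff_zero, Polynomial.eval_eq_sum_range'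
    (n := d + 1)] at h
  · rw [Polynomial.X_pow_dvd_iff] at h
    have h1 := h (d - j) (by omega)
    rw [Polynomial.finsetSum_coeff, Finset.sum_eq_single j] at h1
    · rw [coeff_headExpand, expandAt_zero (headCoeff_isHomogeneous hd (by omega))] at h1
      simpa [mul_assoc] using h1
    · intro i hi hij
      rw [mem_range] at hi
      rw [coeff_headExpand, expandAt_zero (headCoeff_isHomogeneous hd (by omega))]
      simp only [map_one, one_pow, mul_one, Polynomial.coeff_C_mul, Polynomial.coeff_X_pow]
      rw [if_neg (by omega), mul_zero]
    · intro hj'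
      exact absurd (mem_range.mpr (by omega)) hj'
  · exact Nat.lt_succ_of_le (Polynomial.natDegree_le_iff_coeff_eq_zero.mpr fun j hj => by
      rw [coeff_headExpand, _root_.headCoeff_eq_zero hd hj, map_zero])

lemma expandAt_rename_succ (x : k) (q : Fin n → k) (G : MvPolynomial (Fin n) k) :
    expandAt (Fin.cons x q : Fin (n + 1) → k) (rename Fin.succ G) =
      Polynomial.mapAlgHom (rename Fin.succ) (expandAt q G) := by
  suffices h : (expandAt (Fin.cons x q : Fin (n + 1) → k)).comp (rename Fin.succ) =
      (Polynomial.mapAlgHom (rename Fin.succ)).comp (expandAt q) from DFunLike.congr_fun h G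
  ext1 i
  simp [Polynomial.mapAlgHom]

lemma VanishesTo.sum {ι σ : Type*} {c : ℕ} {p : σ → k} {s : Finset ι} {F : ι → MvPolynomial σ k}
    (hF : ∀ i ∈ s, VanishesTo c p (F i)) : VanishesTo c p (∑ i ∈ s, F i) := by
  unfold VanishesTo at *
  rw [map_sum]
  exact Finset.dvd_sum hF

lemma vanishesTo_of_headCoeff_eq_zero {c d : ℕ} {F : MvPolynomial (Fin (n + 1)) k}
    (hd : F.IsHomogeneous d) (hF : ∀ j, d < j + c → headCoeff j F = 0) :
    VanishesTo c (Fin.cons 1 0 : Fin (n + 1) → k) F := by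
  rw [eq_sum_headCoeff (fun j hj => headCoeff_eq_zero hd hj)]
  refine VanishesTo.sum fun j hj => ?_
  rw [mem_range] at hj
  by_cases h : d < j + c
  · simp [hF j h]
  · refine VanishesTo.mono (show c ≤ 0 + (d - j) by omega) ((vanishesTo_zero_left _ _).mul ?_)
    unfold VanishesTo
    rw [expandAt_rename_succ, expandAt_zero (headCoeff_isHomogeneous hd (by omega))]
    simp [Polynomial.mapAlgHom]

end HeadCoeff

section LinearSystem

variable {k : Type*} [Field k] {ι : Type*} {n : ℕ}

/-- The forms of degree `d` in `n + 1` variables vanishing to order at least `m i` at `p i`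
for all `i`. -/
def vanishingForms (d : ℕ) (m : ι → ℕ) (p : ι → Fin (n + 1) → k) :
    Submodule k (MvPolynomial (Fin (n + 1)) k) where
  carrier := {F | F.IsHomogeneous d ∧ ∀ i, VanishesTo (m i) (p i) F}
  add_mem' hF hG := ⟨hF.1.add hG.1, fun i => (hF.2 i).add (hG.2 i)⟩
  zero_mem' := ⟨isHomogeneous_zero _ _ _, fun _ => vanishesTo_zero_right _ _⟩
  smul_mem' a _ hF := ⟨(homogeneousSubmodule _ k d).smul_mem a hF.1, fun i => (hF.2 i).smul a⟩

lemma mem_vanishingForms {d : ℕ} {m : ι → ℕ} {p : ι → Fin (n + 1) → k}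
    {F : MvPolynomial (Fin (n + 1)) k} :
    F ∈ vanishingForms d m p ↔ F.IsHomogeneous d ∧ ∀ i, VanishesTo (m i) (p i) F := Iff.rfl

instance finiteDimensional_homogeneousSubmodule (σ : Type*) [Finite σ] (d : ℕ) :
    FiniteDimensional k (homogeneousSubmodule σ k d) :=
  Module.Finite.iff_fg.mpr (homogeneousSubmodule_fg σ k d)

lemma vanishingForms_le_homogeneousSubmodule (d : ℕ) (m : ι → ℕ) (p : ι → Fin (n + 1) → k) :
    vanishingForms d m p ≤ homogeneousSubmodule _ k d := fun _ h => h.1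

instance (d : ℕ) (m : ι → ℕ) (p : ι → Fin (n + 1) → k) :
    FiniteDimensional k (vanishingForms d m p) :=
  Submodule.finiteDimensional_of_le (vanishingForms_le_homogeneousSubmodule d m p)

/-- The dimension of the linear system `vanishingForms d m p`. -/
def formDim (d : ℕ) (m : ι → ℕ) (p : ι → Fin (n + 1) → k) : ℕ :=
  Module.finrank k (vanishingForms d m p)

lemma vanishingForms_anti {d : ℕ} {m m' : ι → ℕ} (h : m' ≤ m) (p : ι → Fin (n + 1) → k) :
    vanishingForms d m p ≤ vanishingForms d m' p :=
  fun _ hF => ⟨hF.1, fun i => (hF.2 i).mono (h i)⟩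

lemma formDim_pos_iff {d : ℕ} {m : ι → ℕ} {p : ι → Fin (n + 1) → k} :
    0 < formDim d m p ↔ ∃ F ∈ vanishingForms d m p, F ≠ 0 := by
  rw [formDim, Nat.pos_iff_ne_zero, ne_eq, Submodule.finrank_eq_zero, ← ne_eq, Submodule.ne_bot_iff]

lemma vanishingForms_congr {d : ℕ} {m : ι → ℕ} {p q : ι → Fin (n + 1) → k}
    (h : ∀ i, m i ≠ 0 → p i = q i) : vanishingForms d m p = vanishingForms d m q := by
  ext F
  simp only [mem_vanishingForms]
  refine and_congr_right fun _ => forall_congr' fun i => ?_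
  by_cases hi : m i = 0
  · simp [hi]
  · rw [h i hi]

lemma formDim_congr {d : ℕ} {m : ι → ℕ} {p q : ι → Fin (n + 1) → k}
    (h : ∀ i, m i ≠ 0 → p i = q i) : formDim d m p = formDim d m q := by
  rw [formDim, formDim, vanishingForms_congr h]

lemma finrank_le_finrank_add_finrank {V W : Type*} [AddCommGroup V] [Module k V] [AddCommGroup W]
    [Module k W] {A C : Submodule k V} {B : Submodule k W} [FiniteDimensional k A]
    [FiniteDimensional k B] [FiniteDimensional k C] (φ : V →ₗ[k] W) (ψ : V →ₗ[k] V)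
    (hB : ∀ x ∈ A, φ x ∈ B) (hC : ∀ x ∈ A, φ x = 0 → ∃ y ∈ C, ψ y = x) :
    Module.finrank k A ≤ Module.finrank k C + Module.finrank k B := by
  rw [← LinearMap.finrank_range_add_finrank_ker (φ.domRestrict A), add_comm]
  refine add_le_add ?_ (Submodule.finrank_mono ?_)
  · rw [(Submodule.equivMapOfInjective A.subtype A.subtype_injective _).finrank_eq]
    refine le_trans (Submodule.finrank_mono (t := C.map ψ) ?_) (Submodule.finrank_map_le ψ C)
    rintro _ ⟨x, hx, rfl⟩
    obtain ⟨y, hy, h⟩ := hC x x.2 hx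
    exact ⟨y, hy, h⟩
  · rintro _ ⟨x, rfl⟩
    exact hB x x.2

/-- `headCoeff` as a linear map. -/
def headCoeffHom (j : ℕ) : MvPolynomial (Fin (n + 1)) k →ₗ[k] MvPolynomial (Fin n) k where
  toFun := headCoeff j
  map_add' := headCoeff_add j
  map_smul' := headCoeff_smul j

lemma coeff_expandAt_zero {σ : Type*} [Fintype σ] (F : MvPolynomial σ k) (e : ℕ) :
    (expandAt 0 F).coeff e = homogeneousComponent e F := by
  conv_lhs => rw [← F.sum_homogeneousComponent]
  rw [map_sum, Polynomial.finsetSum_coeff]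
  simp only [expandAt_zero (homogeneousComponent_isHomogeneous _ F), Polynomial.coeff_C_mul,
    Polynomial.coeff_X_pow, mul_ite, mul_one, mul_zero]
  rw [Finset.sum_ite_eq]
  split_ifs with h
  · rfl
  · exact (homogeneousComponent_eq_zero _ _ (by rw [mem_range] at h; omega)).symm

lemma IsHomogeneous.of_linForm_mul {σ : Type*} [Fintype σ] {a : σ → k} (ha : a ≠ 0) {d : ℕ}
    {F : MvPolynomial σ k} (hF : (linForm a * F).IsHomogeneous (d + 1)) : F.IsHomogeneous d := by
  have h1 := expandAt_zero hF
  rw [map_mul, expandAt_linForm, eval_linForm] at h1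
  simp only [Pi.zero_apply, mul_zero, Finset.sum_const_zero, map_zero, zero_add, map_mul] at h1
  have h2 : (Polynomial.X * Polynomial.C (linForm a)) * expandAt 0 F =
      (Polynomial.X * Polynomial.C (linForm a)) * (Polynomial.C F * Polynomial.X ^ d) := by
    rw [h1]; ring
  have h3 := mul_left_cancel₀ (mul_ne_zero Polynomial.X_ne_zero
    (Polynomial.C_ne_zero.mpr (linForm_ne_zero ha))) h2
  have h4 := coeff_expandAt_zero F d
  rw [h3, Polynomial.coeff_C_mul, Polynomial.coeff_X_pow_self, mul_one] at h4
  rw [h4]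
  exact homogeneousComponent_isHomogeneous d F

lemma X_zero_eq_linForm : (X 0 : MvPolynomial (Fin (n + 1)) k) = linForm (Pi.single 0 1) := by
  simp [linForm, Pi.single_apply]

/-- Restriction to the hyperplane `X 0 = 0`. -/
lemma formDim_succ_le {d : ℕ} {m m' μ : ι → ℕ} {p : ι → Fin (n + 2) → k}
    {q : ι → Fin (n + 1) → k}
    (hm' : ∀ i, m' i ≤ m i - 1 ∨ p i 0 ≠ 0 ∧ m' i ≤ m i)
    (hμ : ∀ F ∈ vanishingForms (d + 1) m p, ∀ i, VanishesTo (μ i) (q i) (headCoeff 0 F)) :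
    formDim (d + 1) m p ≤ formDim d m' p + formDim (d + 1) μ q := by
  refine finrank_le_finrank_add_finrank (headCoeffHom 0)
    (LinearMap.mulLeft k (X 0)) (fun F hF => ⟨headCoeff_isHomogeneous hF.1 (Nat.zero_le _), hμ F hF⟩)
    fun F hF h0 => ?_
  obtain ⟨G, rfl⟩ := exists_eq_X_mul (F := F) h0
  refine ⟨G, ⟨?_, fun i => ?_⟩, rfl⟩
  · have := hF.1
    rw [X_zero_eq_linForm] at this
    exact IsHomogeneous.of_linForm_mul (by simp) this
  · have := hF.2 i
    rw [X_zero_eq_linForm] at this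
    rcases hm' i with h | ⟨h1, h2⟩
    · exact (this.of_linForm_mul (by simp)).mono h
    · exact (this.of_linForm_mul' (by simpa [Pi.single_apply] using h1)).mono h2

lemma formDim_zero (d : ℕ) (p : ι → Fin (n + 1) → k) :
    formDim d (0 : ι → ℕ) p = Module.finrank k (homogeneousSubmodule (Fin (n + 1)) k d) := by
  have : vanishingForms d (0 : ι → ℕ) p = homogeneousSubmodule (Fin (n + 1)) k d := by
    ext F
    simp [mem_vanishingForms]
  rw [formDim, this]

lemma formDim_mono {d : ℕ} {m m' : ι → ℕ} (h : m' ≤ m) (p : ι → Fin (n + 1) → k) :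
    formDim d m p ≤ formDim d m' p :=
  Submodule.finrank_mono (vanishingForms_anti h p)

lemma formDim_eq_zero_iff {d : ℕ} {m : ι → ℕ} {p : ι → Fin (n + 1) → k} :
    formDim d m p = 0 ↔ ∀ F ∈ vanishingForms d m p, F = 0 := by
  rw [formDim, Submodule.finrank_eq_zero, Submodule.eq_bot_iff]

lemma formDim_eq_zero_of_lt {d : ℕ} {m : ι → ℕ} {p : ι → Fin (n + 1) → k} {s : ι}
    (hp : p s = (Fin.cons 1 0 : Fin (n + 1) → k)) (hs : d < m s) : formDim d m p = 0 := by
  rw [formDim_eq_zero_iff]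
  intro F hF
  refine eq_zero_of_headCoeff_eq_zero fun j => ?_
  exact VanishesTo.headCoeff_eq_zero (c := m s) hF.1 (hp ▸ hF.2 s) (by omega)

lemma formDim_eq_zero_of_ne {d : ℕ} {m : ι → ℕ} {p : ι → Fin 1 → k} {s : ι}
    (hp : p s = (Fin.cons 1 0 : Fin 1 → k)) (hs : m s ≠ 0) : formDim d m p = 0 := by
  rw [formDim_eq_zero_iff]
  intro F hF
  refine eq_zero_of_headCoeff_eq_zero fun j => ?_
  by_cases hj : j < d
  · have h := headCoeff_isHomogeneous hF.1 hj.le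
    rw [eq_C_of_isEmpty (headCoeff j F)] at h ⊢
    by_contra h0
    have := h.inj_right (isHomogeneous_C _ _) h0
    omega
  · exact VanishesTo.headCoeff_eq_zero (c := m s) hF.1 (hp ▸ hF.2 s) (by omega)

lemma exists_linForm_eq_zero (p : ι → Fin (n + 1) → k) {I : Finset ι} (hI : I.card ≤ n) :
    ∃ a : Fin (n + 1) → k, a ≠ 0 ∧ ∀ i ∈ I, eval (p i) (linForm a) = 0 := by
  let L : (Fin (n + 1) → k) →ₗ[k] (I → k) := Matrix.mulVecLin (fun i : I => p i)
  have hL : L.ker ≠ ⊥ := LinearMap.ker_ne_bot_of_finrank_lt (by simpa using by omega)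
  obtain ⟨a, ha, ha0⟩ := (Submodule.ne_bot_iff _).mp hL
  refine ⟨a, ha0, fun i hi => ?_⟩
  have h : ∑ j, p i j * a j = 0 := congrFun (LinearMap.mem_ker.mp ha) ⟨i, hi⟩
  simpa [mul_comm] using h

end LinearSystem

section Inequalities

variable {k : Type*} [Field k] {ι : Type*} [DecidableEq ι] {n : ℕ}

lemma linForm_mul_mem_vanishingForms {d : ℕ} {m : ι → ℕ} {p : ι → Fin (n + 1) → k}
    {I : Finset ι} {a : Fin (n + 1) → k} (haI : ∀ i ∈ I, eval (p i) (linForm a) = 0)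
    {F : MvPolynomial (Fin (n + 1)) k}
    (hF : F ∈ vanishingForms d (fun i => if i ∈ I then m i - 1 else m i) p) :
    linForm a * F ∈ vanishingForms (d + 1) m p := by
  refine ⟨add_comm d 1 ▸ (isHomogeneous_linForm a).mul hF.1, fun i => ?_⟩
  have h := hF.2 i
  dsimp only at h
  split_ifs at h with hi
  · exact VanishesTo.linForm_mul (haI i hi) h
  · simpa using (vanishesTo_zero_left (p i) (linForm a)).mul h

lemma formDim_succ_pos {d : ℕ} {m : ι → ℕ} {p : ι → Fin (n + 1) → k} {I : Finset ι}
    (hI : I.card ≤ n) (h : 0 < formDim d (fun i => if i ∈ I then m i - 1 else m i) p) :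
    0 < formDim (d + 1) m p := by
  obtain ⟨a, ha, haI⟩ := exists_linForm_eq_zero p hI
  obtain ⟨F, hF, hF0⟩ := formDim_pos_iff.mp h
  exact formDim_pos_iff.mpr ⟨_, linForm_mul_mem_vanishingForms haI hF,
    mul_ne_zero (linForm_ne_zero ha) hF0⟩

/-- Comparison of the conditions imposed by the point `s` on two linear systems differing by a
hyperplane. -/
lemma formDim_add_formDim_le {d : ℕ} {m : ι → ℕ} {p : ι → Fin (n + 1) → k} {I : Finset ι} {s : ι}
    (hs : s ∉ I) {a : Fin (n + 1) → k} (ha : a ≠ 0)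
    (haI : ∀ i ∈ I, eval (p i) (linForm a) = 0)
    (haI' : ∀ i ∉ I, m i ≠ 0 → eval (p i) (linForm a) ≠ 0) :
    formDim (d + 1) m p +
        formDim d (Function.update (fun i => if i ∈ I then m i - 1 else m i) s 0) p ≤
      formDim (d + 1) (Function.update m s 0) p +
        formDim d (fun i => if i ∈ I then m i - 1 else m i) p := by
  set mI : ι → ℕ := fun i => if i ∈ I then m i - 1 else m i with hmI
  have hinj : Function.Injective (LinearMap.mulLeft k (linForm a)) :=
    mul_right_injective₀ (linForm_ne_zero ha)
  have hupd : Function.update mI s 0 =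
      fun i => if i ∈ I then Function.update m s 0 i - 1 else Function.update m s 0 i := by
    funext i
    by_cases hi : i = s
    · subst hi; simp
    · simp [hi, hmI]
  set W := (vanishingForms d (Function.update mI s 0) p).map (LinearMap.mulLeft k (linForm a))
    with hW
  have h1 : formDim d (Function.update mI s 0) p = Module.finrank k W :=
    (Submodule.equivMapOfInjective _ hinj _).finrank_eq
  have hWle : W ≤ vanishingForms (d + 1) (Function.update m s 0) p := by
    rintro _ ⟨F, hF, rfl⟩
    rw [hupd] at hF
    exact linForm_mul_mem_vanishingForms haI hF
  rw [h1, formDim, ← Submodule.finrank_sup_add_finrank_inf_eq]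
  refine add_le_add (Submodule.finrank_mono (sup_le (vanishingForms_anti ?_ p) hWle)) ?_
  · intro i
    by_cases hi : i = s
    · subst hi; simp
    · simp [hi]
  · refine le_trans (Submodule.finrank_mono
      (t := (vanishingForms d mI p).map (LinearMap.mulLeft k (linForm a))) ?_)
      (Submodule.finrank_map_le _ _)
    rintro _ ⟨hG, F, hF, rfl⟩
    refine ⟨F, ⟨hF.1, fun i => ?_⟩, rfl⟩
    have hi := hG.2 i
    simp only [hmI]
    split_ifs with h
    · exact hi.of_linForm_mul ha
    · by_cases h0 : m i = 0
      · simp [h0]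
      · exact hi.of_linForm_mul' (haI' i h h0)

/-- Restriction to the exceptional divisor over the point `s`. -/
lemma formDim_update_le {d : ℕ} {m : ι → ℕ} {p : ι → Fin (n + 2) → k} {q : ι → Fin (n + 1) → k}
    {x : ι → k} {s : ι} (hps : p s = (Fin.cons 1 0 : Fin (n + 2) → k))
    (hp : ∀ i, i ≠ s → p i = (Fin.cons (x i) (q i) : Fin (n + 2) → k))
    (hs : m s ≠ 0) (hd : m s ≤ d) :
    formDim d (Function.update m s (m s - 1)) p ≤ formDim d m p +
      formDim (m s - 1) (fun i => if i = s then 0 else m s + m i - (d + 1)) q := by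
  refine finrank_le_finrank_add_finrank (headCoeffHom (d - (m s - 1))) LinearMap.id
    (fun F hF => ?_) fun F hF h0 => ⟨F, ⟨hF.1, fun i => ?_⟩, rfl⟩
  all_goals
    have hs1 : VanishesTo (m s - 1) (Fin.cons 1 0 : Fin (n + 2) → k) F := by
      have := hF.2 s
      rwa [hps, Function.update_self] at this
  · have hh := headCoeff_isHomogeneous hF.1 (Nat.sub_le d (m s - 1))
    rw [Nat.sub_sub_self (by omega)] at hh
    refine ⟨hh, fun i => ?_⟩
    dsimp only
    split_ifs with hi
    · simp
    have hi1 := hF.2 i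
    rw [hp i hi, Function.update_of_ne hi] at hi1
    exact (hi1.headCoeff_of_le (e := d - (m s - 1))
      (fun j hj => VanishesTo.headCoeff_eq_zero hF.1 hs1 (by omega)) _).mono (by omega)
  · by_cases hi : i = s
    · subst hi
      rw [hps]
      refine vanishesTo_of_headCoeff_eq_zero hF.1 fun j hj => ?_
      by_cases hj' : j = d - (m i - 1)
      · rw [hj']; exact h0
      · exact VanishesTo.headCoeff_eq_zero hF.1 hs1 (by omega)
    · simpa [hi] using hF.2 i

/-- Degeneration of all points except `s` and those of `J` to the hyperplane `X 0 = 0`. -/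
lemma formDim_le_sum {d : ℕ} {m : ι → ℕ} {p : ι → Fin (n + 2) → k} {q : ι → Fin (n + 1) → k}
    {s : ι} {J : Finset ι} (hps : p s = (Fin.cons 1 0 : Fin (n + 2) → k))
    (hpJ : ∀ i ∈ J, i ≠ s → p i = (Fin.cons 1 (q i) : Fin (n + 2) → k))
    (hp : ∀ i ∉ J, i ≠ s → p i = (Fin.cons 0 (q i) : Fin (n + 2) → k))
    (hs : m s ≠ 0) (hd : m s ≤ d) :
    formDim d m p ≤ ∑ j ∈ range (d + 1 - m s),
      formDim (d - j)
        (fun i => if i = s then 0 else if i ∈ J then m s + m i + j - d else m i - j) q := by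
  have key : ∀ t, t ≤ d + 1 - m s → formDim d m p ≤ ∑ j ∈ range t, formDim (d - j)
        (fun i => if i = s then 0 else if i ∈ J then m s + m i + j - d else m i - j) q +
      formDim (d - t) (fun i => if i = s ∨ i ∈ J then m i else m i - t) p := by
    intro t
    induction t with
    | zero => simp
    | succ t ih =>
      intro ht
      refine (ih (by omega)).trans ?_
      rw [Finset.sum_range_succ, add_assoc]
      refine Nat.add_le_add_left ?_ _
      rw [add_comm (formDim _ _ q)]
      obtain ⟨D, hD⟩ : ∃ D, d - t = D + 1 := ⟨d - t - 1, by omega⟩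
      rw [hD, show d - (t + 1) = D by omega]
      refine formDim_succ_le (fun i => ?_) fun F hF i => ?_
      · by_cases hi : i = s
        · right
          subst hi
          simp [hps]
        · by_cases hJ : i ∈ J
          · right
            simp [hpJ i hJ hi, hJ]
          · left
            simp [hi, hJ, Nat.sub_sub]
      · have hs1 : VanishesTo (m s) (Fin.cons 1 0 : Fin (n + 2) → k) F := by
          have := hF.2 s
          simpa [hps] using this
        have hi := hF.2 i
        by_cases his : i = s
        · simp [his]
        · by_cases hJ : i ∈ J
          · simp only [his, hJ, if_true, if_false, or_true] at hi ⊢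
            rw [hpJ i hJ his] at hi
            exact (hi.headCoeff_of_le (e := D + 1 - m s)
              (fun j hj => VanishesTo.headCoeff_eq_zero hF.1 hs1 (by omega)) _).mono (by omega)
          · simp only [his, hJ, if_false, or_false] at hi ⊢
            rw [hp i hJ his] at hi
            exact hi.headCoeff_zero
  have h := key _ le_rfl
  rwa [formDim_eq_zero_of_lt (m := fun i => if i = s ∨ i ∈ J then m i else _) hps
    (by simp only [true_or, if_true]; omega), add_zero] at h

end Inequalities

section PointIdeal

lemma exists_matrix_mulVec_eq {k : Type*} [Field k] {n : ℕ} {p : Fin (n + 1) → k} (hp : p ≠ 0) :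
    ∃ A B : Matrix (Fin (n + 1)) (Fin (n + 1)) k, A * B = 1 ∧ B * A = 1 ∧
      A.mulVec (Fin.cons 1 0) = p := by
  have h0 : (Fin.cons 1 0 : Fin (n + 1) → k) ≠ 0 := fun h => one_ne_zero (congrFun h 0)
  let e := (LinearEquiv.toSpanNonzeroSingleton k _ _ h0).symm ≪≫ₗ
    LinearEquiv.toSpanNonzeroSingleton k _ _ hp
  obtain ⟨g, hg⟩ := Submodule.exists_linearEquiv_restrict_eq e
  refine ⟨LinearMap.toMatrix' g.toLinearMap, LinearMap.toMatrix' g.symm.toLinearMap, ?_, ?_, ?_⟩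
  · rw [← LinearMap.toMatrix'_comp]; simp
  · rw [← LinearMap.toMatrix'_comp]; simp
  · rw [LinearMap.toMatrix'_mulVec]
    have h1 := hg (LinearEquiv.toSpanNonzeroSingleton k _ _ h0 1)
    rw [LinearEquiv.trans_apply, LinearEquiv.symm_apply_apply] at h1
    simpa using h1.symm

lemma formDim_mulVec {k : Type*} [Field k] {n : ℕ} {ι : Type*} {d : ℕ} {m : ι → ℕ}
    (p : ι → Fin (n + 1) → k) {A B : Matrix (Fin (n + 1)) (Fin (n + 1)) k} (hAB : A * B = 1)
    (hBA : B * A = 1) : formDim d m (fun i => A.mulVec (p i)) = formDim d m p := by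
  have key : ∀ (q : ι → Fin (n + 1) → k) {A B : Matrix (Fin (n + 1)) (Fin (n + 1)) k},
      A * B = 1 → formDim d m (fun i => A.mulVec (q i)) ≤ formDim d m q := by
    intro q A B hAB
    have hinj : Function.Injective (linSubst A).toLinearMap := fun F G h => by
      have := congrArg (linSubst B) h
      simpa [linSubst_linSubst, hAB, linSubst_one] using this
    rw [formDim, (Submodule.equivMapOfInjective _ hinj _).finrank_eq]
    refine Submodule.finrank_mono ?_
    rintro _ ⟨F, hF, rfl⟩
    exact ⟨linSubst_isHomogeneous A hF.1, fun i => (hF.2 i).linSubst⟩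
  refine le_antisymm (key p hAB) ?_
  have := key (fun i => A.mulVec (p i)) hBA
  simpa [Matrix.mulVec_mulVec, hBA] using this

lemma coeff_zero_expandAt {k σ : Type*} [Field k] (p : σ → k) (F : MvPolynomial σ k) :
    (expandAt p F).coeff 0 = C (eval p F) := by
  induction F using MvPolynomial.induction_on with
  | C a => simp
  | add F G hF hG => simp [hF, hG]
  | mul_X F i hF => simp [hF, Polynomial.mul_coeff_zero]

variable {k : Type} [Field k]

lemma vanishesTo_of_mem_pointIdeal_pow {N c : ℕ} {v : Fin N → k} {F : MvPolynomial (Fin N) k}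
    (hF : F ∈ pointIdeal k N v ^ c) : VanishesTo c v F := by
  have h : pointIdeal k N v ≤ (Ideal.span {Polynomial.X}).comap (expandAt v) := by
    refine Ideal.span_le.mpr fun P hP => ?_
    rw [SetLike.mem_coe, Ideal.mem_comap, Ideal.mem_span_singleton, Polynomial.X_dvd_iff,
      coeff_zero_expandAt, hP.2, map_zero]
  have h2 := Ideal.le_comap_pow (expandAt v) c (Ideal.pow_right_mono h c hF)
  rwa [Ideal.mem_comap, Ideal.span_singleton_pow, Ideal.mem_span_singleton] at h2

lemma aeval_mem_pow {σ R : Type*} [CommRing R] [Algebra k R] {I : Ideal R} {f : σ → R}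
    (hf : ∀ i, f i ∈ I) {e : ℕ} {F : MvPolynomial σ k} (hF : F.IsHomogeneous e) :
    aeval f F ∈ I ^ e := by
  rw [aeval_def, eval₂_eq]
  refine Ideal.sum_mem _ fun μ hμ => Ideal.mul_mem_left _ _ ?_
  have hdeg : ∑ i ∈ μ.support, μ i = e := by
    have := hF (mem_support_iff.mp hμ)
    simpa [Finsupp.weight_apply, Finsupp.sum] using this
  rw [← hdeg, ← Finset.prod_pow_eq_pow_sum]
  exact Ideal.prod_mem_prod fun i _ => Ideal.pow_mem_pow (hf i) _

lemma mem_pointIdeal_pow {n c d : ℕ} {v : Fin (n + 1) → k} (hv : v ≠ 0)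
    {F : MvPolynomial (Fin (n + 1)) k} (hd : F.IsHomogeneous d) (hF : VanishesTo c v F) :
    F ∈ pointIdeal k (n + 1) v ^ c := by
  obtain ⟨A, B, hAB, hBA, rfl⟩ := exists_matrix_mulVec_eq hv
  have hG := hF.linSubst
  have hGd := linSubst_isHomogeneous A hd
  have hmem (i : Fin n) : linForm (B i.succ) ∈
      pointIdeal k (n + 1) (A.mulVec (Fin.cons 1 0)) := by
    have h1 : (B * A).mulVec (Fin.cons 1 0) = (Fin.cons 1 0 : Fin (n + 1) → k) := by
      rw [hBA, Matrix.one_mulVec]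
    rw [← Matrix.mulVec_mulVec] at h1
    refine Ideal.subset_span ⟨isHomogeneous_linForm _, ?_⟩
    rw [eval_linForm]
    simpa [Matrix.mulVec, dotProduct] using congrFun h1 i.succ
  have hFG : F = linSubst B (linSubst A F) := by rw [linSubst_linSubst, hAB, linSubst_one]
  rw [hFG, eq_sum_headCoeff fun j hj => headCoeff_eq_zero hGd hj, map_sum]
  refine Ideal.sum_mem _ fun j hj => ?_
  rw [map_mul]
  refine Ideal.mul_mem_left _ _ ?_
  by_cases hjc : d < j + c
  · rw [VanishesTo.headCoeff_eq_zero hGd hG hjc, map_zero, map_zero]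
    exact Ideal.zero_mem _
  · refine Ideal.pow_le_pow_right (show c ≤ d - j by omega) ?_
    rw [linSubst, aeval_rename]
    exact aeval_mem_pow (fun i => hmem i)
      (headCoeff_isHomogeneous hGd (by rw [mem_range] at hj; omega))

lemma linSys_eq_vanishingForms {n d s : ℕ} {m : ℕ → ℕ} {p : ℕ → Fin (n + 1) → k}
    (hp : ∀ i < s, p i ≠ 0) :
    linSys k n d s m p = vanishingForms d (fun i : Fin s => m i) (fun i => p i) := by
  ext F
  simp only [linSys, Submodule.mem_inf, Submodule.mem_iInf, mem_vanishingForms,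
    Submodule.restrictScalars_mem, mem_range]
  refine and_congr_right fun hd => ⟨fun h i => vanishesTo_of_mem_pointIdeal_pow (h i i.2),
    fun h i hi => mem_pointIdeal_pow (hp i hi) hd (h ⟨i, hi⟩)⟩

end PointIdeal

section Generic

variable {k : Type*} [Field k] {ι κ : Type*}

/-- The value of a polynomial in the coordinates of a tuple of points. -/
def evalAt (p : ι → κ → k) (Q : MvPolynomial (ι × κ) k) : k := eval (Function.uncurry p) Q

/-- A function of a tuple of points is polynomial in the coordinates. -/
def IsPolyFun (f : (ι → κ → k) → k) : Prop :=
  ∃ Q : MvPolynomial (ι × κ) k, ∀ p, f p = evalAt p Q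

lemma isPolyFun_const (a : k) : IsPolyFun fun _ : ι → κ → k => a :=
  ⟨C a, fun p => by simp [evalAt]⟩

lemma isPolyFun_apply (i : ι) (j : κ) : IsPolyFun fun p : ι → κ → k => p i j :=
  ⟨X (i, j), fun p => by simp [evalAt]⟩

lemma IsPolyFun.add {f g : (ι → κ → k) → k} (hf : IsPolyFun f) (hg : IsPolyFun g) :
    IsPolyFun fun p => f p + g p := by
  obtain ⟨P, hP⟩ := hf
  obtain ⟨Q, hQ⟩ := hg
  exact ⟨P + Q, fun p => by simp [evalAt, hP, hQ]⟩

lemma IsPolyFun.mul {f g : (ι → κ → k) → k} (hf : IsPolyFun f) (hg : IsPolyFun g) :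
    IsPolyFun fun p => f p * g p := by
  obtain ⟨P, hP⟩ := hf
  obtain ⟨Q, hQ⟩ := hg
  exact ⟨P * Q, fun p => by simp [evalAt, hP, hQ]⟩

lemma IsPolyFun.det {ν : Type*} [Fintype ν] [DecidableEq ν] {M : (ι → κ → k) → Matrix ν ν k}
    (hM : ∀ a b, IsPolyFun fun p => M p a b) : IsPolyFun fun p => (M p).det := by
  choose Q hQ using hM
  refine ⟨(Matrix.of Q).det, fun p => ?_⟩
  rw [evalAt, RingHom.map_det]
  refine congrArg Matrix.det (Matrix.ext fun a b => ?_)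
  exact hQ a b p

lemma isPolyFun_coeff_expandAt [DecidableEq κ] (i : ι) (F : MvPolynomial κ k) (j : ℕ) (μ : κ →₀ ℕ) :
    IsPolyFun fun p : ι → κ → k => coeff μ ((expandAt (p i) F).coeff j) := by
  induction F using MvPolynomial.induction_on generalizing j μ with
  | C a =>
    simp only [expandAt_C]
    exact isPolyFun_const _
  | add F G hF hG =>
    simp only [map_add, Polynomial.coeff_add, coeff_add]
    exact (hF j μ).add (hG j μ)
  | mul_X F l hF =>
    simp only [map_mul, expandAt_X, mul_add, Polynomial.coeff_add, coeff_add,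
      Polynomial.coeff_mul_C, ← mul_assoc, mul_comm _ (C _), coeff_C_mul]
    refine ((isPolyFun_apply i l).mul (hF j μ)).add ?_
    rcases j with _ | j
    · simp only [Polynomial.mul_coeff_zero, Polynomial.coeff_X_zero, mul_zero, zero_mul, coeff_zero]
      exact isPolyFun_const 0
    · simp only [Polynomial.coeff_mul_X, coeff_mul_X']
      split_ifs
      · exact hF _ _
      · exact isPolyFun_const 0

/-- Upper semicontinuity of the dimension of the common kernel of a family of functionals. -/
lemma exists_evalAt_ne_zero_finrank_le {V J : Type*} [AddCommGroup V] [Module k V]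
    [FiniteDimensional k V] (Λ : (ι → κ → k) → J → Module.Dual k V)
    (hΛ : ∀ j v, IsPolyFun fun p => Λ p j v) (p₀ : ι → κ → k) :
    ∃ Q, evalAt p₀ Q ≠ 0 ∧ ∀ p, evalAt p Q ≠ 0 →
      Module.finrank k ↥(⨅ j, (Λ p j).ker) ≤ Module.finrank k ↥(⨅ j, (Λ p₀ j).ker) := by
  obtain ⟨W, hW⟩ := Submodule.exists_isCompl (⨅ j, (Λ p₀ j).ker)
  let f (j : J) : Module.Dual k W := (Λ p₀ j).domRestrict W
  have hspan : Submodule.span k (Set.range f) = ⊤ := by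
    rw [← Subspace.dualCoannihilator_dualAnnihilator_eq (W := Submodule.span k (Set.range f)),
      ← Submodule.dualAnnihilator_bot]
    congr 1
    rw [Submodule.eq_bot_iff]
    intro w hw
    rw [Submodule.mem_dualCoannihilator] at hw
    refine Subtype.ext ((Submodule.disjoint_def.mp hW.disjoint) w ?_ w.2)
    rw [Submodule.mem_iInf]
    exact fun j => hw (f j) (Submodule.subset_span ⟨j, rfl⟩)
  let r := Module.finrank k W
  obtain ⟨g, hg⟩ : ∃ g : Fin r → J, Submodule.span k (Set.range fun a => f (g a)) = ⊤ := by
    have hr : Module.finrank k (Submodule.span k (Set.range f)) = r := by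
      rw [hspan, finrank_top, Subspace.dual_finrank_eq]
    rw [← hr]
    obtain ⟨g, hg, hg', -⟩ := Submodule.exists_fun_fin_finrank_span_eq k (Set.range f)
    choose g' hg'' using hg
    exact ⟨g', by simp only [hg'', ← hspan, ← hg']⟩
  let w : Module.Basis (Fin r) k W := Module.finBasis k W
  let M (p : ι → κ → k) : Matrix (Fin r) (Fin r) k := fun a b => Λ p (g a) (w b)
  obtain ⟨Q, hQ⟩ := IsPolyFun.det (M := M) fun a b => hΛ (g a) (w b)
  have hmul (p : ι → κ → k) (c : Fin r → k) (a : Fin r) :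
      (M p).mulVec c a = Λ p (g a) (∑ b, c b • w b : W) := by
    simp [M, Matrix.mulVec, dotProduct, mul_comm]
  refine ⟨Q, ?_, fun p hp => ?_⟩
  · rw [← hQ]
    intro h0
    obtain ⟨c, hc, hc'⟩ := Matrix.exists_mulVec_eq_zero_iff.mpr h0
    refine hc ?_
    have hx : (∑ b, c b • w b) = 0 := by
      refine (Module.forall_dual_apply_eq_zero_iff k _).mp fun φ => ?_
      have hφ : φ ∈ Submodule.span k (Set.range fun a => f (g a)) := hg ▸ Submodule.mem_top
      induction hφ using Submodule.span_induction with
      | mem φ h =>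
        obtain ⟨a, rfl⟩ := h
        exact (hmul p₀ c a).symm.trans (congrFun hc' a)
      | zero => simp
      | add φ ψ _ _ h1 h2 => rw [LinearMap.add_apply, h1, h2, add_zero]
      | smul t φ _ h1 => rw [LinearMap.smul_apply, h1, smul_zero]
    exact funext (Fintype.linearIndependent_iff.mp w.linearIndependent c hx)
  · have hdisj : Disjoint (⨅ j, (Λ p j).ker) W := by
      rw [Submodule.disjoint_def]
      intro x hx hxW
      have h1 : (M p).mulVec (w.repr ⟨x, hxW⟩) = 0 := by
        funext a
        rw [hmul, w.sum_repr]
        exact (Submodule.mem_iInf _).mp hx (g a)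
      have h2 : (w.repr ⟨x, hxW⟩ : Fin r → k) = 0 := by
        by_contra h
        exact hp ((hQ p).symm.trans (Matrix.exists_mulVec_eq_zero_iff.mp ⟨_, h, h1⟩))
      have h3 : w.repr ⟨x, hxW⟩ = 0 := DFunLike.coe_injective h2
      simpa using h3
    have h1 := Submodule.finrank_add_finrank_le_of_disjoint hdisj
    have h2 := Submodule.finrank_add_eq_of_isCompl hW
    omega

lemma IsPolyFun.comp {ι' κ' : Type*} {f : (ι → κ → k) → k} (hf : IsPolyFun f)
    {φ : (ι' → κ' → k) → ι → κ → k} (hφ : ∀ i j, IsPolyFun fun p => φ p i j) :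
    IsPolyFun fun p => f (φ p) := by
  obtain ⟨P, hP⟩ := hf
  choose Q hQ using hφ
  refine ⟨aeval (fun x : ι × κ => Q x.1 x.2) P, fun p => ?_⟩
  change f (φ p) = _
  rw [hP, evalAt, evalAt, ← coe_aeval_eq_eval (Function.uncurry p), RingHom.coe_coe,
    ← AlgHom.comp_apply, comp_aeval, ← coe_aeval_eq_eval, RingHom.coe_coe]
  congr 2
  funext x
  simp only [Function.uncurry, hQ, evalAt]
  rw [aeval_eq_eval]

/-- The filter of sets of tuples of points containing a nonempty Zariski open set. -/
def genericFilter (k ι κ : Type*) [Field k] : Filter (ι → κ → k) where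
  sets := {S | ∃ Q : MvPolynomial (ι × κ) k, Q ≠ 0 ∧ ∀ p, evalAt p Q ≠ 0 → p ∈ S}
  univ_sets := ⟨1, one_ne_zero, fun _ _ => Set.mem_univ _⟩
  sets_of_superset := fun ⟨Q, hQ, h⟩ hST => ⟨Q, hQ, fun p hp => hST (h p hp)⟩
  inter_sets := fun ⟨P, hP, h⟩ ⟨Q, hQ, h'⟩ => ⟨P * Q, mul_ne_zero hP hQ, fun p hp => by
    rw [evalAt, map_mul] at hp
    exact ⟨h p (left_ne_zero_of_mul hp), h' p (right_ne_zero_of_mul hp)⟩⟩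

lemma exists_evalAt_ne_zero [Infinite k] {Q : MvPolynomial (ι × κ) k} (hQ : Q ≠ 0) :
    ∃ p, evalAt p Q ≠ 0 := by
  by_contra! h
  refine hQ (MvPolynomial.funext fun x => ?_)
  have h1 := h (Function.curry x)
  rwa [evalAt, Function.uncurry_curry, ← map_zero (eval x)] at h1

instance [Infinite k] : (genericFilter k ι κ).NeBot := by
  refine Filter.neBot_iff.mpr fun h => ?_
  obtain ⟨Q, hQ, h1⟩ : ∅ ∈ genericFilter k ι κ := h ▸ Filter.mem_bot
  obtain ⟨p, hp⟩ := exists_evalAt_ne_zero hQ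
  exact h1 p hp

lemma IsPolyFun.eventually_ne_zero {f : (ι → κ → k) → k} (hf : IsPolyFun f) {p : ι → κ → k}
    (hp : f p ≠ 0) : ∀ᶠ p in genericFilter k ι κ, f p ≠ 0 := by
  obtain ⟨Q, hQ⟩ := hf
  refine ⟨Q, ?_, fun q hq => by rwa [Set.mem_ofPred_eq, hQ]⟩
  rintro rfl
  exact hp (by rw [hQ, evalAt, map_zero])

lemma isPolyFun_evalAt (Q : MvPolynomial (ι × κ) k) : IsPolyFun fun p => evalAt p Q :=
  ⟨Q, fun _ => rfl⟩

lemma eventually_tail [Infinite k] {n : ℕ} {S : (ι → Fin n → k) → Prop}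
    (hS : ∀ᶠ q in genericFilter k ι (Fin n), S q) :
    ∀ᶠ p in genericFilter k ι (Fin (n + 1)), S fun i => Fin.tail (p i) := by
  obtain ⟨Q, hQ, h⟩ := hS
  obtain ⟨q, hq⟩ := exists_evalAt_ne_zero hQ
  have h1 := (isPolyFun_evalAt Q).comp (φ := fun (p : ι → Fin (n + 1) → k) i => Fin.tail (p i))
    fun i j => isPolyFun_apply i j.succ
  exact (h1.eventually_ne_zero (p := fun i => Fin.cons 0 (q i)) (by simpa using hq)).mono
    fun p hp => h _ hp

lemma eventually_linForm_ne_zero [Finite ι] [DecidableEq ι] (n : ℕ) :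
    ∀ᶠ p in genericFilter k ι (Fin (n + 1)), ∀ (I : Finset ι) (a : Fin (n + 1) → k),
      I.card = n → a ≠ 0 → (∀ i ∈ I, eval (p i) (linForm a) = 0) →
      ∀ i ∉ I, eval (p i) (linForm a) ≠ 0 := by
  have h : ∀ e : Fin (n + 1) ↪ ι, ∀ᶠ p in genericFilter k ι (Fin (n + 1)),
      (Matrix.of fun a => p (e a)).det ≠ 0 := fun e => by
    refine (IsPolyFun.det fun a b => isPolyFun_apply (e a) b).eventually_ne_zero
      (p := fun i b => if i = e b then 1 else 0) ?_
    have : (Matrix.of fun a b => if e a = e b then (1 : k) else 0) = 1 := by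
      ext a b
      simp [Matrix.one_apply]
    have h2 := congrArg Matrix.det this
    rw [Matrix.det_one] at h2
    exact h2.trans_ne one_ne_zero
  filter_upwards [Filter.eventually_all.mpr h] with p hp I a hI ha haI i hi h0
  have hcard : (insert i I).card = n + 1 := by rw [card_insert_of_notMem hi, hI]
  let e := ((insert i I).equivFinOfCardEq hcard).symm.toEmbedding.trans (.subtype _)
  refine hp e (Matrix.exists_mulVec_eq_zero_iff.mp ⟨a, ha, funext fun j => ?_⟩)
  have hj : e j ∈ insert i I := Subtype.prop _
  have : eval (p (e j)) (linForm a) = 0 := by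
    rcases mem_insert.mp hj with h | h
    · rw [h, h0]
    · exact haI _ h
  rw [eval_linForm] at this
  simpa [Matrix.mulVec, dotProduct, mul_comm] using this

lemma exists_evalAt_ne_zero_formDim_le {n d : ℕ} {m : ι → ℕ} (p₀ : ι → Fin (n + 1) → k) :
    ∃ Q, evalAt p₀ Q ≠ 0 ∧ ∀ p, evalAt p Q ≠ 0 → formDim d m p ≤ formDim d m p₀ := by
  let J := (Σ i : ι, Fin (m i)) × (Fin (n + 1) →₀ ℕ)
  let Λ (p : ι → Fin (n + 1) → k) (j : J) :
      Module.Dual k (homogeneousSubmodule (Fin (n + 1)) k d) :=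
    (MvPolynomial.lcoeff k j.2 ∘ₗ
      (Polynomial.lcoeff (MvPolynomial (Fin (n + 1)) k) j.1.2).restrictScalars k ∘ₗ
      (expandAt (p j.1.1)).toLinearMap).domRestrict _
  have hΛ (p : ι → Fin (n + 1) → k) :
      Module.finrank k ↥(⨅ j, (Λ p j).ker) = formDim d m p := by
    rw [formDim, ← (Submodule.comapSubtypeEquivOfLe
      (vanishingForms_le_homogeneousSubmodule d m p)).finrank_eq]
    suffices hs : (⨅ j, (Λ p j).ker) = (vanishingForms d m p).comap
        (homogeneousSubmodule (Fin (n + 1)) k d).subtype by rw [hs]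
    ext F
    simp only [Submodule.mem_iInf, LinearMap.mem_ker, Submodule.mem_comap, mem_vanishingForms]
    refine ⟨fun h => ⟨F.2, fun i => Polynomial.X_pow_dvd_iff.mpr fun j hj => ?_⟩, fun h j => ?_⟩
    · ext μ
      exact h ⟨⟨i, j, hj⟩, μ⟩
    · have := Polynomial.X_pow_dvd_iff.mp (h.2 j.1.1) j.1.2 j.1.2.2
      exact congrArg (coeff j.2) this
  simp only [← hΛ]
  exact exists_evalAt_ne_zero_finrank_le Λ (fun j F => isPolyFun_coeff_expandAt _ _ _ _) p₀

/-- The minimal dimension of the linear systems `vanishingForms d m p`. -/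
def genDim (k : Type*) [Field k] (n d : ℕ) (m : ι → ℕ) : ℕ :=
  sInf (Set.range fun p : ι → Fin (n + 1) → k => formDim d m p)

lemma genDim_le {n d : ℕ} {m : ι → ℕ} (p : ι → Fin (n + 1) → k) :
    genDim k n d m ≤ formDim d m p := Nat.sInf_le ⟨p, rfl⟩

lemma eventually_formDim_eq (n d : ℕ) (m : ι → ℕ) :
    ∀ᶠ p in genericFilter k ι (Fin (n + 1)), formDim d m p = genDim k n d m := by
  obtain ⟨p₀, hp₀⟩ := Nat.sInf_mem (Set.range_nonempty fun p : ι → Fin (n + 1) → k => formDim d m p)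
  obtain ⟨Q, hQ, h⟩ := exists_evalAt_ne_zero_formDim_le (d := d) (m := m) p₀
  exact ((isPolyFun_evalAt Q).eventually_ne_zero hQ).mono fun p hp =>
    le_antisymm ((h p hp).trans hp₀.le) (genDim_le p)

lemma eventually_ne_zero (n : ℕ) (s : ι) :
    ∀ᶠ p in genericFilter k ι (Fin (n + 1)), p s ≠ 0 :=
  ((isPolyFun_apply s 0).eventually_ne_zero (p := fun _ _ => 1) one_ne_zero).mono
    fun p hp h => hp (by rw [h]; rfl)

lemma genDim_mono {n d : ℕ} {m m' : ι → ℕ} [Infinite k] (h : m' ≤ m) :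
    genDim k n d m ≤ genDim k n d m' := by
  obtain ⟨p, hp⟩ := (eventually_formDim_eq (k := k) n d m').exists
  exact (genDim_le p).trans (hp ▸ formDim_mono h p)

lemma exists_formDim_eq_genDim [Infinite k] (n d : ℕ) (m : ι → ℕ) (s : ι) :
    ∃ p : ι → Fin (n + 1) → k, p s = (Fin.cons 1 0 : Fin (n + 1) → k) ∧
      formDim d m p = genDim k n d m := by
  obtain ⟨p, hp, hs⟩ := ((eventually_formDim_eq (k := k) n d m).and (eventually_ne_zero n s)).exists
  obtain ⟨A, B, hAB, hBA, h⟩ := exists_matrix_mulVec_eq hs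
  refine ⟨fun i => B.mulVec (p i), ?_, by rw [formDim_mulVec p hBA hAB, hp]⟩
  dsimp only
  rw [← h, Matrix.mulVec_mulVec, hBA, Matrix.one_mulVec]

lemma genDim_update_le [Infinite k] [DecidableEq ι] {n d : ℕ} {m : ι → ℕ} {s : ι} (hs : m s ≠ 0)
    (hd : m s ≤ d) :
    genDim k (n + 1) d (Function.update m s (m s - 1)) ≤ genDim k (n + 1) d m +
      genDim k n (m s - 1) (fun i => if i = s then 0 else m s + m i - (d + 1)) := by
  obtain ⟨p₀, hp₀s, hp₀⟩ := exists_formDim_eq_genDim (k := k) (n + 1) d m s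
  obtain ⟨Q, hQ, h⟩ := exists_evalAt_ne_zero_formDim_le (d := d) (m := m) p₀
  let e : Fin (n + 2) → k := Fin.cons 1 0
  have h1 := ((isPolyFun_evalAt Q).comp (φ := fun p => Function.update p s e) fun i j => by
    by_cases hi : i = s
    · subst hi
      simpa using isPolyFun_const (e j)
    · simpa [hi] using isPolyFun_apply i j).eventually_ne_zero (p := p₀) (by
        rwa [show e = p₀ s from hp₀s.symm, Function.update_eq_self])
  obtain ⟨p, hp, hp'⟩ := (h1.and (eventually_tail (eventually_formDim_eq (k := k) n (m s - 1)
    (fun i => if i = s then 0 else m s + m i - (d + 1))))).exists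
  rw [← hp', ← hp₀]
  refine (genDim_le _).trans ((formDim_update_le (p := Function.update p s e)
    (x := fun i => p i 0) (Function.update_self s _ _) (fun i hi => ?_) hs hd).trans
    (Nat.add_le_add_right (h _ hp) _))
  rw [Function.update_of_ne hi]
  exact (Fin.cons_self_tail (p i)).symm

lemma genDim_le_sum [Infinite k] [DecidableEq ι] {n d : ℕ} {m : ι → ℕ} {s : ι} (J : Finset ι)
    (hs : m s ≠ 0) (hd : m s ≤ d) :
    genDim k (n + 1) d m ≤ ∑ j ∈ range (d + 1 - m s),
      genDim k n (d - j)
        (fun i => if i = s then 0 else if i ∈ J then m s + m i + j - d else m i - j) := by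
  have h : ∀ᶠ q in genericFilter k ι (Fin (n + 1)), ∀ j ∈ range (d + 1 - m s),
      formDim (d - j)
        (fun i => if i = s then 0 else if i ∈ J then m s + m i + j - d else m i - j) q =
      genDim k n (d - j)
        (fun i => if i = s then 0 else if i ∈ J then m s + m i + j - d else m i - j) :=
    (Filter.eventually_all_finset _).mpr fun j _ => eventually_formDim_eq n (d - j) _
  obtain ⟨q, hq⟩ := h.exists
  rw [← Finset.sum_congr rfl hq]
  refine (genDim_le fun i => if i = s then Fin.cons 1 0 else if i ∈ J then Fin.cons 1 (q i)
    else Fin.cons 0 (q i)).trans (formDim_le_sum (by simp) (fun i hi his => ?_)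
      (fun i hi his => ?_) hs hd)
  · simp [hi, his]
  · simp [hi, his]

lemma genDim_add_genDim_le [Infinite k] [Finite ι] [DecidableEq ι] {n d : ℕ} {m : ι → ℕ}
    {I : Finset ι} {s : ι} (hs : s ∉ I) (hI : I.card = n) :
    genDim k n (d + 1) m +
        genDim k n d (Function.update (fun i => if i ∈ I then m i - 1 else m i) s 0) ≤
      genDim k n (d + 1) (Function.update m s 0) +
        genDim k n d (fun i => if i ∈ I then m i - 1 else m i) := by
  obtain ⟨p, h1, h2, h3, h4, h5⟩ := ((eventually_formDim_eq (k := k) n (d + 1) m).and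
    ((eventually_formDim_eq n d _).and ((eventually_formDim_eq n (d + 1) _).and
    ((eventually_formDim_eq n d _).and (eventually_linForm_ne_zero n))))).exists
  rw [← h1, ← h2, ← h3, ← h4]
  obtain ⟨a, ha, haI⟩ := exists_linForm_eq_zero p hI.le
  exact formDim_add_formDim_le hs ha haI fun i hi _ => h5 I a hI ha haI i hi

lemma genDim_succ_pos [Infinite k] [DecidableEq ι] {n d : ℕ} {m : ι → ℕ} {I : Finset ι}
    (hI : I.card ≤ n) (h : 0 < genDim k n d (fun i => if i ∈ I then m i - 1 else m i)) :
    0 < genDim k n (d + 1) m := by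
  obtain ⟨p, hp⟩ := (eventually_formDim_eq (k := k) n (d + 1) m).exists
  exact hp ▸ formDim_succ_pos hI (h.trans_le (genDim_le p))

lemma genDim_zero (n d : ℕ) :
    genDim k n d (0 : ι → ℕ) = Module.finrank k (homogeneousSubmodule (Fin (n + 1)) k d) := by
  simp only [genDim, formDim_zero, Set.range_const, csInf_singleton]

lemma genDim_zero_of_ne [Infinite k] {d : ℕ} {m : ι → ℕ} {s : ι} (hs : m s ≠ 0) :
    genDim k 0 d m = 0 := by
  obtain ⟨p, hp, h⟩ := exists_formDim_eq_genDim (k := k) 0 d m s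
  rw [← h, formDim_eq_zero_of_ne hp hs]

/-- A simple point in general position imposes a condition on a nonzero linear system. -/
lemma genDim_succ_le [Infinite k] [DecidableEq ι] {n d : ℕ} {m : ι → ℕ} {s : ι} (hs : m s = 1)
    (h : 0 < genDim k n d (Function.update m s 0)) :
    genDim k n d m + 1 ≤ genDim k n d (Function.update m s 0) := by
  obtain ⟨p, hp⟩ := (eventually_formDim_eq (k := k) n d (Function.update m s 0)).exists
  rw [← hp] at h
  obtain ⟨F, hF, hF0⟩ := formDim_pos_iff.mp h
  obtain ⟨v, hv⟩ : ∃ v, eval v F ≠ 0 := by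
    by_contra! h0
    exact hF0 (MvPolynomial.funext fun x => by rw [h0, map_zero])
  rw [← hp, Nat.succ_le_iff]
  refine (genDim_le (Function.update p s v)).trans_lt ?_
  have hcongr (i : ι) (hi : Function.update m s 0 i ≠ 0) : p i = Function.update p s v i := by
    by_cases his : i = s
    · simp [his] at hi
    · simp [his]
  have hpu : formDim d (Function.update m s 0) (Function.update p s v) =
      formDim d (Function.update m s 0) p := formDim_congr fun i hi => (hcongr i hi).symm
  rw [← hpu]
  refine Submodule.finrank_lt_finrank_of_lt (lt_of_le_of_ne (vanishingForms_anti ?_ _) ?_)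
  · intro i
    by_cases his : i = s
    · simp [his]
    · simp [his]
  · intro heq
    have hF' : F ∈ vanishingForms d (Function.update m s 0) (Function.update p s v) :=
      vanishingForms_congr (d := d) hcongr ▸ hF
    rw [← heq] at hF'
    have h1 := hF'.2 s
    rw [hs, Function.update_self, VanishesTo, pow_one, Polynomial.X_dvd_iff, coeff_zero_expandAt,
      C_eq_zero] at h1
    exact hv h1

end Generic

lemma gdim_eq_genDim {k : Type} [Field k] [Infinite k] (n d s : ℕ) (m : ℕ → ℕ) :
    gdim k n d s m = genDim k n d fun i : Fin s => m i := by
  refine le_antisymm ?_ ?_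
  · have hne : ∀ᶠ p in genericFilter k (Fin s) (Fin (n + 1)), ∀ i, p i ≠ 0 :=
      Filter.eventually_all.mpr fun i => eventually_ne_zero n i
    obtain ⟨p, hp, hp'⟩ := (hne.and (eventually_formDim_eq n d _)).exists
    rw [← hp']
    let P : ℕ → Fin (n + 1) → k := fun i => if h : i < s then p ⟨i, h⟩ else 0
    have hP : ∀ i < s, P i ≠ 0 := fun i hi => by simpa [P, hi] using hp ⟨i, hi⟩
    refine Nat.sInf_le ⟨P, hP, ?_⟩
    rw [linSys_eq_vanishingForms hP, formDim, show (fun i : Fin s => P i) = p by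
      funext i; simp [P]]
  · refine le_csInf ⟨_, fun _ => 1, fun _ _ => one_ne_zero, rfl⟩ ?_
    rintro _ ⟨p, hp, rfl⟩
    rw [linSys_eq_vanishingForms hp]
    exact genDim_le _

section Expected

lemma finrank_homogeneousSubmodule (k : Type*) [Field k] (n d : ℕ) :
    Module.finrank k (homogeneousSubmodule (Fin (n + 1)) k d) = (n + d).choose n := by
  rw [homogeneousSubmodule_eq_finsupp_supported,
    (AddMonoidAlgebra.supportedEquivFinsupp _).finrank_eq, Module.finrank_eq_nat_card_basis
    (Finsupp.basisSingleOne : Module.Basis _ k _)]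
  have e : {μ : Fin (n + 1) →₀ ℕ | μ.degree = d} ≃ Sym (Fin (n + 1)) d :=
    (Equiv.subtypeEquivRight fun μ => by
      simp [Finsupp.degree_apply, Finsupp.sum]).trans (Sym.equivNatSum (Fin (n + 1)) d).symm
  rw [Nat.card_congr e, Nat.card_eq_fintype_card, Sym.card_sym_eq_choose, Fintype.card_fin]
  rw [show n + 1 + d - 1 = n + d by omega, Nat.choose_symm_add]

variable {ι : Type*}

/-- The coefficient of `T ^ d` in `∏ i ∈ S, (1 - T ^ a i) / (1 - T) ^ n`. -/
def seriesCoeff (n d : ℕ) (S : Finset ι) (a : ι → ℕ) : ℤ :=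
  PowerSeries.coeff d ((∏ i ∈ S, (1 - PowerSeries.X ^ a i)) *
    (PowerSeries.invOneSubPow ℤ n : PowerSeries ℤ))

lemma coeff_one_sub_X_pow_mul (d a : ℕ) (P : PowerSeries ℤ) :
    PowerSeries.coeff d ((1 - PowerSeries.X ^ a) * P) =
      PowerSeries.coeff d P - if a ≤ d then PowerSeries.coeff (d - a) P else 0 := by
  rw [sub_mul, one_mul, map_sub, PowerSeries.coeff_X_pow_mul']

lemma one_sub_X_mul_invOneSubPow (n : ℕ) :
    (1 - PowerSeries.X : PowerSeries ℤ) * (PowerSeries.invOneSubPow ℤ (n + 1) : PowerSeries ℤ) =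
      (PowerSeries.invOneSubPow ℤ n : PowerSeries ℤ) := by
  simpa using PowerSeries.one_sub_pow_mul_invOneSubPow_val_add_eq_invOneSubPow_val ℤ n 1

lemma seriesCoeff_insert [DecidableEq ι] (n d : ℕ) {S : Finset ι} {s : ι} (hs : s ∉ S)
    (a : ι → ℕ) : seriesCoeff n d (insert s S) a =
      seriesCoeff n d S a - if a s ≤ d then seriesCoeff n (d - a s) S a else 0 := by
  simp only [seriesCoeff, prod_insert hs, mul_assoc, coeff_one_sub_X_pow_mul]

/-- Only the exponents up to the degree matter. -/
lemma seriesCoeff_congr {n d : ℕ} {S : Finset ι} {a b : ι → ℕ}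
    (h : ∀ i ∈ S, a i = b i ∨ d < a i ∧ d < b i) : seriesCoeff n d S a = seriesCoeff n d S b := by
  classical
  suffices H : ∀ e ≤ d, seriesCoeff n e S a = seriesCoeff n e S b from H d le_rfl
  induction S using Finset.induction_on with
  | empty => intro e _; rfl
  | insert s S hs ih =>
    intro e he
    rw [seriesCoeff_insert n e hs, seriesCoeff_insert n e hs]
    have ih' := ih fun i hi => h i (mem_insert_of_mem hi)
    rw [ih' e he]
    rcases h s (mem_insert_self s S) with h1 | ⟨h1, h2⟩
    · rw [h1, ih' (e - b s) (by omega)]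
    · rw [if_neg (by omega), if_neg (by omega)]

lemma seriesCoeff_insert_of_lt [DecidableEq ι] {n d : ℕ} {S : Finset ι} {s : ι} (hs : s ∉ S)
    {a : ι → ℕ} (h : d < a s) : seriesCoeff n d (insert s S) a = seriesCoeff n d S a := by
  rw [seriesCoeff_insert n d hs, if_neg (by omega), sub_zero]

lemma seriesCoeff_succ (n d : ℕ) (S : Finset ι) (a : ι → ℕ) :
    seriesCoeff (n + 1) (d + 1) S a =
      seriesCoeff (n + 1) d S a + seriesCoeff n (d + 1) S a := by
  simp only [seriesCoeff]
  rw [← one_sub_X_mul_invOneSubPow n, mul_left_comm, sub_mul, one_mul, map_sub,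
    PowerSeries.coeff_succ_X_mul]
  ring

lemma seriesCoeff_insert_eq_sum [DecidableEq ι] {n d : ℕ} {S : Finset ι} {s : ι} (hs : s ∉ S)
    {a : ι → ℕ} (h : a s ≤ d + 1) : seriesCoeff (n + 1) d (insert s S) a =
      ∑ j ∈ range (a s), seriesCoeff n (d - j) S a := by
  simp only [seriesCoeff, prod_insert hs]
  rw [← mul_neg_geom_sum, mul_comm (1 - PowerSeries.X), mul_assoc, mul_assoc, mul_left_comm
    (1 - PowerSeries.X), one_sub_X_mul_invOneSubPow, sum_mul, map_sum]
  refine sum_congr rfl fun j hj => ?_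
  rw [mem_range] at hj
  rw [PowerSeries.coeff_X_pow_mul', if_pos (by omega)]

lemma one_sub_pow_mul_one_sub_pow {R : Type*} [CommRing R] (x : R) {a b : ℕ} (h : a ≤ b) :
    (1 - x ^ a) * (1 - x ^ b) = (1 - x) * ∑ j ∈ range a, x ^ j * (1 - x ^ (a + b - 1 - 2 * j)) := by
  have h1 : ∑ j ∈ range a, x ^ j * x ^ (a + b - 1 - 2 * j) = x ^ b * ∑ j ∈ range a, x ^ j := by
    rw [← sum_range_reflect (fun j => x ^ j) a, mul_sum]
    refine sum_congr rfl fun j hj => ?_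
    rw [mem_range] at hj
    rw [← pow_add, ← pow_add]
    congr 1
    omega
  simp only [mul_sub, mul_one, sum_sub_distrib]
  rw [h1, ← mul_neg_geom_sum x a]
  ring

lemma seriesCoeff_insert_insert_eq_sum [DecidableEq ι] {n d : ℕ} {S : Finset ι} {s t : ι}
    (hs : s ∉ insert t S) (ht : t ∉ S) {a : ι → ℕ} (h : a s ≤ d + 1) (hst : a s ≤ a t) :
    seriesCoeff (n + 1) d (insert s (insert t S)) a = ∑ j ∈ range (a s),
      seriesCoeff n (d - j) (insert t S) (Function.update a t (a s + a t - 1 - 2 * j)) := by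
  simp only [seriesCoeff, prod_insert hs, prod_insert ht, Function.update_self]
  rw [← mul_assoc (1 - _) (1 - _), one_sub_pow_mul_one_sub_pow _ hst,
    mul_comm (1 - PowerSeries.X), mul_assoc, mul_assoc, mul_left_comm
    (1 - PowerSeries.X), one_sub_X_mul_invOneSubPow, sum_mul, map_sum]
  refine sum_congr rfl fun j hj => ?_
  rw [mem_range] at hj
  rw [mul_assoc, PowerSeries.coeff_X_pow_mul', if_pos (by omega), mul_assoc]
  congr 3
  exact prod_congr rfl fun i hi => by
    rw [Function.update_of_ne (by rintro rfl; exact ht hi)]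

variable [Fintype ι]

/-- The expected value of `genDim k n d m`. -/
def expDim (n d : ℕ) (m : ι → ℕ) : ℤ :=
  seriesCoeff (n + 1) d univ fun i => d + 1 - m i

lemma expDim_eq [DecidableEq ι] (n d : ℕ) (m : ι → ℕ) (s : ι) : expDim n d m =
    seriesCoeff (n + 1) d (insert s (univ.erase s)) fun i => d + 1 - m i := by
  rw [insert_erase (mem_univ s), expDim]

lemma expDim_of_eq_zero [DecidableEq ι] {n d : ℕ} {m : ι → ℕ} {s : ι} (hs : m s = 0) :
    expDim n d m = seriesCoeff (n + 1) d (univ.erase s) fun i => d + 1 - m i := by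
  rw [expDim_eq n d m s, seriesCoeff_insert_of_lt (notMem_erase s _) (by simp only [hs]; omega)]

lemma expDim_zero (k : Type*) [Field k] (n d : ℕ) :
    expDim n d (0 : ι → ℕ) = genDim k n d (0 : ι → ℕ) := by
  have h : expDim n d (0 : ι → ℕ) = seriesCoeff (n + 1) d (∅ : Finset ι) fun _ => d + 1 := by
    classical
    suffices H : ∀ S : Finset ι, seriesCoeff (n + 1) d S (fun _ => d + 1) =
      seriesCoeff (n + 1) d (∅ : Finset ι) fun _ => d + 1 from H univ
    intro S
    induction S using Finset.induction_on with
    | empty => rfl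
    | insert s S hs ih => rw [seriesCoeff_insert_of_lt hs (by omega), ih]
  rw [h, genDim_zero, finrank_homogeneousSubmodule, seriesCoeff, prod_empty, one_mul,
    PowerSeries.invOneSubPow_val_succ_eq_mk_add_choose, PowerSeries.coeff_mk]

lemma expDim_zero_of_single [DecidableEq ι] {d : ℕ} {m : ι → ℕ} {s : ι} (hs : m s ≠ 0)
    (hsd : m s ≤ d) (h : ∀ i, i ≠ s → m i = 0) : expDim 0 d m = 0 := by
  have h0 : ∀ (m : ι → ℕ) (e : ℕ), e ≤ d → (∀ i, i ≠ s → m i = 0) →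
      seriesCoeff 1 e (univ.erase s) (fun i => d + 1 - m i) = 1 := fun m e he h => by
    have h1 : seriesCoeff 1 e (univ.erase s) (fun i => d + 1 - m i) =
        expDim 0 e (0 : ι → ℕ) := by
      rw [expDim_of_eq_zero (s := s) rfl]
      refine seriesCoeff_congr fun i hi => Or.inr ?_
      rw [h i (ne_of_mem_erase hi)]
      simp only [Pi.zero_apply]
      omega
    rw [h1, expDim_zero ℚ, genDim_zero, finrank_homogeneousSubmodule]
    simp
  rw [expDim_eq 0 d m s, seriesCoeff_insert _ _ (notMem_erase s _), h0 m d le_rfl h,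
    if_pos (by omega), h0 m _ (by omega) h, sub_self]

lemma expDim_update [DecidableEq ι] {n d : ℕ} {m : ι → ℕ} {s : ι} (hs : m s ≠ 0) (hd : m s ≤ d) :
    expDim (n + 1) d m = expDim (n + 1) d (Function.update m s (m s - 1)) -
      expDim n (m s - 1) (fun i => if i = s then 0 else m s + m i - (d + 1)) := by
  have hc : ∀ e, seriesCoeff (n + 2) e (univ.erase s)
      (fun i => d + 1 - Function.update m s (m s - 1) i) =
      seriesCoeff (n + 2) e (univ.erase s) fun i => d + 1 - m i := fun e =>
    seriesCoeff_congr fun i hi => by simp [ne_of_mem_erase hi]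
  rw [expDim_of_eq_zero (m := fun i => if i = s then 0 else m s + m i - (d + 1)) (if_pos rfl),
    expDim_eq (n + 1) d m s,
    expDim_eq (n + 1) d _ s, seriesCoeff_insert _ _ (notMem_erase s _),
    seriesCoeff_insert _ _ (notMem_erase s _), hc, hc]
  simp only [Function.update_self]
  rw [if_pos (by omega)]
  have h2 : seriesCoeff (n + 1) (m s - 1) (univ.erase s) (fun i => m s - 1 + 1 -
      if i = s then 0 else m s + m i - (d + 1)) =
      seriesCoeff (n + 1) (m s - 1) (univ.erase s) fun i => d + 1 - m i :=
    seriesCoeff_congr fun i hi => by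
      simp only [ne_of_mem_erase hi, if_false]
      omega
  rw [h2]
  split_ifs with h
  · have h3 := seriesCoeff_succ (n + 1) (m s - 2) (univ.erase s) fun i => d + 1 - m i
    rw [show d - (d + 1 - m s) = m s - 2 + 1 by omega, h3,
      show d - (d + 1 - (m s - 1)) = m s - 2 by omega, show m s - 1 = m s - 2 + 1 by omega]
    ring
  · have h1 : m s = 1 := by omega
    rw [h1, show d - (d + 1 - 1) = 0 by omega]
    have h3 : ∀ n, seriesCoeff n 0 (univ.erase s) (fun i => d + 1 - m i) =
      PowerSeries.constantCoeff (∏ i ∈ univ.erase s, (1 - PowerSeries.X ^ (d + 1 - m i))) := by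
      intro n
      rw [seriesCoeff, PowerSeries.coeff_zero_eq_constantCoeff_apply, map_mul]
      rcases n with _ | n
      · simp [PowerSeries.invOneSubPow_zero]
      · simp [PowerSeries.invOneSubPow_val_succ_eq_mk_add_choose]
    rw [h3, h3, sub_zero]

lemma expDim_eq_sum [DecidableEq ι] {n d : ℕ} {m : ι → ℕ} {s : ι} :
    expDim (n + 1) d m = ∑ j ∈ range (d + 1 - m s),
      expDim n (d - j)
        (fun i => if i = s then 0 else if i ∈ (∅ : Finset ι) then m s + m i + j - d else m i - j) := by
  rw [expDim_eq (n + 1) d m s, seriesCoeff_insert_eq_sum (notMem_erase s _) (by omega)]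
  refine sum_congr rfl fun j hj => ?_
  rw [mem_range] at hj
  rw [expDim_of_eq_zero (s := s) (if_pos rfl)]
  refine seriesCoeff_congr fun i hi => ?_
  simp only [ne_of_mem_erase hi, if_false, notMem_empty]
  omega

lemma expDim_eq_sum_of_le [DecidableEq ι] {n d : ℕ} {m : ι → ℕ} {s t : ι} (hst : t ≠ s)
    (hs : m s ≤ d) (h : m t ≤ m s) : expDim (n + 1) d m = ∑ j ∈ range (d + 1 - m s),
      expDim n (d - j)
        (fun i => if i = s then 0 else if i ∈ ({t} : Finset ι) then m s + m i + j - d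
          else m i - j) := by
  have ht : t ∈ univ.erase s := mem_erase.mpr ⟨hst, mem_univ t⟩
  rw [expDim_eq (n + 1) d m s, ← insert_erase ht, seriesCoeff_insert_insert_eq_sum
    (by rw [insert_erase ht]; exact notMem_erase s _) (notMem_erase t _) (by omega) (by omega),
    insert_erase ht]
  refine sum_congr rfl fun j hj => ?_
  rw [mem_range] at hj
  rw [expDim_of_eq_zero (s := s) (if_pos rfl)]
  refine seriesCoeff_congr fun i hi => ?_
  simp only [ne_of_mem_erase hi, if_false, mem_singleton]
  by_cases hit : i = t
  · subst hit
    simp only [Function.update_self, if_true]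
    omega
  · simp only [Function.update_of_ne hit, hit, if_false]
    omega

lemma expDim_add_expDim [DecidableEq ι] {n d : ℕ} {m : ι → ℕ} {I : Finset ι} {s : ι} (hs : s ∉ I)
    (hsd : m s ≤ d) (hs0 : m s ≠ 0) (hI : ∀ i ∈ I, m i ≠ 0) (hI' : ∀ i ∉ I, i ≠ s → m i + m s ≤ d + 1) :
    expDim n (d + 1) m +
        expDim n d (Function.update (fun i => if i ∈ I then m i - 1 else m i) s 0) =
      expDim n (d + 1) (Function.update m s 0) +
        expDim n d (fun i => if i ∈ I then m i - 1 else m i) := by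
  have hc : ∀ (e : ℕ) (m : ι → ℕ), seriesCoeff (n + 1) e (univ.erase s)
      (fun i => e + 1 - Function.update m s 0 i) =
      seriesCoeff (n + 1) e (univ.erase s) fun i => e + 1 - m i := fun e m =>
    seriesCoeff_congr fun i hi => by simp [ne_of_mem_erase hi]
  rw [expDim_of_eq_zero (m := Function.update _ s 0) (Function.update_self s _ _),
    expDim_of_eq_zero (m := Function.update m s 0) (Function.update_self s _ _), hc, hc,
    expDim_eq _ _ _ s, expDim_eq _ _ _ s, seriesCoeff_insert _ _ (notMem_erase s _),
    seriesCoeff_insert _ _ (notMem_erase s _)]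
  simp only [hs, if_false]
  rw [if_pos (by omega), if_pos (by omega), show d + 1 - (d + 1 + 1 - m s) = m s - 1 by omega,
    show d - (d + 1 - m s) = m s - 1 by omega,
    seriesCoeff_congr (d := m s - 1) (a := fun i => d + 1 + 1 - m i)
      (b := fun i => d + 1 - if i ∈ I then m i - 1 else m i) fun i hi => by
      by_cases h : i ∈ I
      · have := hI i h
        simp only [h, if_true]
        omega
      · have := hI' i h (ne_of_mem_erase hi)
        simp only [h, if_false]
        omega]
  ring

end Expected

section Admissible

variable {ι : Type*} [Fintype ι]

/-- The number of nonzero multiplicities. -/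
def suppCard (m : ι → ℕ) : ℕ := ∑ i, min (m i) 1

/-- The effectivity bounds under which `genDim` and `expDim` agree. -/
def Admissible (n d : ℕ) (m : ι → ℕ) : Prop :=
  (∀ i, m i ≤ d) ∧ (suppCard m ≤ n + 1 ∨ ∑ i, m i ≤ n * d ∨
    (∑ i, m i + #{i | m i = d} ≤ n * d + n ∧ ∑ i, m i + n + 2 ≤ n * d + suppCard m))

lemma suppCard_eq_card (m : ι → ℕ) : suppCard m = #{i | m i ≠ 0} := by
  rw [suppCard, card_filter]
  refine sum_congr rfl fun i _ => ?_
  split_ifs with h <;> omega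

lemma suppCard_mono {m' m : ι → ℕ} (h : m' ≤ m) : suppCard m' ≤ suppCard m :=
  sum_le_sum fun i _ => min_le_min_right 1 (h i)

lemma Admissible.anti {n d : ℕ} {m' m : ι → ℕ} (hm : Admissible n d m) (h : m' ≤ m) :
    Admissible n d m' := by
  have hs : ∑ i, m' i ≤ ∑ i, m i := sum_le_sum fun i _ => h i
  have ht : #{i | m' i = d} ≤ #{i | m i = d} := card_le_card fun i hi => by
    simp only [mem_filter, mem_univ, true_and] at hi ⊢
    have h1 : m' i ≤ m i := h i
    have := hm.1 i
    omega
  have hc : ∑ i, m' i + suppCard m ≤ ∑ i, m i + suppCard m' := by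
    simp only [suppCard, ← sum_add_distrib]
    refine sum_le_sum fun i _ => ?_
    have h1 : m' i ≤ m i := h i
    omega
  have := suppCard_mono h
  refine ⟨fun i => (h i).trans (hm.1 i), ?_⟩
  have := hm.2
  omega

variable [DecidableEq ι]

lemma Admissible.cone {n d : ℕ} {m : ι → ℕ} {s : ι} (hm : Admissible (n + 1) d m) (hs : m s ≠ 0) :
    Admissible n (m s - 1) (fun i => if i = s then 0 else m s + m i - (d + 1)) := by
  set μ : ι → ℕ := fun i => if i = s then 0 else m s + m i - (d + 1) with hμ
  obtain ⟨hd, h⟩ := hm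
  have hsd := hd s
  refine ⟨fun i => ?_, ?_⟩
  · have := hd i
    simp only [hμ]
    split_ifs <;> omega
  obtain ⟨e, he⟩ : ∃ e, m s = e + 1 := ⟨m s - 1, by omega⟩
  obtain ⟨c, rfl⟩ : ∃ c, d = e + c := ⟨d - e, by omega⟩
  have hc : 1 ≤ c := by omega
  rw [he, Nat.add_sub_cancel]
  have hμi : ∀ i, i ≠ s → μ i = m i - c := fun i hi => by
    simp only [hμ, hi, if_false]
    omega
  have hμs : μ s = 0 := if_pos rfl
  have key : ∑ i, μ i + c * suppCard μ + suppCard m + m s ≤ ∑ i, m i + suppCard μ + 1 := by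
    have h1 : ∑ i ∈ univ.erase s, (μ i + c * min (μ i) 1 + min (m i) 1) ≤
        ∑ i ∈ univ.erase s, (m i + min (μ i) 1) := sum_le_sum fun i hi => by
      rw [hμi i (ne_of_mem_erase hi)]
      rcases Nat.lt_or_ge c (m i) with hl | hl
      · rw [min_eq_right (by omega : 1 ≤ m i - c), min_eq_right (by omega : 1 ≤ m i)]
        omega
      · rw [Nat.sub_eq_zero_of_le hl]
        simp
    simp only [suppCard, ← add_sum_erase univ _ (mem_univ s), hμs]
    simp only [sum_add_distrib, ← mul_sum] at h1
    rw [min_eq_right (by omega : 1 ≤ m s)]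
    simp only [Nat.zero_min, zero_add]
    omega
  have hsub : suppCard m ≤ ∑ i, m i := sum_le_sum fun i _ => min_le_left _ _
  by_cases hA : suppCard μ ≤ n + 1
  · exact Or.inl hA
  obtain ⟨u, hu⟩ : ∃ u, suppCard μ = n + 2 + u := ⟨suppCard μ - (n + 2), by omega⟩
  have hle : suppCard μ + 1 ≤ suppCard m := by
    simp only [suppCard, ← add_sum_erase univ _ (mem_univ s), hμs]
    have : ∑ i ∈ univ.erase s, min (μ i) 1 ≤ ∑ i ∈ univ.erase s, min (m i) 1 :=
      sum_le_sum fun i hi => by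
        rw [hμi i (ne_of_mem_erase hi)]
        omega
    rw [min_eq_right (by omega : 1 ≤ m s)]
    omega
  have ht : #{i | μ i = e} ≤ #{i | m i = e + c} ∨ e = 0 := by
    rcases Nat.eq_zero_or_pos e with h0 | h0
    · exact Or.inr h0
    · refine Or.inl (card_le_card fun i hi => ?_)
      simp only [mem_filter, mem_univ, true_and] at hi ⊢
      have his : i ≠ s := by
        rintro rfl
        omega
      rw [hμi i his] at hi
      omega
  have he0 : e ≠ 0 := by
    rintro rfl
    have : suppCard μ = 0 := sum_eq_zero fun i _ => by
      have : μ i = 0 := by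
        by_cases his : i = s
        · rw [his, hμs]
        · rw [hμi i his]
          have := hd i
          omega
      rw [this]
      rfl
    omega
  rw [hu] at key ⊢
  have hcu : u ≤ c * u := Nat.le_mul_of_pos_left _ hc
  have e1 : c * (n + 2 + u) = c * n + 2 * c + c * u := by ring
  have e2 : (n + 1) * (e + c) = n * e + c * n + e + c := by ring
  rw [e1, he] at key
  rw [e2] at h
  omega

lemma Admissible.erase_top {n d : ℕ} {m : ι → ℕ} {s : ι} (hm : Admissible (n + 1) d m)
    (hs : m s = d) (hd : d ≠ 0) : Admissible n d (fun i => if i = s then 0 else m i) := by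
  obtain ⟨h1, h⟩ := hm
  refine ⟨fun i => ?_, ?_⟩
  · have := h1 i
    dsimp only
    split_ifs <;> omega
  have e1 : ∑ i, m i = (∑ i, if i = s then 0 else m i) + d := by
    simp only [← add_sum_erase univ _ (mem_univ s), if_true, hs]
    rw [sum_congr rfl fun i hi => (if_neg (ne_of_mem_erase hi) : (if i = s then 0 else m i) = m i),
      zero_add, add_comm]
  have e2 : suppCard m = suppCard (fun i => if i = s then 0 else m i) + 1 := by
    simp only [suppCard, ← add_sum_erase univ _ (mem_univ s), if_true, hs]
    rw [sum_congr rfl fun i hi => (by rw [if_neg (ne_of_mem_erase hi)] :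
      min (if i = s then 0 else m i) 1 = min (m i) 1), min_eq_right (by omega : 1 ≤ d),
      Nat.zero_min, zero_add, add_comm]
  have e3 : #{i | (if i = s then 0 else m i) = d} + 1 ≤ #{i | m i = d} := by
    rw [← card_erase_add_one (s := univ.filter fun i => m i = d) (a := s) (by simp [hs])]
    refine Nat.add_le_add_right (card_le_card fun i hi => ?_) 1
    simp only [mem_filter, mem_univ, true_and, mem_erase] at hi ⊢
    split_ifs at hi with h
    · exact absurd hi.symm hd
    · exact ⟨h, hi⟩
  rw [e1, e2, Nat.succ_mul] at h
  dsimp only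
  omega

lemma Admissible.of_suppCard_le {n d j : ℕ} {m : ι → ℕ} {s : ι} (h1 : ∀ i, m i ≤ d)
    (hm : suppCard m ≤ n + 2) (hs : m s ≠ 0) :
    Admissible n (d - j) (fun i => if i = s then 0 else m i - j) := by
  refine ⟨fun i => ?_, Or.inl ?_⟩
  · have := h1 i
    dsimp only
    split_ifs <;> omega
  have : suppCard (fun i => if i = s then 0 else m i - j) + 1 ≤ suppCard m := by
    simp only [suppCard, ← add_sum_erase univ _ (mem_univ s), if_true]
    have : ∑ i ∈ univ.erase s, min (if i = s then 0 else m i - j) 1 ≤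
        ∑ i ∈ univ.erase s, min (m i) 1 := sum_le_sum fun i _ => by split_ifs <;> omega
    rw [min_eq_right (by omega : 1 ≤ m s)]
    omega
  omega

/-- The multiplicities obtained from a degeneration along the line through two points. -/
def pairMult (d j : ℕ) (m : ι → ℕ) (a b : ι) : ι → ℕ :=
  fun i => if i = a then 0 else if i ∈ ({b} : Finset ι) then m a + m i + j - d else m i - j

lemma sum_eq_add_add {a b : ι} (hab : b ≠ a) (f : ι → ℕ) :
    ∑ i, f i = f a + (f b + ∑ i ∈ (univ.erase a).erase b, f i) := by
  rw [add_sum_erase _ _ (mem_erase.mpr ⟨hab, mem_univ b⟩), add_sum_erase _ _ (mem_univ a)]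

lemma sum_pairMult_add_le {d j : ℕ} {m : ι → ℕ} {a b : ι} (hab : b ≠ a) (h : d + 1 ≤ m a + m b)
    (ha : m a ≠ 0) (hb : m b ≠ 0) :
    ∑ i, pairMult d j m a b i + j * suppCard (pairMult d j m a b) + d + suppCard m ≤
      ∑ i, m i + 2 * j + suppCard (pairMult d j m a b) + 1 := by
  have hμ : ∀ i ∈ (univ.erase a).erase b, pairMult d j m a b i = m i - j := fun i hi => by
    simp only [mem_erase] at hi
    simp [pairMult, hi.1, hi.2.1]
  have hμa : pairMult d j m a b a = 0 := by simp [pairMult]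
  have hμb : pairMult d j m a b b = m a + m b + j - d := by simp [pairMult, hab]
  have h1 : ∑ i ∈ (univ.erase a).erase b, (pairMult d j m a b i +
      j * min (pairMult d j m a b i) 1 + min (m i) 1) ≤
      ∑ i ∈ (univ.erase a).erase b, (m i + min (pairMult d j m a b i) 1) :=
    sum_le_sum fun i hi => by
      rw [hμ i hi]
      rcases Nat.lt_or_ge j (m i) with hl | hl
      · rw [min_eq_right (by omega : 1 ≤ m i - j), min_eq_right (by omega : 1 ≤ m i)]
        omega
      · rw [Nat.sub_eq_zero_of_le hl]
        simp
  simp only [suppCard, sum_eq_add_add hab, hμa, hμb]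
  simp only [sum_add_distrib, ← mul_sum] at h1
  rw [min_eq_right (by omega : 1 ≤ m a), min_eq_right (by omega : 1 ≤ m b),
    min_eq_right (by omega : 1 ≤ m a + m b + j - d), mul_add, mul_add]
  simp only [Nat.zero_min, zero_add, mul_zero, mul_one]
  omega

lemma Admissible.pairMult {n d j : ℕ} {m : ι → ℕ} {a b : ι} (hm : Admissible (n + 1) d m)
    (hab : b ≠ a) (h : d + 1 ≤ m a + m b) (hba : m b ≤ m a) (hd : ∀ i, m i < d)
    (hj : j < d + 1 - m a) (hsum : ∑ i, m i ≤ (n + 1) * d + n) :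
    Admissible n (d - j) (pairMult d j m a b) := by
  have ha := hd a
  have key := sum_pairMult_add_le (j := j) hab h (by omega) (by omega)
  have h2 := hm.2
  set μ := _root_.pairMult d j m a b with hμ
  have ht : #{i | μ i = d - j} ≤ 1 ∧ (j = 0 → #{i | μ i = d - j} = 0) := by
    have hsub : ∀ i, μ i = d - j → i = b ∧ j ≠ 0 := fun i hi => by
      have hdi := hd i
      simp only [hμ, _root_.pairMult, mem_singleton] at hi
      split_ifs at hi with h3 h4
      · omega
      · subst h4
        exact ⟨rfl, by omega⟩
      · omega
    constructor
    · rw [← card_singleton b]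
      refine card_le_card fun i hi => ?_
      simp only [mem_filter, mem_univ, true_and] at hi
      simpa using (hsub i hi).1
    · intro h0
      rw [card_eq_zero, filter_eq_empty_iff]
      exact fun i _ hi => (hsub i hi).2 h0
  refine ⟨fun i => ?_, ?_⟩
  · have := hd i
    simp only [hμ, _root_.pairMult, mem_singleton]
    split_ifs with h3 h4
    · omega
    · subst h4
      omega
    · omega
  by_cases hA : suppCard μ ≤ n + 1
  · exact Or.inl hA
  obtain ⟨u, hu⟩ : ∃ u, suppCard μ = n + 2 + u := ⟨suppCard μ - (n + 2), by omega⟩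
  obtain ⟨D, rfl⟩ : ∃ D, d = D + j := ⟨d - j, by omega⟩
  have hle : suppCard μ + 1 ≤ suppCard m := by
    have hμa : μ a = 0 := by simp [hμ, _root_.pairMult]
    simp only [suppCard, sum_eq_add_add hab, hμa]
    have : ∑ i ∈ (univ.erase a).erase b, min (μ i) 1 ≤
        ∑ i ∈ (univ.erase a).erase b, min (m i) 1 := sum_le_sum fun i hi => by
      simp only [mem_erase] at hi
      simp only [hμ, _root_.pairMult, hi.1, hi.2.1, mem_singleton, if_false]
      omega
    omega
  rw [hu] at key ⊢
  have e1 : j * (n + 2 + u) = n * j + 2 * j + j * u := by ring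
  have e2 : (n + 1) * (D + j) = n * D + n * j + D + j := by ring
  have hju : j = 0 ∨ u ≤ j * u := by
    rcases Nat.eq_zero_or_pos j with h0 | h0
    · exact Or.inl h0
    · exact Or.inr (Nat.le_mul_of_pos_left _ h0)
  have hn : n = 0 → n * D = 0 ∧ n * j = 0 := by
    rintro rfl
    simp
  rw [e1] at key
  rw [e2] at h2 hsum
  rw [Nat.add_sub_cancel] at ht ⊢
  rcases hju with rfl | hju
  · rw [Nat.zero_mul] at key
    omega
  · omega

end Admissible

section Nonempty

variable {k : Type*} [Field k] {ι : Type*}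

lemma exists_subset_card_le {S T : Finset ι} {n : ℕ} (hTS : T ⊆ S) (hT : #T ≤ n) :
    ∃ I, T ⊆ I ∧ I ⊆ S ∧ #I ≤ n ∧ (#I = n ∨ I = S ∧ #S < n) := by
  rcases Nat.lt_or_ge #S n with h | h
  · exact ⟨S, hTS, Subset.rfl, h.le, Or.inr ⟨rfl, h⟩⟩
  · obtain ⟨I, h1, h2, h3⟩ := exists_subsuperset_card_eq hTS hT h
    exact ⟨I, h1, h2, h3.le, Or.inl h3⟩

lemma genDim_zero_pos (n d : ℕ) : 0 < genDim k n d (0 : ι → ℕ) := by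
  rw [genDim_zero, finrank_homogeneousSubmodule]
  exact Nat.choose_pos (Nat.le_add_right n d)

lemma genDim_le_finrank [Infinite k] (n d : ℕ) (m : ι → ℕ) :
    genDim k n d m ≤ (n + d).choose n := by
  rw [← finrank_homogeneousSubmodule k, ← genDim_zero (ι := ι)]
  exact genDim_mono fun i => Nat.zero_le _

variable [Fintype ι]

lemma card_filter_eq_mul_le (m : ι → ℕ) (d : ℕ) : #{i | m i = d} * d ≤ ∑ i, m i := by
  rw [card_eq_sum_ones, sum_mul]
  refine (sum_le_sum fun i hi => ?_).trans (sum_le_univ_sum_of_nonneg fun i => Nat.zero_le _)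
  simp only [mem_filter, mem_univ, true_and] at hi
  rw [one_mul, hi]

variable [DecidableEq ι]

lemma sum_ite_sub_one_add_card {m : ι → ℕ} {I : Finset ι} (hI : ∀ i ∈ I, m i ≠ 0) :
    (∑ i, if i ∈ I then m i - 1 else m i) + #I = ∑ i, m i := by
  have h : #I = ∑ i, if i ∈ I then 1 else 0 := by simp
  rw [h, ← sum_add_distrib]
  refine sum_congr rfl fun i _ => ?_
  split_ifs with hi
  · have := hI i hi
    omega
  · rfl

lemma genDim_pos [Infinite k] {n d : ℕ} {m : ι → ℕ} (hd : ∀ i, m i ≤ d)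
    (hm : ∑ i, m i ≤ n * d) : 0 < genDim k n d m := by
  induction d generalizing m with
  | zero =>
    have : m = 0 := funext fun i => by simpa using hd i
    rw [this]
    exact genDim_zero_pos n 0
  | succ d ih =>
    have hT : #{i | m i = d + 1} ≤ n :=
      Nat.le_of_mul_le_mul_right ((card_filter_eq_mul_le m (d + 1)).trans hm) d.succ_pos
    obtain ⟨I, h1, h2, hIn, h3⟩ := exists_subset_card_le (S := {i | m i ≠ 0})
      (fun i hi => by simp only [mem_filter, mem_univ, true_and] at hi ⊢; omega) hT
    have hI : ∀ i ∈ I, m i ≠ 0 := fun i hi => by simpa using h2 hi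
    have hsum := sum_ite_sub_one_add_card hI
    have hd' : ∀ i, (if i ∈ I then m i - 1 else m i) ≤ d := fun i => by
      have := hd i
      split_ifs with hi
      · omega
      · by_contra hc
        exact hi (h1 (by simp only [mem_filter, mem_univ, true_and]; omega))
    refine genDim_succ_pos (I := I) hIn (ih hd' ?_)
    rw [Nat.mul_succ] at hm
    rcases h3 with h3 | ⟨rfl, h3⟩
    · omega
    · have h4 : (∑ i, if i ∈ ({i | m i ≠ 0} : Finset ι) then m i - 1 else m i) ≤
          #{i | m i ≠ 0} * d := by
        rw [card_eq_sum_ones, sum_mul, one_mul, sum_filter]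
        refine sum_le_sum fun i _ => ?_
        have := hd i
        simp only [mem_filter, mem_univ, true_and]
        split_ifs <;> omega
      exact h4.trans (Nat.mul_le_mul_right d h3.le)

lemma choose_le_genDim_add_sum [Infinite k] {n d : ℕ} {m : ι → ℕ} (hd : 1 ≤ d)
    (hm : ∀ i, m i ≤ 1) : (n + 1 + d).choose (n + 1) ≤ genDim k (n + 1) d m + ∑ i, m i := by
  induction hN : ∑ i, m i using Nat.strong_induction_on generalizing m with
  | _ N ih =>
    by_cases h0 : m = 0
    · rw [h0, genDim_zero, finrank_homogeneousSubmodule]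
      exact Nat.le_add_right _ _
    · obtain ⟨s, hs⟩ : ∃ s, m s ≠ 0 := by
        by_contra! hc
        exact h0 (funext hc)
      have hs1 := hm s
      have hle := genDim_update_le (k := k) (n := n) (m := m) (s := s) hs (hs1.trans hd)
      have h2 := genDim_le_finrank (k := k) n (m s - 1)
        (fun i => if i = s then 0 else m s + m i - (d + 1))
      rw [show m s - 1 = 0 by omega, show n + 0 = n from rfl, Nat.choose_self] at h2
      have h3 : ∑ i, Function.update m s (m s - 1) i + 1 = ∑ i, m i := by
        rw [← add_sum_erase univ _ (mem_univ s), ← add_sum_erase univ m (mem_univ s),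
          Function.update_self, sum_congr rfl fun i hi =>
            Function.update_of_ne (ne_of_mem_erase hi) _ _]
        omega
      have h4 := @ih _ (by omega) (Function.update m s (m s - 1)) (fun i => by
        by_cases hi : i = s
        · subst hi
          rw [Function.update_self]
          omega
        · rw [Function.update_of_ne hi]
          exact hm i) rfl
      rw [show m s - 1 = 0 by omega] at hle h3 h4
      omega

lemma genDim_pos_of_card_le [Infinite k] {n d : ℕ} {m : ι → ℕ} (hn : n ≠ 0) (hd2 : 2 ≤ d)
    (hd : ∀ i, m i < d) (hc : #{i | 2 ≤ m i} ≤ n) (hm : ∑ i, m i + 1 ≤ n * d + n) :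
    0 < genDim k n d m := by
  induction d, hd2 using Nat.le_induction generalizing m with
  | base =>
    obtain ⟨n, rfl⟩ := Nat.exists_eq_succ_of_ne_zero hn
    have h := choose_le_genDim_add_sum (k := k) (n := n) one_le_two fun i =>
      Nat.le_of_lt_succ (hd i)
    rw [Nat.choose_symm_add, Nat.choose_two_right] at h
    have h2 : (3 * (n + 1)) * 2 ≤ (n + 1 + 2) * (n + 1 + 2 - 1) := by
      rw [show n + 1 + 2 - 1 = n + 2 by omega]
      rcases n with _ | n
      · norm_num
      · nlinarith
    rw [← Nat.le_div_iff_mul_le two_pos] at h2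
    rw [Nat.succ_eq_add_one] at hm
    rw [Nat.succ_eq_add_one]
    omega
  | succ d hd2 ih =>
    obtain ⟨I, h1, h2, hIn, h3⟩ := exists_subset_card_le (S := {i | m i ≠ 0})
      (fun i hi => by simp only [mem_filter, mem_univ, true_and] at hi ⊢; omega) hc
    have hI : ∀ i ∈ I, m i ≠ 0 := fun i hi => by simpa using h2 hi
    have hI1 : ∀ i ∉ I, m i ≤ 1 := fun i hi => by
      by_contra hc
      exact hi (h1 (by simp only [mem_filter, mem_univ, true_and]; omega))
    have hsum := sum_ite_sub_one_add_card hI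
    refine genDim_succ_pos (I := I) hIn (ih (fun i => ?_) ?_ ?_)
    · have := hd i
      split_ifs with hi
      · have := hI i hi
        omega
      · have := hI1 i hi
        omega
    · refine (card_le_card fun i hi => ?_).trans hc
      simp only [mem_filter, mem_univ, true_and] at hi ⊢
      split_ifs at hi <;> omega
    · rw [Nat.mul_succ] at hm
      rcases h3 with h3 | ⟨rfl, h3⟩
      · omega
      · have h4 : (∑ i, if i ∈ ({i | m i ≠ 0} : Finset ι) then m i - 1 else m i) ≤
            #{i | m i ≠ 0} * d := by
          rw [card_eq_sum_ones, sum_mul, one_mul, sum_filter]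
          refine sum_le_sum fun i _ => ?_
          have := hd i
          simp only [mem_filter, mem_univ, true_and]
          split_ifs <;> omega
        have := Nat.mul_le_mul_right d h3.le
        omega

end Nonempty

section Main

lemma exists_notMem_of_card_lt {ι : Type*} [Fintype ι] {m : ι → ℕ} {I : Finset ι} (h : #I < suppCard m) :
    ∃ s ∉ I, m s ≠ 0 := by
  rw [suppCard_eq_card] at h
  obtain ⟨s, hs, hsI⟩ := exists_mem_notMem_of_card_lt_card h
  exact ⟨s, hsI, by simpa using hs⟩

variable {k : Type*} [Field k] [Infinite k] {ι : Type*} [Fintype ι] [DecidableEq ι]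

/-- The conditions on `s` and `I` under which restricting to the hyperplane through the points of
`I` shows that the point `s` imposes the expected number of conditions. -/
structure IsTracePair (n d : ℕ) (m : ι → ℕ) (s : ι) (I : Finset ι) : Prop where
  notMem : s ∉ I
  card_eq : #I = n
  ne_zero : m s ≠ 0
  ne_zero_of_mem : ∀ i ∈ I, m i ≠ 0
  add_le : ∀ i ∉ I, i ≠ s → m i + m s ≤ d + 1
  admissible : Admissible n d fun i => if i ∈ I then m i - 1 else m i

lemma genDim_le_expDim_of_isTracePair {n d : ℕ} {m : ι → ℕ} {s : ι} {I : Finset ι}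
    (hm : Admissible n (d + 1) m) (hsd : m s ≤ d) (h : IsTracePair n d m s I)
    (ih : ∀ {d' : ℕ} {m' : ι → ℕ}, d' + ∑ i, m' i < d + 1 + ∑ i, m i → Admissible n d' m' →
      (genDim k n d' m' : ℤ) = expDim n d' m') :
    (genDim k n (d + 1) m : ℤ) ≤ expDim n (d + 1) m := by
  have hle := genDim_add_genDim_le (k := k) (d := d) (m := m) h.notMem h.card_eq
  have heq := expDim_add_expDim (n := n) h.notMem hsd h.ne_zero h.ne_zero_of_mem h.add_le
  have hu : ∀ m : ι → ℕ, Function.update m s 0 ≤ m := fun m =>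
    update_le_iff.mpr ⟨Nat.zero_le _, fun _ _ => le_rfl⟩
  have hu' : ∑ i, Function.update m s 0 i < ∑ i, m i :=
    sum_lt_sum (fun i _ => hu m i) ⟨s, mem_univ s, by
      rw [Function.update_self]
      exact Nat.pos_of_ne_zero h.ne_zero⟩
  have hsum := sum_ite_sub_one_add_card h.ne_zero_of_mem
  have hu'' := sum_le_sum fun i (_ : i ∈ univ) => hu (fun i => if i ∈ I then m i - 1 else m i) i
  dsimp only at hu''
  have h1 := ih (by omega) (hm.anti (hu m))
  have h2 := ih (by omega) h.admissible
  have h3 := ih (by omega) (h.admissible.anti (hu _))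
  zify at hle
  linarith

lemma genDim_le_expDim_of_sum {n d : ℕ} {m : ι → ℕ} {s : ι} {J : Finset ι} (hs : m s ≠ 0)
    (hd : m s ≤ d)
    (h : expDim (n + 1) d m = ∑ j ∈ range (d + 1 - m s), expDim n (d - j)
      (fun i => if i = s then 0 else if i ∈ J then m s + m i + j - d else m i - j))
    (hJ : ∀ j < d + 1 - m s, Admissible n (d - j)
      (fun i => if i = s then 0 else if i ∈ J then m s + m i + j - d else m i - j))
    (ihn : ∀ {d : ℕ} {m : ι → ℕ}, Admissible n d m → (genDim k n d m : ℤ) = expDim n d m) :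
    (genDim k (n + 1) d m : ℤ) ≤ expDim (n + 1) d m := by
  rw [h, ← sum_congr rfl fun j hj => ihn (hJ j (mem_range.mp hj))]
  exact_mod_cast genDim_le_sum J hs hd

lemma expDim_le_genDim {n d : ℕ} {m : ι → ℕ} {s : ι} (hs : m s ≠ 0)
    (hm : Admissible (n + 1) d m)
    (ihn : ∀ {d : ℕ} {m : ι → ℕ}, Admissible n d m → (genDim k n d m : ℤ) = expDim n d m)
    (ih : ∀ {d' : ℕ} {m' : ι → ℕ}, d' + ∑ i, m' i < d + ∑ i, m i → Admissible (n + 1) d' m' →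
      (genDim k (n + 1) d' m' : ℤ) = expDim (n + 1) d' m') :
    expDim (n + 1) d m ≤ genDim k (n + 1) d m := by
  have hle := genDim_update_le (k := k) (n := n) hs (hm.1 s)
  have hu : Function.update m s (m s - 1) ≤ m :=
    update_le_iff.mpr ⟨Nat.sub_le _ _, fun _ _ => le_rfl⟩
  have hu' : ∑ i, Function.update m s (m s - 1) i < ∑ i, m i :=
    sum_lt_sum (fun i _ => hu i) ⟨s, mem_univ s, by
      rw [Function.update_self]
      omega⟩
  rw [expDim_update hs (hm.1 s), ← ihn (hm.cone hs), ← ih (by omega) (hm.anti hu)]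
  zify at hle
  linarith

lemma Admissible.sub_one {n d : ℕ} {m : ι → ℕ} {I : Finset ι} (hI : #I = n)
    (hI2 : ∀ i ∈ I, 2 ≤ m i) (hd : ∀ i, m i ≤ d) (hId : ∀ i ∉ I, m i ≠ d)
    (h1 : ∑ i, m i ≤ n * (d + 1) + n) (h2 : ∑ i, m i + n + 2 ≤ n * (d + 1) + suppCard m) :
    Admissible n d fun i => if i ∈ I then m i - 1 else m i := by
  have hsum := sum_ite_sub_one_add_card fun i hi => (by have := hI2 i hi; omega : m i ≠ 0)
  have ht : #{i | (if i ∈ I then m i - 1 else m i) = d} = 0 := by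
    rw [card_eq_zero, filter_eq_empty_iff]
    intro i _ hi
    split_ifs at hi with h
    · have := hI2 i h
      have := hd i
      omega
    · exact hId i h hi
  have hs : suppCard (fun i => if i ∈ I then m i - 1 else m i) = suppCard m :=
    sum_congr rfl fun i _ => by
      dsimp only
      split_ifs with h
      · have := hI2 i h
        omega
      · rfl
  rw [Nat.mul_succ] at h1 h2
  refine ⟨fun i => ?_, Or.inr (Or.inr ?_)⟩
  · have := hd i
    dsimp only
    split_ifs <;> omega
  · rw [hs, ht]
    dsimp only
    omega

lemma exists_isTracePair_of_sum_le {n d : ℕ} {m : ι → ℕ} (hA : n < suppCard m)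
    (hd : ∀ i, m i ≤ d) (hp : ∀ i j, i ≠ j → m i + m j ≤ d + 1) (h : ∑ i, m i ≤ n * (d + 1)) :
    ∃ s I, IsTracePair n d m s I := by
  obtain ⟨I, hI1, hI⟩ := exists_subset_card_eq (hA.le.trans_eq (suppCard_eq_card m))
  have hI0 : ∀ i ∈ I, m i ≠ 0 := fun i hi => by simpa using hI1 hi
  obtain ⟨s, hsI, hs⟩ := exists_notMem_of_card_lt (hI.trans_lt hA)
  have hsum := sum_ite_sub_one_add_card hI0
  refine ⟨s, I, hsI, hI, hs, hI0, fun i _ his => hp i s his, fun i => ?_, Or.inr (Or.inl ?_)⟩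
  · have := hd i
    dsimp only
    split_ifs <;> omega
  · rw [Nat.mul_succ] at h
    dsimp only
    omega

lemma exists_isTracePair_of_card_le {n d : ℕ} {m : ι → ℕ} (hn : n ≠ 0) (hA : n < suppCard m)
    (hd : ∀ i, m i ≤ d) (hp : ∀ i j, i ≠ j → m i + m j ≤ d + 1) (hc : n ≤ #{i | 2 ≤ m i})
    (h1 : ∑ i, m i ≤ n * (d + 1) + n) (h2 : ∑ i, m i + n + 2 ≤ n * (d + 1) + suppCard m) :
    ∃ s I, IsTracePair n d m s I := by
  obtain ⟨I, hI1, hI⟩ := exists_subset_card_eq hc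
  have hI2 : ∀ i ∈ I, 2 ≤ m i := fun i hi => by simpa using hI1 hi
  obtain ⟨s, hsI, hs⟩ := exists_notMem_of_card_lt (hI.trans_lt hA)
  obtain ⟨t, ht⟩ := card_ne_zero.mp (hI.trans_ne hn)
  refine ⟨s, I, hsI, hI, hs, fun i hi => ?_, fun i _ his => hp i s his,
    Admissible.sub_one hI hI2 hd (fun i hi hid => ?_) h1 h2⟩
  · have := hI2 i hi
    omega
  · have := hI2 t ht
    have := hp i t (by rintro rfl; exact hi ht)
    omega

lemma exists_isTracePair_of_two_le {n d : ℕ} {m : ι → ℕ} (hA : 2 * n + 2 ≤ suppCard m)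
    (hd : ∀ i, m i ≤ d) (hm2 : ∀ i, m i ≠ 1)
    (h1 : ∑ i, m i ≤ n * (d + 1) + n) (h2 : ∑ i, m i + n + 2 ≤ n * (d + 1) + suppCard m) :
    ∃ s I, IsTracePair n d m s I := by
  set S : Finset ι := {i | m i ≠ 0} with hS
  have hSc : #S = suppCard m := (suppCard_eq_card m).symm
  obtain ⟨s, hsS, hmin⟩ := exists_min_image S m (card_pos.mp (by omega))
  have hs : m s ≠ 0 := by simpa [hS] using hsS
  have hs2 := hm2 s
  have hsd := hd s
  set R : Finset ι := {i ∈ S.erase s | d + 1 < m i + m s} with hR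
  have hsum : #S * m s + #R * (d + 2 - 2 * m s) ≤ ∑ i, m i := by
    have hRS : R ⊆ S := (filter_subset _ _).trans (erase_subset _ _)
    have e1 : #S * m s = ∑ i ∈ S, m s := by rw [sum_const, smul_eq_mul]
    have e2 : #R * (d + 2 - 2 * m s) = ∑ i ∈ S, if i ∈ R then (d + 2 - 2 * m s) else 0 := by
      rw [sum_ite_mem, inter_eq_right.mpr hRS, sum_const, smul_eq_mul]
    rw [e1, e2, ← sum_add_distrib]
    refine (sum_le_sum fun i hi => ?_).trans (sum_le_univ_sum_of_nonneg fun i => Nat.zero_le _)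
    have := hmin i hi
    split_ifs with hiR
    · have := (mem_filter.mp hiR).2
      omega
    · omega
  have h2s : 2 * m s ≤ d + 1 := by
    have h3 : (2 * n + 2) * m s ≤ #S * m s := Nat.mul_le_mul_right _ (by omega)
    by_contra hc
    have h4 : (n + 1) * (d + 2) ≤ (n + 1) * (2 * m s) := Nat.mul_le_mul_left _ (by omega)
    have e1 : (n + 1) * (2 * m s) = (2 * n + 2) * m s := by ring
    have e2 : (n + 1) * (d + 2) = n * (d + 1) + n + d + 2 := by ring
    omega
  have hRn : #R ≤ n := by
    by_contra hc
    have h3 : (2 * n + 2) * m s ≤ #S * m s := Nat.mul_le_mul_right _ (by omega)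
    have h4 : (n + 1) * (d + 2 - 2 * m s) ≤ #R * (d + 2 - 2 * m s) :=
      Nat.mul_le_mul_right _ (by omega)
    have e1 : (2 * n + 2) * m s + (n + 1) * (d + 2 - 2 * m s) = n * (d + 1) + n + d + 2 := by
      obtain ⟨x, hx⟩ : ∃ x, d + 2 = 2 * m s + x := ⟨d + 2 - 2 * m s, by omega⟩
      rw [hx, Nat.add_sub_cancel_left, show n * (d + 1) + n + d + 2 = (n + 1) * (d + 2) by ring, hx]
      ring
    omega
  obtain ⟨I, hRI, hIS, hI⟩ := exists_subsuperset_card_eq (filter_subset _ _ : R ⊆ S.erase s) hRn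
    (by rw [card_erase_of_mem hsS]; omega)
  have hI2 : ∀ i ∈ I, 2 ≤ m i := fun i hi => by
    have h3 : m i ≠ 0 := by simpa [hS] using (mem_erase.mp (hIS hi)).2
    have := hm2 i
    omega
  have hadd : ∀ i ∉ I, i ≠ s → m i + m s ≤ d + 1 := fun i hi his => by
    by_contra hc
    refine hi (hRI (mem_filter.mpr ⟨mem_erase.mpr ⟨his, ?_⟩, by omega⟩))
    simp only [hS, mem_filter, mem_univ, true_and]
    omega
  refine ⟨s, I, fun hsI => (mem_erase.mp (hIS hsI)).1 rfl, hI, hs, fun i hi => ?_, hadd,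
    Admissible.sub_one hI hI2 hd (fun i hi hid => ?_) h1 h2⟩
  · have := hI2 i hi
    omega
  · by_cases his : i = s
    · subst his
      omega
    · have := hadd i hi his
      omega

lemma genDim_le_expDim_of_eq_one {n d : ℕ} {m : ι → ℕ} {s : ι} (hm : Admissible (n + 1) d m)
    (hs : m s = 1) (h : 0 < genDim k (n + 1) d (Function.update m s 0))
    (heq : (genDim k (n + 1) d (Function.update m s 0) : ℤ) =
      expDim (n + 1) d (Function.update m s 0)) :
    (genDim k (n + 1) d m : ℤ) ≤ expDim (n + 1) d m := by
  have hle := genDim_succ_le hs h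
  have h0 : (fun i => if i = s then 0 else m s + m i - (d + 1)) = (0 : ι → ℕ) := funext fun i => by
    have := hm.1 i
    simp only [Pi.zero_apply]
    split_ifs <;> omega
  rw [expDim_update (by omega) (hm.1 s), h0, hs, Nat.sub_self, ← heq, expDim_zero k, genDim_zero,
    finrank_homogeneousSubmodule, show n + 0 = n from rfl, Nat.choose_self]
  zify at hle
  push_cast
  linarith

lemma expDim_pos_of_pair {n d : ℕ} {m : ι → ℕ} {a b : ι} (hm : Admissible (n + 1) d m)
    (hab : b ≠ a) (h : d + 1 ≤ m a + m b) (hba : m b ≤ m a) (hd : ∀ i, m i < d)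
    (hsum : ∑ i, m i ≤ (n + 1) * d + n) (hc : ∑ i, m i + n + 3 ≤ n * d + d + suppCard m)
    (ihn : ∀ {d : ℕ} {m : ι → ℕ}, Admissible n d m → (genDim k n d m : ℤ) = expDim n d m) :
    0 < expDim (n + 1) d m := by
  have ha := hd a
  rw [expDim_eq_sum_of_le hab (hd a).le hba]
  have hadm : ∀ j < d + 1 - m a, Admissible n (d - j) (pairMult d j m a b) := fun j hj =>
    hm.pairMult hab h hba hd hj hsum
  change 0 < ∑ j ∈ range (d + 1 - m a), expDim n (d - j) (pairMult d j m a b)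
  rw [← sum_congr rfl fun j hj => ihn (hadm j (mem_range.mp hj))]
  have h1 : 1 ∈ range (d + 1 - m a) := mem_range.mpr (by omega)
  refine sum_pos' (fun j _ => Int.natCast_nonneg _) ⟨1, h1, Int.natCast_pos.mpr ?_⟩
  have key := sum_pairMult_add_le (j := 1) hab h (by omega) (by omega)
  refine genDim_pos (hadm 1 (mem_range.mp h1)).1 ?_
  obtain ⟨D, rfl⟩ : ∃ D, d = D + 1 := ⟨d - 1, by omega⟩
  rw [Nat.mul_succ] at hc
  rw [Nat.add_sub_cancel]
  omega

lemma genDim_le_expDim {n d : ℕ} {m : ι → ℕ} (hm : Admissible (n + 1) d m) (hm0 : ∃ i, m i ≠ 0)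
    (ihn : ∀ {d : ℕ} {m : ι → ℕ}, Admissible n d m → (genDim k n d m : ℤ) = expDim n d m)
    (ih : ∀ {d' : ℕ} {m' : ι → ℕ}, d' + ∑ i, m' i < d + ∑ i, m i → Admissible (n + 1) d' m' →
      (genDim k (n + 1) d' m' : ℤ) = expDim (n + 1) d' m') :
    (genDim k (n + 1) d m : ℤ) ≤ expDim (n + 1) d m := by
  by_cases hA : suppCard m ≤ n + 2
  · obtain ⟨s, hs⟩ := hm0
    refine genDim_le_expDim_of_sum hs (hm.1 s) expDim_eq_sum (fun j _ => ?_) ihn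
    simpa using Admissible.of_suppCard_le hm.1 hA hs
  have hu : ∀ s, Function.update m s 0 ≤ m := fun s =>
    update_le_iff.mpr ⟨Nat.zero_le _, fun _ _ => le_rfl⟩
  have hus : ∀ s, ∑ i, Function.update m s 0 i + m s = ∑ i, m i := fun s => by
    rw [← add_sum_erase univ _ (mem_univ s), ← add_sum_erase univ m (mem_univ s),
      Function.update_self, sum_congr rfl fun i hi =>
        Function.update_of_ne (ne_of_mem_erase hi) _ _]
    omega
  by_cases hT : ∃ s, m s = d
  · obtain ⟨s, hs⟩ := hT
    have hd : d ≠ 0 := by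
      rintro rfl
      obtain ⟨i, hi⟩ := hm0
      exact hi (Nat.le_zero.mp (hm.1 i))
    refine genDim_le_expDim_of_sum (by omega) (hm.1 s) expDim_eq_sum (fun j hj => ?_) ihn
    obtain rfl : j = 0 := by omega
    simpa using hm.erase_top hs hd
  have hd : ∀ i, m i < d := fun i => lt_of_le_of_ne (hm.1 i) fun h => hT ⟨i, h⟩
  have h0 : #{i | m i = d} = 0 := by
    rw [card_eq_zero, filter_eq_empty_iff]
    exact fun i _ => (hd i).ne
  have hm2 := hm.2
  rw [h0] at hm2
  obtain ⟨D, rfl⟩ : ∃ D, d = D + 1 := by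
    obtain ⟨i, _⟩ := hm0
    exact ⟨d - 1, by have := hd i; omega⟩
  have hdD : ∀ i, m i ≤ D := fun i => Nat.le_of_lt_succ (hd i)
  have htrace : (∃ s I, IsTracePair (n + 1) D m s I) →
      (genDim k (n + 1) (D + 1) m : ℤ) ≤ expDim (n + 1) (D + 1) m := by
    rintro ⟨s, I, h⟩
    exact genDim_le_expDim_of_isTracePair hm (hdD s) h ih
  by_cases hp : ∃ a b, b ≠ a ∧ m b ≤ m a ∧ D + 2 ≤ m a + m b
  · obtain ⟨a, b, hab, hba, h⟩ := hp
    by_cases hsum : ∑ i, m i ≤ (n + 1) * (D + 1) + n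
    · have hda := hd a
      exact genDim_le_expDim_of_sum (by omega) (hm.1 a) (expDim_eq_sum_of_le hab (hm.1 a) hba)
        (fun j hj => hm.pairMult hab h hba hd hj hsum) ihn
    by_cases hs : ∃ s, m s = 1
    · obtain ⟨s, hs⟩ := hs
      have heq := ih (by have := hus s; omega) (hm.anti (hu s))
      refine genDim_le_expDim_of_eq_one hm hs ?_ heq
      have hda := hdD a
      have hdb := hdD b
      have has : a ≠ s := by
        rintro rfl
        omega
      have hbs : b ≠ s := by
        rintro rfl
        omega
      have hsupp : suppCard m ≤ suppCard (Function.update m s 0) + 1 := by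
        simp only [suppCard, ← add_sum_erase univ _ (mem_univ s), Function.update_self]
        rw [sum_congr rfl fun i hi => (by rw [Function.update_of_ne (ne_of_mem_erase hi)] :
          min (Function.update m s 0 i) 1 = min (m i) 1)]
        omega
      have hus' := hus s
      have hpos := expDim_pos_of_pair (k := k) (hm.anti (hu s)) hab
        (by rwa [Function.update_of_ne has, Function.update_of_ne hbs])
        (by rwa [Function.update_of_ne has, Function.update_of_ne hbs])
        (fun i => (hu s i).trans_lt (hd i)) (by omega) (by rw [Nat.succ_mul] at hm2 hsum; omega) ihn
      rw [← heq] at hpos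
      exact_mod_cast hpos
    · exact htrace (exists_isTracePair_of_two_le (by omega) hdD (fun i hi => hs ⟨i, hi⟩)
        (by omega) (by omega))
  have hp' : ∀ i j, i ≠ j → m i + m j ≤ D + 1 := fun i j hij => by
    by_contra hc
    rcases le_total (m i) (m j) with h | h
    · exact hp ⟨j, i, hij, h, by omega⟩
    · exact hp ⟨i, j, hij.symm, h, by omega⟩
  by_cases hB : ∑ i, m i ≤ (n + 1) * (D + 1)
  · exact htrace (exists_isTracePair_of_sum_le (by omega) hdD hp' hB)
  by_cases hc : n + 1 ≤ #{i | 2 ≤ m i}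
  · exact htrace (exists_isTracePair_of_card_le n.succ_ne_zero (by omega) hdD hp' hc (by omega)
      (by omega))
  obtain ⟨s, hs⟩ : ∃ s, m s = 1 := by
    obtain ⟨s, hsI, hs⟩ := exists_notMem_of_card_lt (m := m) (I := {i | 2 ≤ m i}) (by omega)
    simp only [mem_filter, mem_univ, true_and] at hsI
    exact ⟨s, by omega⟩
  have hus' := hus s
  refine genDim_le_expDim_of_eq_one hm hs (genDim_pos_of_card_le n.succ_ne_zero ?_
    (fun i => (hu s i).trans_lt (hd i)) ((card_le_card fun i hi => ?_).trans (not_le.mp hc).le)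
    (by omega)) (ih (by omega) (hm.anti (hu s)))
  · have := hd s
    omega
  · simp only [mem_filter, mem_univ, true_and] at hi ⊢
    exact hi.trans (hu s i)

/-- Within the effectivity bounds, the generic dimension is the expected one. -/
theorem genDim_eq_expDim {n d : ℕ} {m : ι → ℕ} (hm : Admissible n d m) :
    (genDim k n d m : ℤ) = expDim n d m := by
  induction n generalizing d m with
  | zero =>
    by_cases h0 : m = 0
    · rw [h0, expDim_zero k]
    obtain ⟨s, hs⟩ : ∃ s, m s ≠ 0 := by
      by_contra! hc
      exact h0 (funext hc)
    have hsupp : suppCard m ≤ 1 := by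
      have h1 : m s ≤ ∑ i, m i := single_le_sum (fun i _ => Nat.zero_le _) (mem_univ s)
      have := hm.2
      rw [Nat.zero_mul] at this
      omega
    rw [genDim_zero_of_ne hs, expDim_zero_of_single hs (hm.1 s) fun i hi => ?_, Nat.cast_zero]
    rw [suppCard_eq_card, card_le_one] at hsupp
    by_contra hc
    exact hi (hsupp i (by simpa using hc) s (by simpa using hs))
  | succ n ihn =>
    induction hN : d + ∑ i, m i using Nat.strong_induction_on generalizing d m with
    | _ N ih =>
      subst hN
      by_cases h0 : m = 0
      · rw [h0, expDim_zero k]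
      obtain ⟨s, hs⟩ : ∃ s, m s ≠ 0 := by
        by_contra! hc
        exact h0 (funext hc)
      exact le_antisymm (genDim_le_expDim hm ⟨s, hs⟩ ihn fun h h' => ih _ h h' rfl)
        (expDim_le_genDim hs hm ihn fun h h' => ih _ h h' rfl)

end Main

lemma genDim_fin_cons {k : Type*} [Field k] (n d s : ℕ) (m : Fin s → ℕ) :
    genDim k n d (Fin.cons 0 m : Fin (s + 1) → ℕ) = genDim k n d m := by
  have h : ∀ p : Fin (s + 1) → Fin (n + 1) → k,
      formDim d (Fin.cons 0 m : Fin (s + 1) → ℕ) p = formDim d m (Fin.tail p) := fun p => by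
    have h1 : vanishingForms d (Fin.cons 0 m : Fin (s + 1) → ℕ) p =
        vanishingForms d m (Fin.tail p) := by
      ext F
      exact and_congr_right fun _ => by
        simp [Fin.forall_fin_succ, vanishesTo_zero_left, Fin.tail]
    rw [formDim, formDim, h1]
  rw [genDim, genDim]
  congr 1
  ext N
  constructor
  · rintro ⟨p, rfl⟩
    exact ⟨Fin.tail p, (h p).symm⟩
  · rintro ⟨p, rfl⟩
    exact ⟨Fin.cons 0 p, (h _).trans (by rw [Fin.tail_cons])⟩

lemma admissible_of_sum_le {n d s : ℕ} {m : ℕ → ℕ} (hm1 : ∀ i < s, 1 ≤ m i)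
    (hm2 : ∀ i < s, m i ≤ d)
    (hb : (∑ i ∈ Finset.range s, (m i : ℤ)) ≤ (n : ℤ) * d +
      min ((n : ℤ) - (((Finset.range s).filter (fun i => m i = d)).card : ℤ))
          ((s : ℤ) - n - 2)) :
    Admissible n d fun i : Fin s => m i := by
  have hsum : ∑ i ∈ Finset.range s, m i = ∑ i : Fin s, m i := sum_range m
  have ht : #{i ∈ Finset.range s | m i = d} = #{i : Fin s | m i = d} := by
    rw [card_filter, card_filter, sum_range]
  have hc : suppCard (fun i : Fin s => m i) = s := by
    rw [suppCard, sum_congr rfl fun (i : Fin s) _ => min_eq_right (hm1 i i.2)]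
    simp
  refine ⟨fun i => hm2 i i.2, Or.inr (Or.inr ?_)⟩
  rw [hc, ← hsum, ← ht]
  rw [← Nat.cast_sum, ← Nat.cast_mul] at hb
  omega

/-- the recursion
`gdim L_{n,d}(m_1,…,m_s) = gdim L_{n,d}(m_1−1,m_2,…,m_s) − gdim L_{n−1,m_1−1}(k'_{12},…,k'_{1s})`
under the effectivity bound. -/
theorem stmt9 (k : Type) [Field k] [IsAlgClosed k] [CharZero k]
    (n d s : ℕ) (hn : 2 ≤ n) (hd : 1 ≤ d) (hs : n + 3 ≤ s)
    (m : ℕ → ℕ) (hm1 : ∀ i < s, 1 ≤ m i) (hm2 : ∀ i < s, m i ≤ d)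
    (hb : (∑ i ∈ Finset.range s, (m i : ℤ)) ≤ (n : ℤ) * d +
      min ((n : ℤ) - (((Finset.range s).filter (fun i => m i = d)).card : ℤ))
          ((s : ℤ) - n - 2)) :
    (gdim k n d s m : ℤ) =
      (gdim k n d s (Function.update m 0 (m 0 - 1)) : ℤ) -
      (gdim k (n - 1) (m 0 - 1) (s - 1) (fun i => m 0 + m (i + 1) - (d + 1)) : ℤ) := by
  have hm := admissible_of_sum_le hm1 hm2 hb
  obtain ⟨s, rfl⟩ : ∃ t, s = t + 1 := ⟨s - 1, by omega⟩
  obtain ⟨n, rfl⟩ : ∃ t, n = t + 1 := ⟨n - 1, by omega⟩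
  have h0 : m ((0 : Fin (s + 1)) : ℕ) ≠ 0 := Nat.one_le_iff_ne_zero.mp (hm1 0 s.succ_pos)
  have h1 : (fun i : Fin (s + 1) => Function.update m 0 (m 0 - 1) i) =
      Function.update (fun i : Fin (s + 1) => m i) 0 (m 0 - 1) := by
    funext i
    refine i.cases rfl fun j => ?_
    rw [Function.update_of_ne (by simp), Function.update_of_ne (Fin.succ_ne_zero j)]
  have h2 : (Fin.cons 0 fun i : Fin s => m 0 + m (i + 1) - (d + 1) : Fin (s + 1) → ℕ) =
      fun i : Fin (s + 1) => if i = 0 then 0 else m 0 + m i - (d + 1) := by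
    funext i
    refine i.cases rfl fun j => ?_
    simp
  have hu : Function.update (fun i : Fin (s + 1) => m i) 0 (m 0 - 1) ≤ fun i : Fin (s + 1) => m i :=
    update_le_iff.mpr ⟨Nat.sub_le _ _, fun _ _ => le_rfl⟩
  have h3 := expDim_update (n := n) (m := fun i : Fin (s + 1) => m i) (s := 0) h0 (hm.1 0)
  rw [← genDim_eq_expDim (k := k) hm, ← genDim_eq_expDim (k := k) (hm.cone h0), Fin.val_zero,
    ← genDim_eq_expDim (k := k) (hm.anti hu)] at h3
  rw [gdim_eq_genDim, gdim_eq_genDim, gdim_eq_genDim, h1, Nat.add_sub_cancel, Nat.add_sub_cancel,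
    ← genDim_fin_cons n _ s, h2]
  exact h3
end
end

section
/- (Dimension of linear systems through a star configuration of points.) Let k be an algebraically closed field of characteristic zero, n ≥ 2, and let d, m_1,…,m_{n+2} be integers with 0 ≤ m_i ≤ d for all i and Σ_{i=1}^{n+2} m_i ≤ (n+1)d. Then the dimension over k of the star linear system Δ, i.e. of the space of homogeneous polynomials F ∈ k[y_1,…,y_{n+1}] of degree d with multiplicity at least k_{ij} = max(m_i + m_j − d, 0) at the star configuration point q_{ij} for all 1 ≤ i < j ≤ n+2, equals N(d) − N(d−1), where N(e) := #{α ∈ ℕ^{n+2} : α_1 + ⋯ + α_{n+2} = e and α_i ≤ e − m_i for all i}. (Equivalently, dim Δ = h^0(D) − h^0(D − H), where D = dH − Σ_{i=1}^{n+2} m_i E_i is the corresponding divisor on ℙ^{n+1} blown up at the n+2 coordinate points and H is a general hyperplane; this identity is established in the proof of the theorem on star configurations.) -/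
open MvPolynomial Finset

noncomputable section

/-- The vectors representing the `n+2` vertices: `e_l` for `l ≤ n+1` and the zero
vector for `l = n+2`, so that `q_{ij} = [starVec i − starVec j]` is the star
configuration point for all `i < j`. -/
def starVec (k : Type) [Field k] (n : ℕ) (l : Fin (n + 2)) : Fin (n + 1) → k :=
  fun j => if (l : ℕ) = (j : ℕ) then 1 else 0

/-- The star linear system `Δ` attached to `(d; m_1,…,m_{n+2})`: degree-`d` forms with
multiplicity at least `k_{ij} = max(m_i + m_j − d, 0)` at the star configuration point
`q_{ij}` for all `i < j`. -/
def starSys (k : Type) [Field k] (n d : ℕ) (m : Fin (n + 2) → ℕ) :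
    Submodule k (MvPolynomial (Fin (n + 1)) k) :=
  (homogeneousSubmodule (Fin (n + 1)) k d) ⊓
    ⨅ (i : Fin (n + 2)) (j : Fin (n + 2)) (_ : i < j),
      Submodule.restrictScalars k
        (pointIdeal k (n + 1) (starVec k n i - starVec k n j) ^ (m i + m j - d))

/-- The substitution `y ↦ y + t v`, with values in polynomials in `t`. -/
def shear {k σ : Type} [Field k] (v : σ → k) :
    MvPolynomial σ k →ₐ[k] Polynomial (MvPolynomial σ k) :=
  aeval fun l => Polynomial.C (X l) + Polynomial.C (C (v l)) * Polynomial.X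

lemma shear_X {k σ : Type} [Field k] (v : σ → k) (l : σ) :
    shear v (X l) = Polynomial.C (X l) + Polynomial.C (C (v l)) * Polynomial.X := by
  simp [shear]

lemma shear_C {k σ : Type} [Field k] (v : σ → k) (r : k) :
    shear v (C r) = Polynomial.C (C r) := by
  simp only [shear, algHom_C]
  rfl

lemma natDegree_shear_X {k σ : Type} [Field k] [DecidableEq k] (v : σ → k) (l : σ) :
    (shear v (X l)).natDegree = if v l = 0 then 0 else 1 := by
  rw [shear_X]
  split_ifs with h
  · simp [h]
  · rw [add_comm]
    exact Polynomial.natDegree_linear (by simpa using h)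

lemma shear_sum_X {k σ : Type} [Field k] (v : σ → k) (s : Finset σ) :
    shear v (∑ l ∈ s, X l) =
      Polynomial.C (∑ l ∈ s, X l) + Polynomial.C (C (∑ l ∈ s, v l)) * Polynomial.X := by
  simp [map_sum, shear_X, Finset.sum_add_distrib, Finset.sum_mul]

lemma shear_ne_zero {k σ : Type} [Field k] (v : σ → k) {F : MvPolynomial σ k} (hF : F ≠ 0) :
    shear v F ≠ 0 := by
  intro h
  apply hF
  have key : ((Polynomial.aeval (0 : MvPolynomial σ k)).restrictScalars k).comp (shear v) =
      AlgHom.id k (MvPolynomial σ k) := by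
    ext l
    simp [shear_X]
  have := congrArg (fun f => f F) key
  simpa [h] using this.symm

lemma natDegree_shear_X_mul {k σ : Type} [Field k] [DecidableEq k] (v : σ → k) (l : σ)
    {G : MvPolynomial σ k} (hG : G ≠ 0) :
    (shear v (X l * G)).natDegree = (if v l = 0 then 0 else 1) + (shear v G).natDegree := by
  rw [map_mul, Polynomial.natDegree_mul (shear_ne_zero v (X_ne_zero l)) (shear_ne_zero v hG),
    natDegree_shear_X]

/-- The polynomial `F` restricted to the coordinate subspace where the variables outside `s`
vanish. -/
def killOutside {k σ : Type} [Field k] [DecidableEq σ] (s : Finset σ) :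
    MvPolynomial σ k →ₐ[k] MvPolynomial σ k :=
  aeval fun l => if l ∈ s then X l else 0

lemma killOutside_X {k σ : Type} [Field k] [DecidableEq σ] (s : Finset σ) (l : σ) :
    killOutside s (X l : MvPolynomial σ k) = if l ∈ s then X l else 0 := by
  simp [killOutside]

lemma killOutside_killOutside {k σ : Type} [Field k] [DecidableEq σ] {s t : Finset σ}
    (hst : s ⊆ t) (F : MvPolynomial σ k) :
    killOutside s (killOutside t F) = killOutside s F := by
  have key : (killOutside s).comp (killOutside t) = killOutside (k := k) s := by
    ext1 l
    by_cases h : l ∈ t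
    · simp [killOutside_X, h]
    · have h' : l ∉ s := fun hs => h (hst hs)
      simp [killOutside_X, h, h']
  exact congrArg (fun f => f F) key

lemma killOutside_univ {k σ : Type} [Field k] [DecidableEq σ] [Fintype σ]
    (F : MvPolynomial σ k) : killOutside univ F = F := by
  have key : killOutside (univ : Finset σ) = AlgHom.id k (MvPolynomial σ k) := by
    ext1 l
    simp [killOutside_X]
  exact congrArg (fun f => f F) key

lemma killOutside_empty {k σ : Type} [Field k] [DecidableEq σ] (F : MvPolynomial σ k) :
    killOutside ∅ F = C (constantCoeff F) := by
  have key : killOutside (∅ : Finset σ) =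
      (Algebra.ofId k (MvPolynomial σ k)).comp (aeval (0 : σ → k)) := by
    ext1 l
    simp [killOutside_X]
  have := congrArg (fun f => f F) key
  simp only [AlgHom.comp_apply, Algebra.ofId_apply, aeval_zero] at this
  simpa using this

lemma X_dvd_of_killOutside_erase_eq_zero {k σ : Type} [Field k] [DecidableEq σ] {s : Finset σ}
    {i : σ} {F : MvPolynomial σ k} (hF : killOutside s F = F)
    (h : killOutside (s.erase i) F = 0) : X i ∣ F := by
  rw [← Ideal.mem_span_singleton, ← Ideal.Quotient.eq_zero_iff_mem]
  let q := Ideal.Quotient.mkₐ k (Ideal.span {(X i : MvPolynomial σ k)})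
  have hqi : q (X i) = 0 :=
    Ideal.Quotient.eq_zero_iff_mem.2 (Ideal.mem_span_singleton_self _)
  have key : q.comp (killOutside s) = q.comp (killOutside (s.erase i)) := by
    ext1 l
    by_cases hl : l = i
    · subst hl
      simp [killOutside_X, apply_ite q, hqi]
    · simp [killOutside_X, hl]
  have := congrArg (fun f => f F) key
  simp only [AlgHom.comp_apply, hF, h, map_zero] at this
  exact this

lemma natDegree_shear_killOutside_le {k σ : Type} [Field k] [DecidableEq σ] {s : Finset σ}
    {v : σ → k} (hv : ∀ l ∉ s, v l = 0) (F : MvPolynomial σ k) :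
    (shear v (killOutside s F)).natDegree ≤ (shear v F).natDegree := by
  have key : (shear v).comp (killOutside s) =
      (Polynomial.mapAlgHom (killOutside s)).comp (shear v) := by
    ext1 l
    by_cases hl : l ∈ s
    · simp [killOutside_X, shear_X, hl, Polynomial.map_add, Polynomial.map_mul]
    · simp [killOutside_X, shear_X, hl, hv l hl]
  have := congrArg (fun f => f F) key
  simp only [AlgHom.comp_apply] at this
  rw [this]
  exact Polynomial.natDegree_map_le

/-- The products of powers of the coordinates in `s` and of their sum. -/
def starGen (k : Type) {σ : Type} [Field k] (s : Finset σ) (α : σ → ℕ) (γ : ℕ) :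
    MvPolynomial σ k :=
  (∏ l ∈ s, X l ^ α l) * (∑ l ∈ s, X l) ^ γ

/-- The span of the products of powers of the coordinates in `s` and of their sum, with
exponents bounded by `b` and `c`. -/
def starSpan (k : Type) {σ : Type} [Field k] (s : Finset σ) (b : σ → ℕ) (c : ℕ) :
    Submodule k (MvPolynomial σ k) :=
  Submodule.span k {P | ∃ α : σ → ℕ, ∃ γ : ℕ, (∀ l, α l ≤ b l) ∧ γ ≤ c ∧ P = starGen k s α γ}

/-- The bound on the degree in direction `v` of the elements of `starSpan k s b c`. -/
def shearBound {k σ : Type} [Field k] [DecidableEq k] (s : Finset σ) (b : σ → ℕ) (c : ℕ)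
    (v : σ → k) : ℕ :=
  (∑ l ∈ s, if v l = 0 then 0 else b l) + if ∑ l ∈ s, v l = 0 then 0 else c

/-- The vectors `e_i` and `e_i - e_j` with `i < j` in `s`. -/
def IsStarDir {k σ : Type} [Field k] [LinearOrder σ] (s : Finset σ) (v : σ → k) : Prop :=
  (∃ i ∈ s, v = Pi.single i 1) ∨ ∃ i ∈ s, ∃ j ∈ s, i < j ∧ v = Pi.single i 1 - Pi.single j 1

lemma IsStarDir.eq_zero {k σ : Type} [Field k] [LinearOrder σ] {s : Finset σ} {v : σ → k}
    (hv : IsStarDir s v) {l : σ} (hl : l ∉ s) : v l = 0 := by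
  rcases hv with ⟨i, hi, rfl⟩ | ⟨i, hi, j, hj, -, rfl⟩
  · have : l ≠ i := by rintro rfl; exact hl hi
    simp [this]
  · have h1 : l ≠ i := by rintro rfl; exact hl hi
    have h2 : l ≠ j := by rintro rfl; exact hl hj
    simp [h1, h2]

lemma IsStarDir.mono {k σ : Type} [Field k] [LinearOrder σ] {s t : Finset σ} {v : σ → k}
    (hv : IsStarDir s v) (hst : s ⊆ t) : IsStarDir t v := by
  rcases hv with ⟨i, hi, rfl⟩ | ⟨i, hi, j, hj, hij, rfl⟩
  · exact Or.inl ⟨i, hst hi, rfl⟩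
  · exact Or.inr ⟨i, hst hi, j, hst hj, hij, rfl⟩

lemma shearBound_erase {k σ : Type} [Field k] [DecidableEq k] [DecidableEq σ] (s : Finset σ)
    (b : σ → ℕ) (c : ℕ) {v : σ → k} {i : σ} (hv : v i = 0) :
    shearBound (s.erase i) b c v = shearBound s b c v := by
  have h1 : ∑ l ∈ s.erase i, (if v l = 0 then 0 else b l) =
      ∑ l ∈ s, if v l = 0 then 0 else b l := Finset.sum_erase _ (by simp [hv])
  have h2 : ∑ l ∈ s.erase i, v l = ∑ l ∈ s, v l := Finset.sum_erase _ hv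
  rw [shearBound, shearBound, h1, h2]

lemma shearBound_add_single {k σ : Type} [Field k] [DecidableEq k] [DecidableEq σ]
    {s : Finset σ} (b : σ → ℕ) (c : ℕ) (v : σ → k) {i : σ} (hi : i ∈ s) :
    shearBound s (b + Pi.single i 1) c v = (if v i = 0 then 0 else 1) + shearBound s b c v := by
  have h1 : ∑ l ∈ s, (if v l = 0 then 0 else (b + Pi.single i 1 : σ → ℕ) l) =
      (if v i = 0 then 0 else 1) + ∑ l ∈ s, if v l = 0 then 0 else b l := by
    rw [← Finset.add_sum_erase s _ hi,
      ← Finset.add_sum_erase s (fun l => if v l = 0 then 0 else b l) hi]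
    have : ∑ l ∈ s.erase i, (if v l = 0 then 0 else (b + Pi.single i 1 : σ → ℕ) l) =
        ∑ l ∈ s.erase i, if v l = 0 then 0 else b l := by
      refine Finset.sum_congr rfl fun l hl => ?_
      simp [Finset.ne_of_mem_erase hl]
    rw [this]
    split_ifs <;> simp; ring
  rw [shearBound, shearBound, h1, add_assoc]

lemma natDegree_shear_le_of_mem_starSpan {k σ : Type} [Field k] [DecidableEq k]
    {s : Finset σ} {b : σ → ℕ} {c : ℕ} {F : MvPolynomial σ k} (hF : F ∈ starSpan k s b c)
    (v : σ → k) : (shear v F).natDegree ≤ shearBound s b c v := by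
  induction hF using Submodule.span_induction with
  | zero => simp
  | add x y _ _ hx hy =>
    rw [map_add]
    exact (Polynomial.natDegree_add_le _ _).trans (max_le hx hy)
  | smul a x _ hx =>
    rw [map_smul]
    exact (Polynomial.natDegree_smul_le _ _).trans hx
  | mem P hP =>
    obtain ⟨α, γ, hα, hγ, rfl⟩ := hP
    rw [starGen, map_mul, map_prod, map_pow, shear_sum_X]
    refine Polynomial.natDegree_mul_le.trans (add_le_add ?_ ?_)
    · refine (Polynomial.natDegree_prod_le _ _).trans (Finset.sum_le_sum fun l _ => ?_)
      rw [map_pow]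
      refine Polynomial.natDegree_pow_le.trans ?_
      rw [natDegree_shear_X]
      split_ifs
      · simp
      · simpa using hα l
    · refine Polynomial.natDegree_pow_le.trans ?_
      split_ifs with h
      · rw [h]
        simp only [map_zero, zero_mul, add_zero, Polynomial.natDegree_C, mul_zero, le_refl]
      · refine (Nat.mul_le_mul hγ (m₂ := 1) ?_).trans (by simp)
        rw [add_comm]
        exact Polynomial.natDegree_linear_le

lemma killOutside_eq_self_of_mem_starSpan {k σ : Type} [Field k] [DecidableEq σ]
    {s : Finset σ} {b : σ → ℕ} {c : ℕ} {F : MvPolynomial σ k} (hF : F ∈ starSpan k s b c) :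
    killOutside s F = F := by
  induction hF using Submodule.span_induction with
  | zero => simp
  | add x y _ _ hx hy => rw [map_add, hx, hy]
  | smul a x _ hx => rw [map_smul, hx]
  | mem P hP =>
    obtain ⟨α, γ, -, -, rfl⟩ := hP
    rw [starGen, map_mul, map_prod, map_pow, map_sum]
    congr 1
    · refine Finset.prod_congr rfl fun l hl => ?_
      simp [killOutside_X, hl]
    · congr 1
      refine Finset.sum_congr rfl fun l hl => ?_
      simp [killOutside_X, hl]

lemma exists_mem_starSpan_killOutside_erase {k σ : Type} [Field k] [DecidableEq σ]
    {s : Finset σ} {i : σ} (hi : i ∈ s) {b : σ → ℕ} {c : ℕ} {F : MvPolynomial σ k}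
    (hF : F ∈ starSpan k (s.erase i) b c) :
    ∃ H ∈ starSpan k s b c, killOutside (s.erase i) H = F := by
  have : starSpan k (s.erase i) b c ≤
      (starSpan k s b c).map (killOutside (s.erase i)).toLinearMap := by
    rw [starSpan, Submodule.span_le]
    rintro _ ⟨α, γ, hα, hγ, rfl⟩
    refine ⟨starGen k s (Function.update α i 0) γ, Submodule.subset_span
      ⟨_, γ, fun l => ?_, hγ, rfl⟩, ?_⟩
    · by_cases hl : l = i
      · subst hl; simp
      · simpa [hl] using hα l
    · simp only [AlgHom.toLinearMap_apply, starGen, map_mul, map_prod, map_pow, map_sum]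
      rw [← Finset.mul_prod_erase s _ hi, ← Finset.add_sum_erase s _ hi]
      simp only [killOutside_X]
      simp only [Finset.mem_erase, ne_eq, not_true_eq_false, false_and, if_false, zero_add,
        Function.update_self, pow_zero, one_mul]
      congr 1
      · refine Finset.prod_congr rfl fun l hl => ?_
        rw [Finset.mem_erase] at hl
        simp [hl.1, hl.2]
      · congr 1
        refine Finset.sum_congr rfl fun l hl => ?_
        rw [Finset.mem_erase] at hl
        simp [hl.1, hl.2]
  obtain ⟨H, hH, rfl⟩ := this hF
  exact ⟨H, hH, rfl⟩

lemma X_mul_mem_starSpan {k σ : Type} [Field k] [DecidableEq σ] {s : Finset σ} {i : σ}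
    (hi : i ∈ s) {b : σ → ℕ} {c : ℕ} {F : MvPolynomial σ k} (hF : F ∈ starSpan k s b c) :
    X i * F ∈ starSpan k s (b + Pi.single i 1) c := by
  induction hF using Submodule.span_induction with
  | zero => simp
  | add x y _ _ hx hy => rw [mul_add]; exact Submodule.add_mem _ hx hy
  | smul a x _ hx => rw [mul_smul_comm]; exact Submodule.smul_mem _ _ hx
  | mem P hP =>
    obtain ⟨α, γ, hα, hγ, rfl⟩ := hP
    refine Submodule.subset_span ⟨α + Pi.single i 1, γ, fun l => ?_, hγ, ?_⟩
    · simpa using hα l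
    · rw [starGen, starGen, ← mul_assoc]
      congr 1
      simp only [Pi.add_apply, pow_add, Finset.prod_mul_distrib]
      rw [mul_comm]
      congr 1
      rw [Finset.prod_eq_single i]
      · simp
      · intro l _ hl
        simp [hl]
      · exact fun h => absurd hi h

lemma X_mul_mem_starSpan_singleton {k σ : Type} [Field k] {i : σ} {b : σ → ℕ} {c : ℕ}
    {F : MvPolynomial σ k} (hF : F ∈ starSpan k {i} b c) :
    X i * F ∈ starSpan k {i} b (c + 1) := by
  induction hF using Submodule.span_induction with
  | zero => simp
  | add x y _ _ hx hy => rw [mul_add]; exact Submodule.add_mem _ hx hy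
  | smul a x _ hx => rw [mul_smul_comm]; exact Submodule.smul_mem _ _ hx
  | mem P hP =>
    obtain ⟨α, γ, hα, hγ, rfl⟩ := hP
    refine Submodule.subset_span ⟨α, γ + 1, hα, by omega, ?_⟩
    simp only [starGen, Finset.prod_singleton, Finset.sum_singleton]
    ring

/-- A polynomial whose degrees in the directions `e_i` and `e_i - e_j` are small enough is a
combination of products of powers of the coordinates and of their sum. -/
theorem killOutside_mem_starSpan {k σ : Type} [Field k] [DecidableEq k] [LinearOrder σ]
    (s : Finset σ) (b : σ → ℕ) (c : ℕ) (F : MvPolynomial σ k)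
    (hF : ∀ v, IsStarDir s v → (shear v (killOutside s F)).natDegree ≤ shearBound s b c v) :
    killOutside s F ∈ starSpan k s b c := by
  induction s using Finset.strongInduction generalizing b c F with
  | H s ihs =>
  induction hN : ∑ l ∈ s, b l + c using Nat.strong_induction_on generalizing b c F with
  | h N ihN =>
  subst hN
  rcases s.eq_empty_or_nonempty with rfl | hs
  · rw [killOutside_empty, C_eq_smul_one]
    exact Submodule.smul_mem _ _ (Submodule.subset_span ⟨0, 0, by simp, by simp, by simp [starGen]⟩)
  have peel : ∀ i ∈ s, ∃ H ∈ starSpan k s b c, ∃ G,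
      killOutside s F = H + X i * killOutside s G ∧
      ∀ v, IsStarDir s v → (shear v (X i * killOutside s G)).natDegree ≤ shearBound s b c v := by
    intro i hi
    have h1 : killOutside (s.erase i) F ∈ starSpan k (s.erase i) b c := by
      refine ihs _ (Finset.erase_ssubset hi) b c F fun v hv => ?_
      rw [shearBound_erase s b c (hv.eq_zero (Finset.notMem_erase i s)),
        ← killOutside_killOutside (Finset.erase_subset i s) F]
      exact (natDegree_shear_killOutside_le (fun l hl => hv.eq_zero hl) _).trans
        (hF v (hv.mono (Finset.erase_subset i s)))
    obtain ⟨H, hH, hHF⟩ := exists_mem_starSpan_killOutside_erase hi h1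
    have hHs := killOutside_eq_self_of_mem_starSpan hH
    have hsub : killOutside s (killOutside s F - H) = killOutside s F - H := by
      rw [map_sub, hHs, killOutside_killOutside subset_rfl]
    obtain ⟨G, hG⟩ : X i ∣ killOutside s F - H := by
      refine X_dvd_of_killOutside_erase_eq_zero hsub ?_
      rw [map_sub, hHF, killOutside_killOutside (Finset.erase_subset i s), sub_self]
    have hG' : killOutside s F - H = X i * killOutside s G := by
      rw [← hsub, hG, map_mul, killOutside_X, if_pos hi]
    refine ⟨H, hH, G, by rw [← hG']; ring, fun v hv => ?_⟩
    rw [← hG', map_sub]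
    exact (Polynomial.natDegree_sub_le _ _).trans
      (max_le (hF v hv) (natDegree_shear_le_of_mem_starSpan hH v))
  by_cases hb : ∃ i ∈ s, b i ≠ 0
  · obtain ⟨i, hi, hbi⟩ := hb
    obtain ⟨H, hH, G, hFG, hG⟩ := peel i hi
    obtain ⟨b', rfl⟩ : ∃ b', b = b' + Pi.single i 1 :=
      ⟨b - Pi.single i 1, by
        ext l
        by_cases hl : l = i
        · subst hl; simp; omega
        · simp [hl]⟩
    rw [hFG]
    refine Submodule.add_mem _ hH (X_mul_mem_starSpan hi (ihN _ ?_ b' c G (fun v hv => ?_) rfl))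
    · refine Nat.add_lt_add_right (Finset.sum_lt_sum (fun l _ => by simp) ⟨i, hi, by simp⟩) c
    · by_cases h0 : killOutside s G = 0
      · simp [h0]
      · have := hG v hv
        rw [natDegree_shear_X_mul v i h0, shearBound_add_single b' c v hi] at this
        omega
  push Not at hb
  have hb0 : ∀ v : σ → k, shearBound s b c v = if ∑ l ∈ s, v l = 0 then 0 else c := by
    intro v
    rw [shearBound, Finset.sum_eq_zero, zero_add]
    intro l hl
    simp [hb l hl]
  by_cases hcard : ∃ i ∈ s, ∃ j ∈ s, i < j
  · obtain ⟨i, hi, j, hj, hij⟩ := hcard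
    obtain ⟨H, hH, G, hFG, hG⟩ := peel i hi
    have h0 : killOutside s G = 0 := by
      by_contra h0
      have := hG (Pi.single i 1 - Pi.single j 1) (Or.inr ⟨i, hi, j, hj, hij, rfl⟩)
      rw [natDegree_shear_X_mul _ i h0, hb0] at this
      simp [hij.ne, Finset.sum_sub_distrib, Finset.sum_pi_single', hi, hj] at this
    rw [hFG, h0]
    simpa using hH
  · obtain ⟨i, hi⟩ := hs
    obtain rfl : s = {i} := by
      refine Finset.eq_singleton_iff_unique_mem.2 ⟨hi, fun j hj => ?_⟩
      by_contra hne
      rcases lt_or_gt_of_ne hne with h | h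
      · exact hcard ⟨j, hj, i, hi, h⟩
      · exact hcard ⟨i, hi, j, hj, h⟩
    obtain ⟨H, hH, G, hFG, hG⟩ := peel i hi
    rw [hFG]
    by_cases h0 : killOutside {i} G = 0
    · simpa [h0] using hH
    have key : ∀ v : σ → k, v i ≠ 0 → IsStarDir {i} v →
        1 + (shear v (killOutside {i} G)).natDegree ≤ c := by
      intro v hvi hv
      have := hG v hv
      rw [natDegree_shear_X_mul _ i h0, hb0] at this
      simpa [hvi] using this
    obtain ⟨c, rfl⟩ : ∃ c', c = c' + 1 := by
      have := key (Pi.single i 1) (by simp) (Or.inl ⟨i, hi, rfl⟩)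
      exact ⟨c - 1, by omega⟩
    refine Submodule.add_mem _ hH (X_mul_mem_starSpan_singleton
      (ihN _ (by omega) b c G (fun v hv => ?_) rfl))
    have hvi : v i ≠ 0 := by
      rcases hv with ⟨j, hj, rfl⟩ | ⟨j, hj, l, hl, hjl, rfl⟩
      · rw [Finset.mem_singleton.1 hj]; simp
      · rw [Finset.mem_singleton.1 hj, Finset.mem_singleton.1 hl] at hjl
        exact absurd hjl (lt_irrefl _)
    have := key v hvi hv
    rw [shearBound]
    simp [hvi]
    omega

lemma natDegree_shear_le_of_isHomogeneous {k : Type} [Field k] {N e : ℕ} (v : Fin N → k)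
    {P : MvPolynomial (Fin N) k} (hP : P.IsHomogeneous e) : (shear v P).natDegree ≤ e := by
  classical
  rw [shear, aeval_def, eval₂_eq']
  refine Polynomial.natDegree_sum_le_of_forall_le _ _ fun β hβ => ?_
  refine Polynomial.natDegree_mul_le.trans ?_
  have h0 : (algebraMap k (Polynomial (MvPolynomial (Fin N) k)) (coeff β P)).natDegree = 0 :=
    Polynomial.natDegree_C _
  rw [h0, zero_add]
  refine (Polynomial.natDegree_prod_le _ _).trans ?_
  have hdeg : ∑ i, β i = e := by
    have := hP (mem_support_iff.1 hβ)
    rw [← this, Finsupp.weight_apply, Finsupp.sum_fintype]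
    · simp
    · simp
  rw [← hdeg]
  refine Finset.sum_le_sum fun i _ => Polynomial.natDegree_pow_le.trans ?_
  refine (Nat.mul_le_mul le_rfl (m₂ := 1) ?_).trans (by simp)
  rw [add_comm]
  exact Polynomial.natDegree_linear_le

lemma shear_eq_of_isHomogeneous_one {k σ : Type} [Field k] (v : σ → k)
    {P : MvPolynomial σ k} (hP : P ∈ homogeneousSubmodule σ k 1) :
    shear v P = Polynomial.C P + Polynomial.C (C (eval v P)) * Polynomial.X := by
  rw [homogeneousSubmodule_one_eq_span_X] at hP
  induction hP using Submodule.span_induction with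
  | zero => simp
  | mem x hx =>
    obtain ⟨i, rfl⟩ := hx
    simp [shear_X]
  | add x y _ _ hx hy =>
    rw [map_add, hx, hy]
    simp only [map_add]
    ring
  | smul a x _ hx =>
    rw [smul_eq_C_mul, map_mul, hx, shear_C]
    simp only [map_mul, eval_C]
    ring

lemma homogeneousComponent_mul_of_mem {k σ : Type} [Field k] {j : ℕ} (i : ℕ)
    (a : MvPolynomial σ k) {b : MvPolynomial σ k} (hb : b ∈ homogeneousSubmodule σ k j) :
    homogeneousComponent (i + j) (a * b) = homogeneousComponent i a * b := by
  let _ : GradedAlgebra (homogeneousSubmodule σ k) := gradedAlgebra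
  have := DirectSum.coe_decompose_mul_add_of_right_mem (homogeneousSubmodule σ k)
    (i := i) (a := a) hb
  rw [← decomposition.decompose'_apply, ← decomposition.decompose'_apply]
  exact this

/-- A form with multiplicity at least `m` at `v` has degree in direction `v` at most its degree
minus `m`. -/
lemma natDegree_shear_homogeneousComponent_le {k : Type} [Field k] {N : ℕ} (v : Fin N → k)
    (m : ℕ) {F : MvPolynomial (Fin N) k} (hF : F ∈ pointIdeal k N v ^ m) (e : ℕ) :
    (shear v (homogeneousComponent (e + m) F)).natDegree ≤ e := by
  induction m generalizing F e with
  | zero => exact natDegree_shear_le_of_isHomogeneous v (homogeneousComponent_isHomogeneous _ _)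
  | succ m ih =>
    rw [pow_succ] at hF
    induction hF using Submodule.mul_induction_on' with
    | add x _ y _ hx hy =>
      rw [map_add, map_add]
      exact (Polynomial.natDegree_add_le _ _).trans (max_le hx hy)
    | mem_mul_mem a ha b hb =>
      induction hb using Submodule.span_induction generalizing a with
      | zero => simp
      | add x y _ _ hx hy =>
        rw [mul_add, map_add, map_add]
        exact (Polynomial.natDegree_add_le _ _).trans (max_le (hx a ha) (hy a ha))
      | smul r x _ hx =>
        have := hx (a * r) (Ideal.mul_mem_right _ _ ha)
        rwa [mul_assoc, ← smul_eq_mul r] at this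
      | mem l hl =>
        rw [← add_assoc, homogeneousComponent_mul_of_mem _ _ hl.1, map_mul,
          shear_eq_of_isHomogeneous_one v hl.1, hl.2]
        refine Polynomial.natDegree_mul_le.trans ?_
        simpa using ih ha e

/-- The equations of the `n + 2` hyperplanes. -/
def starForm (k : Type) [Field k] (n : ℕ) (l : Fin (n + 2)) : MvPolynomial (Fin (n + 1)) k :=
  Fin.lastCases (motive := fun _ => MvPolynomial (Fin (n + 1)) k) (∑ i, X i) (fun i => X i) l

/-- The parametrization of the star configuration by the `n + 2` linear forms. -/
def starMap (k : Type) [Field k] (n : ℕ) :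
    MvPolynomial (Fin (n + 2)) k →ₐ[k] MvPolynomial (Fin (n + 1)) k :=
  aeval (starForm k n)

lemma starForm_castSucc (k : Type) [Field k] (n : ℕ) (i : Fin (n + 1)) :
    starForm k n i.castSucc = X i := by
  simp [starForm]

lemma starForm_last (k : Type) [Field k] (n : ℕ) :
    starForm k n (Fin.last (n + 1)) = ∑ i, X i := by
  simp [starForm]

lemma starForm_mem (k : Type) [Field k] (n : ℕ) (l : Fin (n + 2)) :
    starForm k n l ∈ homogeneousSubmodule (Fin (n + 1)) k 1 := by
  induction l using Fin.lastCases with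
  | last =>
    rw [starForm_last]
    exact Submodule.sum_mem _ fun i _ => isHomogeneous_X k i
  | cast i =>
    rw [starForm_castSucc]
    exact isHomogeneous_X k i

lemma starVec_castSucc (k : Type) [Field k] (n : ℕ) (i : Fin (n + 1)) :
    starVec k n i.castSucc = Pi.single i 1 := by
  ext j
  simp [starVec, Pi.single_apply, Fin.ext_iff, eq_comm]

lemma starVec_last (k : Type) [Field k] (n : ℕ) : starVec k n (Fin.last (n + 1)) = 0 := by
  ext j
  simp [starVec, j.isLt.ne']

lemma eval_starForm (k : Type) [Field k] (n : ℕ) {i j l : Fin (n + 2)} (hi : l ≠ i)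
    (hj : l ≠ j) : eval (starVec k n i - starVec k n j) (starForm k n l) = 0 := by
  induction l using Fin.lastCases with
  | last =>
    obtain ⟨i, rfl⟩ := Fin.exists_castSucc_eq.2 hi.symm
    obtain ⟨j, rfl⟩ := Fin.exists_castSucc_eq.2 hj.symm
    simp [starForm_last, starVec_castSucc]
  | cast l =>
    have hi' : (i : ℕ) ≠ l := fun h => hi (Fin.ext (by simpa using h.symm))
    have hj' : (j : ℕ) ≠ l := fun h => hj (Fin.ext (by simpa using h.symm))
    simp [starForm_castSucc, starVec, hi', hj']

/-- The exponents of the monomials of degree `d` with multiplicity at least `m i` at the `i`-th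
coordinate point. -/
def expSet {n : ℕ} (d : ℕ) (m : Fin (n + 2) → ℕ) : Set (Fin (n + 2) →₀ ℕ) :=
  {α | ∑ i, α i = d ∧ ∀ i, α i + m i ≤ d}

/-- The exponents of the monomials of degree `d - 1` with multiplicity at least `m i` at the
`i`-th coordinate point. -/
def expSetPred {n : ℕ} (d : ℕ) (m : Fin (n + 2) → ℕ) : Set (Fin (n + 2) →₀ ℕ) :=
  {α | ∑ i, α i + 1 = d ∧ ∀ i, α i + 1 + m i ≤ d}

lemma starMap_monomial (k : Type) [Field k] (n : ℕ) (α : Fin (n + 2) →₀ ℕ) :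
    starMap k n (monomial α 1) = ∏ l, starForm k n l ^ α l := by
  rw [starMap, aeval_monomial, map_one, one_mul, Finsupp.prod_fintype]
  simp

lemma map_starMap_le_starSys (k : Type) [Field k] (n d : ℕ) (m : Fin (n + 2) → ℕ) :
    (restrictSupport k (expSet d m)).map (starMap k n).toLinearMap ≤ starSys k n d m := by
  rw [restrictSupport_eq_span, Submodule.map_span, Submodule.span_le]
  rintro _ ⟨_, ⟨α, ⟨hα, hαm⟩, rfl⟩, rfl⟩
  simp only [AlgHom.toLinearMap_apply, starMap_monomial]
  refine ⟨?_, ?_⟩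
  · rw [SetLike.mem_coe, mem_homogeneousSubmodule, ← hα]
    refine IsHomogeneous.prod _ _ _ fun l _ => ?_
    simpa using (starForm_mem k n l).pow (α l)
  · simp only [SetLike.mem_coe, Submodule.mem_iInf, Submodule.restrictScalars_mem]
    intro i j hij
    rw [← Finset.prod_sdiff (Finset.subset_univ {i, j})]
    refine Ideal.mul_mem_right _ _ ?_
    have hsum : ∑ l ∈ univ \ {i, j}, α l + (α i + α j) = d := by
      rw [← hα, ← Finset.sum_sdiff (Finset.subset_univ {i, j}), Finset.sum_pair hij.ne]
    have hle : m i + m j - d ≤ ∑ l ∈ univ \ {i, j}, α l := by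
      have := hαm i
      have := hαm j
      omega
    refine Ideal.pow_le_pow_right hle ?_
    rw [← Finset.prod_pow_eq_pow_sum]
    refine Ideal.prod_mem_prod fun l hl => Ideal.pow_mem_pow (Ideal.subset_span ?_) _
    simp only [Finset.mem_sdiff, Finset.mem_univ, true_and, Finset.mem_insert,
      Finset.mem_singleton, not_or] at hl
    exact ⟨starForm_mem k n l, eval_starForm k n hl.1 hl.2⟩

lemma homogeneousComponent_mem_map_starMap (k : Type) [Field k] (n d : ℕ)
    (m : Fin (n + 2) → ℕ) (hm : ∀ i, m i ≤ d) {F : MvPolynomial (Fin (n + 1)) k}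
    (hF : F ∈ starSpan k univ (fun l => d - m l.castSucc) (d - m (Fin.last (n + 1)))) :
    homogeneousComponent d F ∈
      (restrictSupport k (expSet d m)).map (starMap k n).toLinearMap := by
  induction hF using Submodule.span_induction with
  | zero => simp
  | add x y _ _ hx hy => rw [map_add]; exact Submodule.add_mem _ hx hy
  | smul a x _ hx => rw [map_smul]; exact Submodule.smul_mem _ _ hx
  | mem P hP =>
    obtain ⟨α, γ, hα, hγ, rfl⟩ := hP
    let β : Fin (n + 2) →₀ ℕ := Finsupp.equivFunOnFinite.symm (Fin.snoc (α := fun _ => ℕ) α γ)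
    have hβc : ∀ l : Fin (n + 1), β l.castSucc = α l := fun l => by simp [β]
    have hβl : β (Fin.last (n + 1)) = γ := by simp [β]
    have hgen : starGen k univ α γ = starMap k n (monomial β 1) := by
      rw [starMap_monomial, Fin.prod_univ_castSucc, starGen, starForm_last, hβl]
      congr 1
      refine Finset.prod_congr rfl fun l _ => ?_
      rw [starForm_castSucc, hβc]
    have hhom : starGen k univ α γ ∈ homogeneousSubmodule (Fin (n + 1)) k (∑ l, β l) := by
      rw [hgen, starMap_monomial]
      refine IsHomogeneous.prod _ _ _ fun l _ => ?_
      simpa using (starForm_mem k n l).pow (β l)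
    rw [homogeneousComponent_of_mem hhom]
    split_ifs with hd
    · rw [hgen]
      refine Submodule.mem_map_of_mem ?_
      rw [monomial_mem_restrictSupport]
      refine Or.inl ⟨hd.symm, fun i => ?_⟩
      induction i using Fin.lastCases with
      | last =>
        have := hm (Fin.last (n + 1))
        omega
      | cast l =>
        have := hm l.castSucc
        have : α l ≤ d - m l.castSucc := hα l
        have := hβc l
        omega
    · exact Submodule.zero_mem _

lemma starSys_eq_map (k : Type) [Field k] (n d : ℕ) (m : Fin (n + 2) → ℕ)
    (hm : ∀ i, m i ≤ d) :
    starSys k n d m = (restrictSupport k (expSet d m)).map (starMap k n).toLinearMap := by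
  classical
  refine le_antisymm ?_ (map_starMap_le_starSys k n d m)
  rintro F ⟨hFd, hFm⟩
  simp only [SetLike.mem_coe, Submodule.mem_iInf, Submodule.restrictScalars_mem] at hFd hFm
  have hdeg : ∀ i j, i < j → (shear (starVec k n i - starVec k n j) F).natDegree ≤
      (d - m i) + (d - m j) := by
    intro i j hij
    have := natDegree_shear_homogeneousComponent_le _ _ (hFm i j hij) (d - (m i + m j - d))
    have hi := hm i
    have hj := hm j
    rw [show d - (m i + m j - d) + (m i + m j - d) = d by omega,
      homogeneousComponent_eq_self hFd] at this
    omega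
  rw [← homogeneousComponent_eq_self hFd]
  refine homogeneousComponent_mem_map_starMap k n d m hm ?_
  rw [← killOutside_univ F]
  refine killOutside_mem_starSpan _ _ _ _ fun v hv => ?_
  rw [killOutside_univ]
  rcases hv with ⟨i, -, rfl⟩ | ⟨i, -, j, -, hij, rfl⟩
  · have := hdeg i.castSucc (Fin.last (n + 1)) (Fin.castSucc_lt_last i)
    rw [starVec_castSucc, starVec_last, sub_zero] at this
    refine this.trans (le_of_eq ?_)
    rw [shearBound, Finset.sum_eq_single i]
    · simp
    · intro l _ hl
      simp [hl]
    · simp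
  · have := hdeg i.castSucc j.castSucc (by simpa using hij)
    rw [starVec_castSucc, starVec_castSucc] at this
    refine this.trans (le_of_eq ?_)
    rw [shearBound, ← Finset.sum_subset (Finset.subset_univ {i, j}), Finset.sum_pair hij.ne]
    · simp [hij.ne, hij.ne']
    · intro l _ hl
      simp only [Finset.mem_insert, Finset.mem_singleton, not_or] at hl
      simp [hl.1, hl.2]

/-- The linear relation between the `n + 2` hyperplane equations. -/
def starRel (k : Type) [Field k] (n : ℕ) : MvPolynomial (Fin (n + 2)) k :=
  X (Fin.last (n + 1)) - ∑ i : Fin (n + 1), X i.castSucc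

lemma starRel_mem (k : Type) [Field k] (n : ℕ) :
    starRel k n ∈ homogeneousSubmodule (Fin (n + 2)) k 1 :=
  Submodule.sub_mem _ (isHomogeneous_X k _) (Submodule.sum_mem _ fun _ _ => isHomogeneous_X k _)

lemma degreeOf_starRel (k : Type) [Field k] (n : ℕ) (i : Fin (n + 2)) :
    degreeOf i (starRel k n) = 1 := by
  refine le_antisymm ((degreeOf_le_totalDegree _ _).trans
    (IsHomogeneous.totalDegree_le (starRel_mem k n))) ?_
  have hmem : Finsupp.single i 1 ∈ (starRel k n).support := by
    rw [mem_support_iff]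
    induction i using Fin.lastCases with
    | last =>
      simp [starRel, coeff_sum, coeff_X, Finsupp.single_left_inj]
    | cast i =>
      have := (Fin.castSucc_lt_last i).ne'
      simp [starRel, coeff_sum, coeff_X, this, Finsupp.single_left_inj]
  simpa using monomial_le_degreeOf i hmem

lemma starRel_ne_zero (k : Type) [Field k] (n : ℕ) : starRel k n ≠ 0 := by
  intro h
  have := degreeOf_starRel k n 0
  simp [h] at this

lemma starMap_eq_zero_iff (k : Type) [Field k] (n : ℕ) (P : MvPolynomial (Fin (n + 2)) k) :
    starMap k n P = 0 ↔ starRel k n ∣ P := by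
  constructor
  · intro h
    rw [← Ideal.mem_span_singleton, ← Ideal.Quotient.eq_zero_iff_mem]
    let q := Ideal.Quotient.mkₐ k (Ideal.span {starRel k n})
    have hq : q (starRel k n) = 0 :=
      Ideal.Quotient.eq_zero_iff_mem.2 (Ideal.mem_span_singleton_self _)
    have key : (q.comp (rename Fin.castSucc)).comp (starMap k n) = q := by
      ext1 l
      induction l using Fin.lastCases with
      | last =>
        have hq : q (X (Fin.last (n + 1))) = q (∑ i : Fin (n + 1), X i.castSucc) := by
          rw [← sub_eq_zero, ← map_sub]
          exact hq
        simp [starMap, starForm_last, hq]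
      | cast i => simp [starMap, starForm_castSucc]
    have := congrArg (fun f => f P) key
    simp only [AlgHom.comp_apply, h, map_zero] at this
    exact this.symm
  · rintro ⟨G, rfl⟩
    have : starMap k n (starRel k n) = 0 := by
      simp [starMap, starRel, starForm_last, starForm_castSucc]
    rw [map_mul, this, zero_mul]

lemma isHomogeneous_iff_sum {k : Type} [Field k] {N e : ℕ} {P : MvPolynomial (Fin N) k} :
    P ∈ homogeneousSubmodule (Fin N) k e ↔ ∀ α ∈ P.support, ∑ i, α i = e := by
  have h : ∀ α : Fin N →₀ ℕ, Finsupp.weight 1 α = ∑ i, α i := fun α => by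
    rw [Finsupp.weight_apply, Finsupp.sum_fintype] <;> simp
  constructor
  · intro hP α hα
    rw [← h]
    exact hP (mem_support_iff.1 hα)
  · intro hP α hα
    rw [h]
    exact hP α (mem_support_iff.2 hα)

lemma restrictSupport_inf_ker_starMap (k : Type) [Field k] (n d : ℕ) (m : Fin (n + 2) → ℕ)
    (hm : ∀ i, m i ≤ d) :
    restrictSupport k (expSet d m) ⊓ LinearMap.ker (starMap k n).toLinearMap =
      (restrictSupport k (expSetPred d m)).map (LinearMap.mulLeft k (starRel k n)) := by
  apply le_antisymm
  · rintro P ⟨hP, hPk⟩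
    rw [SetLike.mem_coe, mem_restrictSupport_iff] at hP
    obtain ⟨G, rfl⟩ := (starMap_eq_zero_iff k n P).1 hPk
    rcases eq_or_ne G 0 with rfl | hG
    · simp
    refine ⟨G, ?_, rfl⟩
    have hhom : starRel k n * G ∈ homogeneousSubmodule (Fin (n + 2)) k d :=
      isHomogeneous_iff_sum.2 fun α hα => (hP hα).1
    have hdeg : ∀ i, 1 + degreeOf i G ≤ d - m i := by
      intro i
      rw [← degreeOf_starRel k n i, ← degreeOf_mul_eq (starRel_ne_zero k n) hG, degreeOf_le_iff]
      intro α hα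
      have := (hP hα).2 i
      omega
    obtain ⟨e, rfl⟩ : ∃ e, d = e + 1 := ⟨d - 1, by have := hdeg 0; omega⟩
    have hGe : homogeneousComponent e G = G := by
      refine mul_right_cancel₀ (starRel_ne_zero k n) ?_
      rw [← homogeneousComponent_mul_of_mem e G (starRel_mem k n), mul_comm G,
        homogeneousComponent_eq_self hhom]
    have hGhom : G ∈ homogeneousSubmodule (Fin (n + 2)) k e := by
      rw [← hGe]
      exact homogeneousComponent_isHomogeneous e G
    intro α hα
    refine ⟨by rw [isHomogeneous_iff_sum.1 hGhom α hα], fun i => ?_⟩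
    have h1 := hdeg i
    have h2 := monomial_le_degreeOf (f := G) i hα
    have h3 := hm i
    omega
  · rintro _ ⟨G, hG, rfl⟩
    rw [SetLike.mem_coe, mem_restrictSupport_iff] at hG
    rw [LinearMap.mulLeft_apply]
    refine ⟨?_, (starMap_eq_zero_iff k n _).2 (dvd_mul_right _ _)⟩
    rcases eq_or_ne G 0 with rfl | hG0
    · simp
    obtain ⟨α₀, hα₀⟩ := support_nonempty.2 hG0
    obtain ⟨e, rfl⟩ : ∃ e, d = e + 1 := ⟨_, (hG hα₀).1.symm⟩
    have hGhom : G ∈ homogeneousSubmodule (Fin (n + 2)) k e :=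
      isHomogeneous_iff_sum.2 fun α hα => Nat.succ_injective (hG hα).1
    have hhom : starRel k n * G ∈ homogeneousSubmodule (Fin (n + 2)) k (e + 1) := by
      rw [mul_comm]
      exact IsHomogeneous.mul hGhom (starRel_mem k n)
    intro α hα
    refine ⟨isHomogeneous_iff_sum.1 hhom α hα, fun i => ?_⟩
    have h1 : degreeOf i G ≤ e - m i := degreeOf_le_iff.2 fun β hβ => by
      have := (hG hβ).2 i
      omega
    have h2 := (monomial_le_degreeOf i hα).trans (degreeOf_mul_le i _ _)
    rw [degreeOf_starRel] at h2
    have h3 := (hG hα₀).2 i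
    omega

lemma finrank_restrictSupport (k : Type) {σ : Type} [Field k] (A : Set (σ →₀ ℕ)) :
    Module.finrank k (restrictSupport k A) = A.ncard := by
  rw [Module.finrank_eq_nat_card_basis (basisRestrictSupport k A), Nat.card_coe_set_eq]

lemma finite_expSet {n : ℕ} (d : ℕ) (m : Fin (n + 2) → ℕ) : (expSet d m).Finite := by
  refine (Set.finite_Iic (Finsupp.equivFunOnFinite.symm fun _ : Fin (n + 2) => d)).subset ?_
  intro α hα i
  have := hα.2 i
  simp
  omega

lemma finrank_starSys_add (k : Type) [Field k] (n d : ℕ) (m : Fin (n + 2) → ℕ)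
    (hm : ∀ i, m i ≤ d) :
    Module.finrank k (starSys k n d m) + (expSetPred d m).ncard = (expSet d m).ncard := by
  have : Finite (expSet d m) := finite_expSet d m
  have : Module.Finite k (restrictSupport k (expSet d m)) :=
    Module.Finite.of_basis (basisRestrictSupport k (expSet d m))
  have h := LinearMap.finrank_range_add_finrank_ker
    ((starMap k n).toLinearMap.domRestrict (restrictSupport k (expSet d m)))
  have hinj : Function.Injective (LinearMap.mulLeft k (starRel k n)) :=
    mul_right_injective₀ (starRel_ne_zero k n)
  rw [LinearMap.range_domRestrict, ← starSys_eq_map k n d m hm, finrank_restrictSupport,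
    LinearMap.ker_domRestrict, ← Submodule.finrank_map_subtype_eq, Submodule.map_comap_subtype,
    restrictSupport_inf_ker_starMap k n d m hm,
    ← (Submodule.equivMapOfInjective _ hinj _).finrank_eq, finrank_restrictSupport] at h
  exact h

/-- the dimension of the star linear system equals `N(d) − N(d−1)`,
where `N(e)` counts the `α ∈ ℕ^{n+2}` with `Σ α_i = e` and `α_i ≤ e − m_i`. -/
theorem stmt10 (k : Type) [Field k] [IsAlgClosed k] [CharZero k]
    (n d : ℕ) (hn : 2 ≤ n) (m : Fin (n + 2) → ℕ)
    (hm : ∀ i, m i ≤ d) (hb : (∑ i, m i) ≤ (n + 1) * d) :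
    (Module.finrank k ↥(starSys k n d m) : ℤ)
      = (Set.ncard {α : Fin (n + 2) → ℕ |
            (∑ i, (α i : ℤ)) = (d : ℤ) ∧ ∀ i, (α i : ℤ) ≤ (d : ℤ) - m i} : ℤ)
      - (Set.ncard {α : Fin (n + 2) → ℕ |
            (∑ i, (α i : ℤ)) = (d : ℤ) - 1 ∧ ∀ i, (α i : ℤ) ≤ (d : ℤ) - 1 - m i} : ℤ) := by
  have h1 : {α : Fin (n + 2) → ℕ |
      (∑ i, (α i : ℤ)) = (d : ℤ) ∧ ∀ i, (α i : ℤ) ≤ (d : ℤ) - m i} =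
      (fun α : Fin (n + 2) →₀ ℕ => (α : Fin (n + 2) → ℕ)) '' expSet d m := by
    ext α
    constructor
    · rintro ⟨h, h'⟩
      refine ⟨Finsupp.equivFunOnFinite.symm α, ⟨by exact_mod_cast h, fun i => ?_⟩, rfl⟩
      have := h' i
      simp only [Finsupp.equivFunOnFinite_symm_apply_apply]
      omega
    · rintro ⟨α, ⟨h, h'⟩, rfl⟩
      refine ⟨by exact_mod_cast h, fun i => ?_⟩
      change (α i : ℤ) ≤ _
      have := h' i
      omega
  have h2 : {α : Fin (n + 2) → ℕ |
      (∑ i, (α i : ℤ)) = (d : ℤ) - 1 ∧ ∀ i, (α i : ℤ) ≤ (d : ℤ) - 1 - m i} =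
      (fun α : Fin (n + 2) →₀ ℕ => (α : Fin (n + 2) → ℕ)) '' expSetPred d m := by
    ext α
    constructor
    · rintro ⟨h, h'⟩
      refine ⟨Finsupp.equivFunOnFinite.symm α,
        ⟨by exact_mod_cast eq_sub_iff_add_eq.1 h, fun i => ?_⟩, rfl⟩
      have := h' i
      simp only [Finsupp.equivFunOnFinite_symm_apply_apply]
      omega
    · rintro ⟨α, ⟨h, h'⟩, rfl⟩
      refine ⟨eq_sub_iff_add_eq.2 (by exact_mod_cast h), fun i => ?_⟩
      change (α i : ℤ) ≤ _
      have := h' i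
      omega
  rw [h1, h2, Set.ncard_image_of_injective _ DFunLike.coe_injective,
    Set.ncard_image_of_injective _ DFunLike.coe_injective, ← finrank_starSys_add k n d m hm]
  push_cast
  ring
end
end
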